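/- arXiv:1307.5332 — 2 statements merged into one kernel-verified Lean document; each statement's English description precedes it below -/
import Mathlib

section
/- Let q ≥ 2 and let N be the normal closure in the free group F_2 = ⟨a,t⟩ of the set {a^q} ∪ {[a, t^{−n} a t^n] : n ∈ ℤ}, so that F_2/N is the lamplighter group ℤ_q ≀ ℤ with its standard presentation. Let μ be the lazy simple random walk measure on Γ_2(N) = F_2/[N,N]. Then there exists a constant C ≥ 1 such that for all n ≥ 2: exp(−C·n/(log n)^2) ≤ μ^{(2n)}(e) ≤ exp(−(1/C)·n/(log n)^2). -/
open scoped Pointwise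

noncomputable section

open Classical in
/-- Convolution of two real-valued functions ("measures") on a group:
`(μ ∗ ν)(g) = Σ_h μ(h) ν(h⁻¹ g)`. -/
noncomputable def conv {G : Type*} [Group G] (μ ν : G → ℝ) : G → ℝ :=
  fun g => ∑' h : G, μ h * ν (h⁻¹ * g)

open Classical in
/-- `convPow μ n` is the `n`-fold convolution power of `μ`;
`convPow μ 0` is the Dirac mass at the identity. -/
noncomputable def convPow {G : Type*} [Group G] (μ : G → ℝ) : ℕ → G → ℝ
  | 0 => fun g => if g = 1 then 1 else 0
  | n + 1 => conv μ (convPow μ n)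

/-- Pushforward of a measure along a map. -/
noncomputable def pushforward {G H : Type*} (f : G → H) (μ : G → ℝ) : H → ℝ :=
  fun h => ∑' g : {g : G // f g = h}, μ g.1

open Classical in
/-- The lazy simple random walk measure on the free group on `r` generators:
mass `1/2` at the identity and mass `1/(4r)` at each `sᵢ^{±1}`. -/
noncomputable def lazySRW (r : ℕ) : FreeGroup (Fin r) → ℝ := fun g =>
  if g = 1 then 1 / 2
  else if ∃ i : Fin r, g = FreeGroup.of i ∨ g = (FreeGroup.of i)⁻¹ then 1 / (4 * r)
  else 0

/-- The lazy simple random walk measure on the quotient `F_r / M`, i.e. the pushforward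
of `lazySRW r` under the quotient map. -/
noncomputable def lazySRWQuot (r : ℕ) (M : Subgroup (FreeGroup (Fin r))) [M.Normal] :
    FreeGroup (Fin r) ⧸ M → ℝ :=
  pushforward (QuotientGroup.mk : FreeGroup (Fin r) → FreeGroup (Fin r) ⧸ M) (lazySRW r)

/-- Iterated logarithms: `iterLog 1 x = log (1 + x)` and
`iterLog (i+1) x = log (1 + iterLog i x)`. -/
noncomputable def iterLog : ℕ → ℝ → ℝ
  | 0, x => x
  | n + 1, x => Real.log (1 + iterLog n x)

instance derivedSeriesNormal (G : Type*) [Group G] (n : ℕ) : (derivedSeries G n).Normal :=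
  derivedSeries_normal G n

/-! ### Expectations over uniformly random words in eight letters -/

/-- Expectation over a uniformly random word of length `n` in eight letters. -/
def Ex : ℕ → (List (Fin 8) → ℝ) → ℝ
  | 0, f => f []
  | n + 1, f => (1 / 8) * ∑ s : Fin 8, Ex n (fun w => f (s :: w))

open Classical in
/-- Real-valued indicator of a proposition. -/
def ind (P : Prop) : ℝ := if P then 1 else 0

lemma ind_nonneg (P : Prop) : 0 ≤ ind P := by unfold ind; split_ifs <;> norm_num

lemma ind_le_one (P : Prop) : ind P ≤ 1 := by unfold ind; split_ifs <;> norm_num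

lemma ind_mono {P Q : Prop} (h : P → Q) : ind P ≤ ind Q := by
  unfold ind
  by_cases hP : P
  · simp [hP, h hP]
  · by_cases hQ : Q <;> simp [hP, hQ]

lemma ind_congr {P Q : Prop} (h : P ↔ Q) : ind P = ind Q :=
  le_antisymm (ind_mono h.1) (ind_mono h.2)

lemma ind_true {P : Prop} (h : P) : ind P = 1 := by simp [ind, h]

lemma ind_false {P : Prop} (h : ¬ P) : ind P = 0 := by simp [ind, h]

@[simp] lemma ind_T : ind True = 1 := ind_true trivial

lemma ind_add_le {P Q R : Prop} (hP : P → R) (hQ : Q → R) (hPQ : P → Q → False) :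
    ind P + ind Q ≤ ind R := by
  by_cases h1 : P
  · have h2 : ¬ Q := fun h => hPQ h1 h
    rw [ind_true h1, ind_false h2, ind_true (hP h1)]; norm_num
  · rw [ind_false h1, zero_add]; exact ind_mono hQ

lemma Ex_mono_len : ∀ (n : ℕ) {f g : List (Fin 8) → ℝ},
    (∀ w, w.length = n → f w ≤ g w) → Ex n f ≤ Ex n g
  | 0, f, g, h => h [] rfl
  | n + 1, f, g, h => by
      unfold Ex
      have : ∀ s ∈ (Finset.univ : Finset (Fin 8)),
          Ex n (fun w => f (s :: w)) ≤ Ex n (fun w => g (s :: w)) := fun s _ =>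
        Ex_mono_len n (fun w hw => h (s :: w) (by simp [hw]))
      have := Finset.sum_le_sum this
      linarith

lemma Ex_mono (n : ℕ) {f g : List (Fin 8) → ℝ} (h : ∀ w, f w ≤ g w) : Ex n f ≤ Ex n g :=
  Ex_mono_len n (fun w _ => h w)

lemma Ex_congr_len (n : ℕ) {f g : List (Fin 8) → ℝ}
    (h : ∀ w, w.length = n → f w = g w) : Ex n f = Ex n g :=
  le_antisymm (Ex_mono_len n fun w hw => (h w hw).le) (Ex_mono_len n fun w hw => (h w hw).ge)

lemma Ex_const (n : ℕ) (c : ℝ) : Ex n (fun _ => c) = c := by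
  induction n with
  | zero => rfl
  | succ n ih => simp [Ex, ih]

lemma Ex_add (n : ℕ) (f g : List (Fin 8) → ℝ) :
    Ex n (fun w => f w + g w) = Ex n f + Ex n g := by
  induction n generalizing f g with
  | zero => rfl
  | succ n ih => simp only [Ex, ih, Finset.sum_add_distrib]; ring

lemma Ex_mul (n : ℕ) (c : ℝ) (f : List (Fin 8) → ℝ) :
    Ex n (fun w => c * f w) = c * Ex n f := by
  induction n generalizing f with
  | zero => rfl
  | succ n ih => simp only [Ex, ih, ← Finset.mul_sum]; ring

lemma Ex_sum {ι : Type*} (n : ℕ) (S : Finset ι) (f : ι → List (Fin 8) → ℝ) :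
    Ex n (fun w => ∑ i ∈ S, f i w) = ∑ i ∈ S, Ex n (f i) := by
  classical
  induction S using Finset.induction_on with
  | empty => simp [Ex_const]
  | insert a S ha ih => simp only [Finset.sum_insert ha, Ex_add, ih]

lemma Ex_append (m n : ℕ) (f : List (Fin 8) → ℝ) :
    Ex (m + n) f = Ex m (fun u => Ex n (fun v => f (u ++ v))) := by
  induction m generalizing f with
  | zero => simp [Ex]
  | succ m ih =>
    rw [show m + 1 + n = (m + n) + 1 by ring]
    simp only [Ex, ih, List.cons_append]

lemma Ex_nonneg (n : ℕ) {f : List (Fin 8) → ℝ} (h : ∀ w, 0 ≤ f w) : 0 ≤ Ex n f := by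
  have := Ex_mono n h
  rwa [Ex_const] at this

lemma Ex_ind_le_one (n : ℕ) (P : List (Fin 8) → Prop) : Ex n (fun w => ind (P w)) ≤ 1 := by
  have := Ex_mono n (fun w => ind_le_one (P w))
  rwa [Ex_const] at this

lemma Ex_ind_eq (b : List (Fin 8)) : Ex b.length (fun w => ind (w = b)) = (1 / 8) ^ b.length := by
  induction b with
  | nil => simp [Ex, ind]
  | cons s b ih =>
    simp only [List.length_cons, Ex]
    rw [Finset.sum_eq_single s]
    · have : (fun w : List (Fin 8) => ind (s :: w = s :: b)) = fun w => ind (w = b) := by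
        funext w; exact ind_congr (by simp)
      rw [this, ih, pow_succ]; ring
    · intro s' _ hs
      have : (fun w : List (Fin 8) => ind (s' :: w = s :: b)) = fun w => 0 := by
        funext w; exact ind_false (by simp [hs])
      rw [this, Ex_const]
    · simp

/-- If two words of length `n` have joint weight at most `c`, the expectation drops. -/
lemma Ex_pair (n : ℕ) (b₀ b₁ : List (Fin 8)) (h₀ : b₀.length = n) (h₁ : b₁.length = n)
    (hne : b₀ ≠ b₁) (g : List (Fin 8) → ℝ) (c : ℝ) (hg : ∀ w, g w ≤ c)
    (hp : g b₀ + g b₁ ≤ c) : Ex n g ≤ c * (1 - (1 / 8) ^ n) := by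
  have key : ∀ w, g w ≤ c + (-(c - g b₀)) * ind (w = b₀) + (-(c - g b₁)) * ind (w = b₁) := by
    intro w
    by_cases e0 : w = b₀
    · have : w ≠ b₁ := e0 ▸ hne
      rw [ind_true e0, ind_false this, e0]; linarith
    · by_cases e1 : w = b₁
      · rw [ind_true e1, ind_false e0, e1]; linarith
      · rw [ind_false e0, ind_false e1]; linarith [hg w]
  have h := Ex_mono n key
  rw [Ex_add, Ex_add, Ex_const, Ex_mul, Ex_mul] at h
  have i0 : Ex n (fun w => ind (w = b₀)) = (1 / 8) ^ n := by rw [← h₀]; exact Ex_ind_eq b₀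
  have i1 : Ex n (fun w => ind (w = b₁)) = (1 / 8) ^ n := by rw [← h₁]; exact Ex_ind_eq b₁
  rw [i0, i1] at h
  have : (0 : ℝ) < (1 / 8) ^ n := by positivity
  nlinarith

/-! ### The convolution powers as word expectations -/

/-- The eight letters as elements of the free group. -/
def lt : Fin 8 → FreeGroup (Fin 2) :=
  ![1, 1, 1, 1, FreeGroup.of 0, (FreeGroup.of 0)⁻¹, FreeGroup.of 1, (FreeGroup.of 1)⁻¹]

/-- The element of the free group represented by a word. -/
def wp (w : List (Fin 8)) : FreeGroup (Fin 2) := (w.map lt).prod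

@[simp] lemma wp_nil : wp [] = 1 := rfl

@[simp] lemma wp_cons (s : Fin 8) (w : List (Fin 8)) : wp (s :: w) = lt s * wp w := by
  simp [wp]

@[simp] lemma wp_append (u w : List (Fin 8)) : wp (u ++ w) = wp u * wp w := by
  simp [wp]

lemma lazySRW_eq (g : FreeGroup (Fin 2)) :
    lazySRW 2 g = ∑ s : Fin 8, (1 / 8) * ind (lt s = g) := by
  have e1 : (1 : FreeGroup (Fin 2)) ≠ FreeGroup.of 0 := by decide
  have e2 : (1 : FreeGroup (Fin 2)) ≠ (FreeGroup.of 0)⁻¹ := by decide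
  have e3 : (1 : FreeGroup (Fin 2)) ≠ FreeGroup.of 1 := by decide
  have e4 : (1 : FreeGroup (Fin 2)) ≠ (FreeGroup.of 1)⁻¹ := by decide
  have e5 : (FreeGroup.of 0 : FreeGroup (Fin 2)) ≠ (FreeGroup.of 0)⁻¹ := by decide
  have e6 : (FreeGroup.of 0 : FreeGroup (Fin 2)) ≠ FreeGroup.of 1 := by decide
  have e7 : (FreeGroup.of 0 : FreeGroup (Fin 2)) ≠ (FreeGroup.of 1)⁻¹ := by decide
  have e8 : ((FreeGroup.of 0)⁻¹ : FreeGroup (Fin 2)) ≠ FreeGroup.of 1 := by decide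
  have e9 : ((FreeGroup.of 0)⁻¹ : FreeGroup (Fin 2)) ≠ (FreeGroup.of 1)⁻¹ := by decide
  have e10 : (FreeGroup.of 1 : FreeGroup (Fin 2)) ≠ (FreeGroup.of 1)⁻¹ := by decide
  unfold lazySRW ind lt
  simp only [Fin.sum_univ_eight, Fin.exists_fin_two]
  by_cases h1 : g = 1
  · subst h1
    simp [e1.symm, e2.symm, e3.symm, e4.symm]; norm_num
  by_cases h2 : g = FreeGroup.of 0
  · subst h2
    simp [e1, e5.symm, e6.symm, e7.symm]; norm_num
  by_cases h3 : g = (FreeGroup.of 0)⁻¹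
  · subst h3
    simp [e2, e5, e8.symm, e9.symm]; norm_num
  by_cases h4 : g = FreeGroup.of 1
  · subst h4
    simp [e3, e6, e8, e10.symm]; norm_num
  by_cases h5 : g = (FreeGroup.of 1)⁻¹
  · subst h5
    simp [e4, e7, e9, e10]; norm_num
  simp [h1, h2, h3, h4, h5, Ne.symm h1, Ne.symm h2, Ne.symm h3, Ne.symm h4, Ne.symm h5]

section quot
variable (M : Subgroup (FreeGroup (Fin 2))) [M.Normal]

lemma lazySRWQuot_eq (h : FreeGroup (Fin 2) ⧸ M) :
    lazySRWQuot 2 M h = ∑ s : Fin 8, (1 / 8) * ind ((lt s : FreeGroup (Fin 2) ⧸ M) = h) := by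
  classical
  unfold lazySRWQuot pushforward
  simp only [lazySRW_eq]
  have : ∀ s : Fin 8, HasSum (fun g : {g : FreeGroup (Fin 2) // (g : FreeGroup (Fin 2) ⧸ M) = h} =>
      (1 / 8 : ℝ) * ind (lt s = g.1))
      ((1 / 8) * ind ((lt s : FreeGroup (Fin 2) ⧸ M) = h)) := by
    intro s
    by_cases hs : (lt s : FreeGroup (Fin 2) ⧸ M) = h
    · have := hasSum_single (f := fun g : {g : FreeGroup (Fin 2) //
        (g : FreeGroup (Fin 2) ⧸ M) = h} => (1 / 8 : ℝ) * ind (lt s = g.1)) ⟨lt s, hs⟩ (by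
          intro b hb
          have : lt s ≠ b.1 := fun e => hb (Subtype.ext e.symm)
          simp [ind_false this])
      simpa [ind_true hs, ind_true (rfl : lt s = lt s)] using this
    · rw [ind_false hs, mul_zero]
      convert hasSum_zero with g
      have : lt s ≠ g.1 := fun e => hs (e ▸ g.2)
      simp [ind_false this]
  exact (hasSum_sum (fun s _ => this s)).tsum_eq

/-- Probability that a random word of length `n` represents `g` in the quotient. -/
def pr (n : ℕ) (g : FreeGroup (Fin 2) ⧸ M) : ℝ :=
  Ex n (fun w => ind ((wp w : FreeGroup (Fin 2) ⧸ M) = g))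

lemma pr_succ (n : ℕ) (g : FreeGroup (Fin 2) ⧸ M) :
    pr M (n + 1) g = (1 / 8) * ∑ s : Fin 8, pr M n ((lt s : FreeGroup (Fin 2) ⧸ M)⁻¹ * g) := by
  unfold pr
  simp only [Ex]
  congr 1
  refine Finset.sum_congr rfl fun s _ => ?_
  congr 1
  funext w
  apply ind_congr
  rw [wp_cons, QuotientGroup.mk_mul, eq_inv_mul_iff_mul_eq]

lemma pr_succ' (n : ℕ) (g : FreeGroup (Fin 2) ⧸ M) :
    pr M (n + 1) g = (1 / 8) * ∑ s : Fin 8, pr M n (g * (lt s : FreeGroup (Fin 2) ⧸ M)⁻¹) := by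
  unfold pr
  rw [Ex_append, ← Ex_sum, ← Ex_mul]
  congr 1
  funext w
  simp only [Ex]
  congr 1
  refine Finset.sum_congr rfl fun s _ => ?_
  apply ind_congr
  rw [wp_append, QuotientGroup.mk_mul, eq_mul_inv_iff_mul_eq]
  simp

lemma convPow_eq (n : ℕ) (g : FreeGroup (Fin 2) ⧸ M) :
    convPow (lazySRWQuot 2 M) n g = pr M n g := by
  classical
  induction n generalizing g with
  | zero =>
    simp only [convPow, pr, Ex, ind, wp_nil, QuotientGroup.mk_one]
    by_cases h : g = 1
    · simp [h]
    · simp [h, Ne.symm h]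
  | succ n ih =>
    rw [pr_succ]
    simp only [convPow, conv, lazySRWQuot_eq, ih, Finset.sum_mul]
    have : ∀ s : Fin 8, HasSum (fun h : FreeGroup (Fin 2) ⧸ M =>
        (1 / 8 : ℝ) * ind ((lt s : FreeGroup (Fin 2) ⧸ M) = h) * pr M n (h⁻¹ * g))
        ((1 / 8) * pr M n ((lt s : FreeGroup (Fin 2) ⧸ M)⁻¹ * g)) := by
      intro s
      have := hasSum_single (f := fun h : FreeGroup (Fin 2) ⧸ M =>
        (1 / 8 : ℝ) * ind ((lt s : FreeGroup (Fin 2) ⧸ M) = h) * pr M n (h⁻¹ * g)) (lt s)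
        (fun b hb => by simp [ind_false (Ne.symm hb)])
      simpa [ind_true rfl] using this
    rw [(hasSum_sum (fun s _ => this s)).tsum_eq, Finset.mul_sum]

lemma pr_inv (n : ℕ) (g : FreeGroup (Fin 2) ⧸ M) : pr M n g⁻¹ = pr M n g := by
  induction n generalizing g with
  | zero =>
    simp only [pr, Ex]
    apply ind_congr
    simp [eq_comm]
  | succ n ih =>
    rw [pr_succ, pr_succ']
    congr 1
    have : ∀ s : Fin 8, pr M n ((lt s : FreeGroup (Fin 2) ⧸ M)⁻¹ * g⁻¹)
        = pr M n (g * (lt s : FreeGroup (Fin 2) ⧸ M)) := by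
      intro s; rw [← mul_inv_rev, ih]
    rw [Finset.sum_congr rfl fun s _ => this s]
    simp only [Fin.sum_univ_eight, lt]
    simp
    ring

lemma pr_nonneg (n : ℕ) (g : FreeGroup (Fin 2) ⧸ M) : 0 ≤ pr M n g :=
  Ex_nonneg n fun _ => ind_nonneg _

/-- Cauchy-Schwarz lower bound for the return probability. -/
lemma pr_return_lower (n : ℕ) (A : Finset (FreeGroup (Fin 2) ⧸ M)) :
    (Ex n (fun w => ind ((wp w : FreeGroup (Fin 2) ⧸ M) ∈ A))) ^ 2
      ≤ A.card * pr M (2 * n) 1 := by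
  have h1 : pr M (2 * n) 1 = Ex n (fun u => pr M n (wp u : FreeGroup (Fin 2) ⧸ M)) := by
    rw [two_mul]
    unfold pr
    rw [Ex_append]
    congr 1
    funext u
    have := pr_inv M n (wp u : FreeGroup (Fin 2) ⧸ M)
    unfold pr at this
    rw [← this]
    congr 1
    funext v
    apply ind_congr
    rw [wp_append, QuotientGroup.mk_mul, mul_eq_one_iff_inv_eq, eq_comm]
  have h2 : ∑ g ∈ A, pr M n g ^ 2 ≤ pr M (2 * n) 1 := by
    rw [h1]
    have : ∑ g ∈ A, pr M n g ^ 2 =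
        Ex n (fun u => ∑ g ∈ A, pr M n g * ind ((wp u : FreeGroup (Fin 2) ⧸ M) = g)) := by
      rw [Ex_sum]
      refine Finset.sum_congr rfl fun g _ => ?_
      rw [Ex_mul, sq]; rfl
    rw [this]
    apply Ex_mono
    intro u
    by_cases hu : (wp u : FreeGroup (Fin 2) ⧸ M) ∈ A
    · rw [Finset.sum_eq_single_of_mem _ hu]
      · simp [ind_true rfl]
      · intro b _ hb; simp [ind_false (Ne.symm hb)]
    · rw [Finset.sum_eq_zero]
      · exact pr_nonneg M n _
      · intro g hg
        rw [ind_false, mul_zero]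
        rintro rfl; exact hu hg
  have h3 : Ex n (fun w => ind ((wp w : FreeGroup (Fin 2) ⧸ M) ∈ A)) ≤ ∑ g ∈ A, pr M n g := by
    unfold pr
    rw [← Ex_sum]
    apply Ex_mono
    intro u
    by_cases hu : (wp u : FreeGroup (Fin 2) ⧸ M) ∈ A
    · rw [ind_true hu]
      have := Finset.single_le_sum (f := fun g => ind ((wp u : FreeGroup (Fin 2) ⧸ M) = g))
        (fun i _ => ind_nonneg _) hu
      simpa [ind_true rfl] using this
    · rw [ind_false hu]
      exact Finset.sum_nonneg fun i _ => ind_nonneg _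
  have h4 := sq_sum_le_card_mul_sum_sq (s := A) (f := fun g => pr M n g)
  have h5 : 0 ≤ Ex n (fun w => ind ((wp w : FreeGroup (Fin 2) ⧸ M) ∈ A)) :=
    Ex_nonneg n fun _ => ind_nonneg _
  calc _ ≤ (∑ g ∈ A, pr M n g) ^ 2 := pow_le_pow_left₀ h5 h3 2
    _ ≤ _ := h4
    _ ≤ _ := by gcongr

end quot

/-! ### The walk on the integers and on the lamplighter states -/

/-- Displacement of a letter in the `t` direction. -/
def dp : Fin 8 → ℤ := ![0, 0, 0, 0, 0, 0, 1, -1]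

/-- Lamp increment of a letter. -/
def da : Fin 8 → ℤ := ![0, 0, 0, 0, 1, -1, 0, 0]

lemma abs_dp (s : Fin 8) : |dp s| ≤ 1 := by
  fin_cases s <;> simp [dp]

/-- Along the word `w` started at `p`, some position is at distance at least `m` from `c`. -/
def reach (c : ℤ) (m : ℕ) : ℤ → List (Fin 8) → Prop
  | p, [] => (m : ℤ) ≤ |p - c|
  | p, s :: w => (m : ℤ) ≤ |p - c| ∨ reach c m (p + dp s) w

lemma exit_time (c : ℤ) (k n : ℕ) (p : ℤ) (hp : |p - c| ≤ k) :
    n * Ex n (fun w => ind (¬ reach c k p w)) ≤ 4 * ((k : ℝ) ^ 2 - ((p : ℝ) - c) ^ 2) := by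
  have hsq : ∀ p : ℤ, |p - c| ≤ k → ((p : ℝ) - c) ^ 2 ≤ (k : ℝ) ^ 2 := by
    intro p hp
    have : ((|p - c| : ℤ) : ℝ) ≤ k := by exact_mod_cast hp
    rw [Int.cast_abs, Int.cast_sub] at this
    rw [← sq_abs]
    exact pow_le_pow_left₀ (abs_nonneg _) this 2
  induction n generalizing p with
  | zero => have := hsq p hp; simp; linarith
  | succ n ih =>
    by_cases h : (k : ℤ) ≤ |p - c|
    · have : (fun w => ind (¬ reach c k p w)) = fun _ => 0 := by
        funext w
        apply ind_false
        cases w <;> simp [reach, h]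
      rw [this, Ex_const]
      have := hsq p hp; simp; linarith
    · have hle := Ex_ind_le_one (n + 1) (fun w => ¬ reach c k p w)
      have hlt : |p - c| + 1 ≤ k := by omega
      have hstep : ∀ s : Fin 8, n * Ex n (fun w => ind (¬ reach c k p (s :: w))) ≤
          4 * ((k : ℝ) ^ 2 - (((p + dp s : ℤ) : ℝ) - c) ^ 2) := by
        intro s
        have h1 := ih (p + dp s) (by
          have := abs_add_le (p - c) (dp s)
          have := abs_dp s
          rw [show p + dp s - c = p - c + dp s by ring]; omega)
        refine le_trans (le_of_eq ?_) h1
        congr 2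
        funext w
        apply ind_congr
        simp [reach, h]
      have hsum := Finset.sum_le_sum (fun s (_ : s ∈ (Finset.univ : Finset (Fin 8))) => hstep s)
      rw [← Finset.mul_sum] at hsum
      have e : Ex (n + 1) (fun w => ind (¬ reach c k p w)) =
        (1 / 8) * ∑ s : Fin 8, Ex n (fun w => ind (¬ reach c k p (s :: w))) := rfl
      have e2 : ∑ s : Fin 8, 4 * ((k : ℝ) ^ 2 - (((p + dp s : ℤ) : ℝ) - c) ^ 2) =
          32 * ((k : ℝ) ^ 2 - ((p : ℝ) - c) ^ 2) - 8 := by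
        simp [Fin.sum_univ_eight, dp]; ring
      rw [e2] at hsum
      push_cast
      nlinarith [hsum, hle, e]

section model
variable (q : ℕ)

/-- Total lamp change along a word started at position `p`. -/
def lamp : ℤ → List (Fin 8) → ℤ → ZMod q
  | _, [] => 0
  | p, s :: w => Pi.single p (da s : ZMod q) + lamp (p + dp s) w

lemma lamp_reach (hq : 2 ≤ q) (c : ℤ) (n : ℕ) : ∀ (i k : ℕ) (p : ℤ) (Ψ : ℤ → ZMod q),
    |p - c| ≤ i + 1 →
    Ex n (fun w => ind ((∀ j : ℤ, (i : ℤ) < |j - c| → lamp q p w j = Ψ j) ∧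
      reach c (i + k + 1) p w)) ≤ (7 / 8) ^ k := by
  have : Fact (1 < q) := ⟨hq⟩
  induction n with
  | zero =>
    intro i k p Ψ hp
    rcases Nat.eq_zero_or_pos k with rfl | hk
    · simpa using Ex_ind_le_one 0 _
    · simp only [Ex, reach]
      rw [ind_false]
      · positivity
      · rintro ⟨_, h⟩
        push_cast at h; omega
  | succ n ih =>
    intro i k p Ψ hp
    rcases Nat.eq_zero_or_pos k with rfl | hk
    · simpa using Ex_ind_le_one (n + 1) _
    have hdp : ∀ s, |p + dp s - c| ≤ |p - c| + 1 := by
      intro s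
      have := abs_add_le (p - c) (dp s)
      have := abs_dp s
      rw [show p + dp s - c = p - c + dp s by ring]; omega
    have hnr : ¬ ((i + k + 1 : ℕ) : ℤ) ≤ |p - c| := by push_cast; omega
    by_cases hpi : |p - c| ≤ i
    · -- still inside
      have : ∀ s : Fin 8, Ex n (fun w => ind ((∀ j : ℤ, (i : ℤ) < |j - c| →
          lamp q p (s :: w) j = Ψ j) ∧ reach c (i + k + 1) p (s :: w))) ≤ (7 / 8) ^ k := by
        intro s
        refine le_trans (Ex_mono n fun w => ind_mono ?_)
          (ih i k (p + dp s) Ψ (by have := hdp s; omega))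
        rintro ⟨h1, h2⟩
        refine ⟨fun j hj => ?_, ?_⟩
        · have hne : j ≠ p := by rintro rfl; omega
          have := h1 j hj
          simpa [lamp, Pi.single_eq_of_ne hne] using this
        · rcases h2 with h2 | h2
          · exact absurd h2 hnr
          · exact h2
      have hs := Finset.sum_le_sum (fun s (_ : s ∈ (Finset.univ : Finset (Fin 8))) => this s)
      simp only [Ex]
      simp only [Finset.sum_const, Finset.card_univ, Fintype.card_fin, nsmul_eq_mul] at hs
      push_cast at hs
      linarith
    · have hpe : |p - c| = i + 1 := by omega
      obtain ⟨k, rfl⟩ : ∃ k', k = k' + 1 := ⟨k - 1, by omega⟩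
      set f : Fin 8 → List (Fin 8) → ℝ := fun s w => ind ((∀ j : ℤ, (i : ℤ) < |j - c| →
          lamp q p (s :: w) j = Ψ j) ∧ reach c (i + (k + 1) + 1) p (s :: w)) with hf
      have hr : ∀ s w, reach c (i + (k + 1) + 1) p (s :: w) →
          reach c ((i + 1) + k + 1) (p + dp s) w := by
        rintro s w (h | h)
        · exact absurd h hnr
        · rwa [show i + 1 + k + 1 = i + (k + 1) + 1 by ring]
      have hl : ∀ s w, (∀ j : ℤ, (i : ℤ) < |j - c| → lamp q p (s :: w) j = Ψ j) →
          (∀ j : ℤ, ((i + 1 : ℕ) : ℤ) < |j - c| → lamp q (p + dp s) w j = Ψ j) := by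
        intro s w h j hj
        push_cast at hj
        have hne : j ≠ p := by rintro rfl; omega
        have := h j (by omega)
        simpa [lamp, Pi.single_eq_of_ne hne] using this
      have h1 : ∀ s, Ex n (f s) ≤ (7 / 8) ^ k := fun s =>
        le_trans (Ex_mono n fun w => ind_mono fun h => ⟨hl s w h.1, hr s w h.2⟩)
          (ih (i + 1) k (p + dp s) Ψ (by have := hdp s; push_cast; omega))
      have h2 : Ex n (f 0) + Ex n (f 4) ≤ (7 / 8) ^ k := by
        rw [← Ex_add]
        refine le_trans (Ex_mono n fun w => ind_add_le
          (R := (∀ j : ℤ, ((i + 1 : ℕ) : ℤ) < |j - c| → lamp q p w j = Ψ j) ∧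
            reach c ((i + 1) + k + 1) p w) ?_ ?_ ?_)
          (ih (i + 1) k p Ψ (by push_cast; omega))
        · intro h
          simpa [dp] using And.intro (hl 0 w h.1) (hr 0 w h.2)
        · intro h
          simpa [dp] using And.intro (hl 4 w h.1) (hr 4 w h.2)
        · intro h h'
          have e1 := h.1 p (by omega)
          have e2 := h'.1 p (by omega)
          rw [← e2] at e1
          simp [lamp, dp, da] at e1
      simp only [Ex]
      have hs : ∑ s : Fin 8, Ex n (f s) ≤ 7 * (7 / 8) ^ k := by
        rw [Fin.sum_univ_eight]
        linarith [h1 1, h1 2, h1 3, h1 5, h1 6, h1 7]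
      rw [pow_succ]
      change 1 / 8 * ∑ s : Fin 8, Ex n (f s) ≤ _
      linarith

/-- Lamplighter states: lamp configuration and position. -/
abbrev XS : Type := (ℤ → ZMod q) × ℤ

/-- Action of a letter on a state. -/
def act (s : Fin 8) (x : XS q) : XS q := (x.1 + Pi.single x.2 (da s : ZMod q), x.2 + dp s)

/-- Final state after following a word. -/
def rn : XS q → List (Fin 8) → XS q
  | x, [] => x
  | x, s :: w => rn (act q s x) w

lemma rn_append (x : XS q) (u v : List (Fin 8)) : rn q x (u ++ v) = rn q (rn q x u) v := by
  induction u generalizing x with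
  | nil => rfl
  | cons s u ih => simp [rn, ih]

lemma rn_fst (x : XS q) (w : List (Fin 8)) : (rn q x w).1 = x.1 + lamp q x.2 w := by
  induction w generalizing x with
  | nil => simp [rn, lamp]
  | cons s w ih => simp [rn, lamp, ih, act, add_assoc]

/-- A finite set of states is left with probability bounded below. -/
lemma exit_prob (hq : 2 ≤ q) (A : Finset (XS q)) (x : XS q) (L k : ℕ) :
    L * Ex L (fun u => ind (rn q x u ∈ A)) ≤
      4 * ((k : ℝ) + 1) ^ 2 + L * (A.card * (7 / 8 : ℝ) ^ k) := by
  have h1 : Ex L (fun u => ind (rn q x u ∈ A)) ≤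
      Ex L (fun u => ind (¬ reach x.2 (k + 1) x.2 u)) +
      ∑ y ∈ A, Ex L (fun u => ind ((∀ j : ℤ, ((0 : ℕ) : ℤ) < |j - x.2| →
        lamp q x.2 u j = (y.1 - x.1) j) ∧ reach x.2 (0 + k + 1) x.2 u)) := by
    rw [← Ex_sum, ← Ex_add]
    apply Ex_mono
    intro u
    have hnn : 0 ≤ ∑ y ∈ A, ind ((∀ j : ℤ, ((0 : ℕ) : ℤ) < |j - x.2| →
        lamp q x.2 u j = (y.1 - x.1) j) ∧ reach x.2 (0 + k + 1) x.2 u) :=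
      Finset.sum_nonneg fun _ _ => ind_nonneg _
    by_cases hr : reach x.2 (k + 1) x.2 u
    · by_cases hA : rn q x u ∈ A
      · have := Finset.single_le_sum (f := fun y : XS q => ind ((∀ j : ℤ, ((0 : ℕ) : ℤ) < |j - x.2| →
          lamp q x.2 u j = (y.1 - x.1) j) ∧ reach x.2 (0 + k + 1) x.2 u))
          (fun _ _ => ind_nonneg _) hA
        have h0 := ind_nonneg (¬ reach x.2 (k + 1) x.2 u)
        have e : ind ((∀ j : ℤ, ((0 : ℕ) : ℤ) < |j - x.2| →
          lamp q x.2 u j = ((rn q x u).1 - x.1) j) ∧ reach x.2 (0 + k + 1) x.2 u) = 1 := by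
          apply ind_true
          refine ⟨fun j _ => ?_, by simpa using hr⟩
          rw [rn_fst]; simp
        have := ind_le_one (rn q x u ∈ A)
        linarith
      · rw [ind_false hA]
        have := ind_nonneg (¬ reach x.2 (k + 1) x.2 u)
        linarith
    · have := ind_le_one (rn q x u ∈ A)
      rw [ind_true hr]
      linarith
  have h2 : ∑ y ∈ A, Ex L (fun u => ind ((∀ j : ℤ, ((0 : ℕ) : ℤ) < |j - x.2| →
        lamp q x.2 u j = (y.1 - x.1) j) ∧ reach x.2 (0 + k + 1) x.2 u)) ≤
        A.card * (7 / 8 : ℝ) ^ k := by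
    rw [← nsmul_eq_mul]
    apply Finset.sum_le_card_nsmul
    intro y _
    exact lamp_reach q hq x.2 L 0 k x.2 (y.1 - x.1) (by simp)
  have h3 := exit_time x.2 (k + 1) L x.2 (by simp; positivity)
  simp only [sub_self] at h3
  push_cast at h3
  have hL : (0 : ℝ) ≤ L := by positivity
  have h4 := mul_le_mul_of_nonneg_left (h1.trans (add_le_add_right h2 _)) hL
  rw [mul_add] at h4
  linarith

open Classical in
/-- Signed flow of one letter through the `a`-edges. -/
def dflow (x : XS q) (s : Fin 8) : XS q → ℤ :=
  if s = 4 then Pi.single x 1 else if s = 5 then - Pi.single (act q 5 x) 1 else 0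

/-- Flow of a word through the `a`-edges. -/
def flow : XS q → List (Fin 8) → XS q → ℤ
  | _, [] => 0
  | x, s :: w => dflow q x s + flow (act q s x) w

lemma flow_append (x : XS q) (u v : List (Fin 8)) :
    flow q x (u ++ v) = flow q x u + flow q (rn q x u) v := by
  induction u generalizing x with
  | nil => simp [flow, rn]
  | cons s u ih => simp [flow, rn, ih, add_assoc]

lemma act_zero (x : XS q) : act q 0 x = x := by
  simp [act, da, dp]

lemma act_four (x : XS q) : act q 4 x = (x.1 + Pi.single x.2 1, x.2) := by
  simp [act, da, dp]

lemma rn_rep_zero (m : ℕ) (x : XS q) : rn q x (List.replicate m 0) = x := by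
  induction m with
  | zero => rfl
  | succ m ih => simp [List.replicate_succ, rn, act_zero, ih]

lemma flow_rep_zero (m : ℕ) (x : XS q) : flow q x (List.replicate m 0) = 0 := by
  induction m with
  | zero => rfl
  | succ m ih => simp [List.replicate_succ, flow, act_zero, ih, dflow]

lemma rn_rep_four (m : ℕ) (x : XS q) :
    rn q x (List.replicate m 4) = (x.1 + Pi.single x.2 (m : ZMod q), x.2) := by
  induction m generalizing x with
  | zero => simp [rn]
  | succ m ih =>
    rw [List.replicate_succ, rn, ih, act_four]
    simp [add_assoc, ← Pi.single_add, add_comm (1 : ZMod q)]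

lemma flow_rep_four_nonneg (m : ℕ) (x y : XS q) : 0 ≤ flow q x (List.replicate m 4) y := by
  classical
  induction m generalizing x with
  | zero => simp [flow]
  | succ m ih =>
    rw [List.replicate_succ, flow]
    have := ih (act q 4 x)
    have h2 : 0 ≤ dflow q x 4 y := by
      simp only [dflow, if_true, Pi.single_apply]; split_ifs <;> simp
    simp only [Pi.add_apply]
    omega

lemma flow_rep_four_pos (m : ℕ) (x : XS q) : 1 ≤ flow q x (List.replicate (m + 1) 4) x := by
  have := flow_rep_four_nonneg q m (act q 4 x) x
  rw [List.replicate_succ, flow]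
  have h2 : dflow q x 4 x = 1 := by
    simp [dflow]
  simp only [Pi.add_apply]
  omega

open Classical in
/-- The `a`-coset of a state (first `m` elements). -/
def coset (m : ℕ) (x : XS q) : Finset (XS q) :=
  (Finset.range m).image fun j : ℕ => (x.1 + Pi.single x.2 (j : ZMod q), x.2)

lemma coset_card (m : ℕ) (x : XS q) : (coset q m x).card ≤ m := by
  classical
  unfold coset
  exact Finset.card_image_le.trans (by simp)

lemma flow_rep_four_off (m : ℕ) (x y : XS q) (hy : y ∉ coset q m x) :
    flow q x (List.replicate m 4) y = 0 := by
  classical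
  induction m with
  | zero => simp [flow]
  | succ m ih =>
    rw [List.replicate_succ', flow_append, rn_rep_four]
    have h1 : y ∉ coset q m x := by
      intro h
      apply hy
      simp only [coset, Finset.mem_image, Finset.mem_range] at h ⊢
      obtain ⟨j, hj, e⟩ := h
      exact ⟨j, by omega, e⟩
    have h2 : y ≠ (x.1 + Pi.single x.2 (m : ZMod q), x.2) := by
      rintro rfl
      apply hy
      simp only [coset, Finset.mem_image, Finset.mem_range]
      exact ⟨m, by omega, rfl⟩
    simp [ih h1, flow, dflow, Pi.single_eq_of_ne h2]

/-- Main upper estimate on the flow. -/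
lemma flow_prob (hq : 2 ≤ q) (L T : ℕ)
    (hL : ∀ (A : Finset (XS q)) (x : XS q), A.card ≤ T →
      Ex L (fun u => ind (rn q x u ∈ A)) ≤ 3 / 4) (m : ℕ) :
    ∀ (r : ℕ) (A : Finset (XS q)) (x : XS q) (Ψ : XS q → ℤ), A.card + q * m ≤ T →
    Ex (m * (L + q) + r) (fun w => ind (∀ y, y ∉ A → flow q x w y = Ψ y)) ≤
      (1 - (1 / 8) ^ q / 4) ^ m := by
  classical
  have hθ : (0 : ℝ) ≤ 1 - (1 / 8) ^ q / 4 := by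
    have : (1 / 8 : ℝ) ^ q ≤ 1 := pow_le_one₀ (by norm_num) (by norm_num)
    linarith
  induction m with
  | zero => intro r A x Ψ _; simpa using Ex_ind_le_one _ _
  | succ m ih =>
    intro r A x Ψ hA
    rw [mul_add, mul_one] at hA
    rw [show (m + 1) * (L + q) + r = L + (q + (m * (L + q) + r)) by ring]
    rw [Ex_append]
    set R := m * (L + q) + r with hR
    set θ : ℝ := 1 - (1 / 8) ^ q / 4 with hθd
    have hin : ∀ (u b : List (Fin 8)), Ex R (fun v => ind (∀ y, y ∉ A →
        flow q x (u ++ (b ++ v)) y = Ψ y)) ≤ θ ^ m := by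
      intro u b
      refine le_trans (Ex_mono R fun v => ind_mono ?_)
        (ih r A (rn q (rn q x u) b) (Ψ - flow q x u - flow q (rn q x u) b) (by omega))
      intro h y hy
      have := h y hy
      rw [flow_append, flow_append] at this
      simp only [Pi.add_apply, Pi.sub_apply] at this ⊢
      omega
    have hu : ∀ u, Ex (q + R) (fun w => ind (∀ y, y ∉ A → flow q x (u ++ w) y = Ψ y)) ≤
        θ ^ m * (1 - (1 / 8) ^ q) + θ ^ m * (1 / 8) ^ q * ind (rn q x u ∈ A) := by
      intro u
      rw [Ex_append]
      by_cases hx : rn q x u ∈ A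
      · rw [ind_true hx]
        have := Ex_mono q (hin u)
        rw [Ex_const] at this
        linarith
      · rw [ind_false hx, mul_zero, add_zero]
        apply Ex_pair q (List.replicate q 0) (List.replicate q 4) (by simp) (by simp)
        · intro h
          have := List.replicate_right_inj (a := (0 : Fin 8)) (b := 4) (n := q) (by omega)
          rw [this] at h
          exact absurd h (by decide)
        · exact hin u
        · rw [← Ex_add]
          have hc : (A ∪ coset q q (rn q x u)).card + q * m ≤ T := by
            have := Finset.card_union_le A (coset q q (rn q x u))
            have := coset_card q q (rn q x u)
            omega
          refine le_trans (Ex_mono R fun v => ind_add_le ?_ ?_ ?_)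
            (ih r (A ∪ coset q q (rn q x u)) (rn q x u) (Ψ - flow q x u) hc)
          · intro h y hy
            have := h y (fun h' => hy (Finset.mem_union_left _ h'))
            rw [flow_append, flow_append, flow_rep_zero, rn_rep_zero] at this
            simp only [Pi.add_apply, Pi.sub_apply, Pi.zero_apply] at this ⊢
            omega
          · intro h y hy
            have := h y (fun h' => hy (Finset.mem_union_left _ h'))
            have h2 := flow_rep_four_off q q (rn q x u) y
              (fun h' => hy (Finset.mem_union_right _ h'))
            rw [flow_append, flow_append, rn_rep_four] at this
            simp only [CharP.cast_eq_zero, Pi.single_zero, add_zero, Prod.mk.eta] at this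
            simp only [Pi.add_apply, Pi.sub_apply] at this ⊢
            omega
          · intro h h'
            have e1 := h _ hx
            have e2 := h' _ hx
            rw [flow_append, flow_append, flow_rep_zero, rn_rep_zero] at e1
            rw [flow_append, flow_append, rn_rep_four] at e2
            simp only [CharP.cast_eq_zero, Pi.single_zero, add_zero, Prod.mk.eta] at e2
            simp only [Pi.add_apply, Pi.zero_apply] at e1 e2
            obtain ⟨q', rfl⟩ : ∃ q', q = q' + 1 := ⟨q - 1, by omega⟩
            have := flow_rep_four_pos (q' + 1) q' (rn (q' + 1) x u)
            omega
    have h := Ex_mono L hu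
    rw [Ex_add, Ex_const, Ex_mul] at h
    have h3 := hL A x (by omega)
    have hpos : 0 ≤ θ ^ m * (1 / 8) ^ q := by positivity
    have := mul_le_mul_of_nonneg_left h3 hpos
    rw [pow_succ]
    refine h.trans ?_
    rw [hθd] at *
    linarith

end model

/-! ### Representing words by permutations -/

section rep
variable (q : ℕ)

lemma act_45 (x : XS q) : act q 4 (act q 5 x) = x := by
  simp [act, da, dp, add_assoc, ← Pi.single_add]

lemma act_54 (x : XS q) : act q 5 (act q 4 x) = x := by
  simp [act, da, dp, add_assoc, ← Pi.single_add]

lemma act_67 (x : XS q) : act q 6 (act q 7 x) = x := by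
  simp [act, da, dp]

lemma act_76 (x : XS q) : act q 7 (act q 6 x) = x := by
  simp [act, da, dp]

/-- The generator `a` acting on states. -/
def eA : Equiv.Perm (XS q) := ⟨act q 4, act q 5, act_54 q, act_45 q⟩

/-- The generator `t` acting on states. -/
def eT : Equiv.Perm (XS q) := ⟨act q 6, act q 7, act_76 q, act_67 q⟩

open Classical in
/-- The generator `a` acting on flows and states. -/
def fA : Equiv.Perm ((XS q → ℤ) × XS q) where
  toFun z := (z.1 + Pi.single z.2 1, act q 4 z.2)
  invFun z := (z.1 - Pi.single (act q 5 z.2) 1, act q 5 z.2)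
  left_inv z := by simp [act_54]
  right_inv z := by simp [act_45]

/-- The generator `t` acting on flows and states. -/
def fT : Equiv.Perm ((XS q → ℤ) × XS q) where
  toFun z := (z.1, act q 6 z.2)
  invFun z := (z.1, act q 7 z.2)
  left_inv z := by simp [act_76]
  right_inv z := by simp [act_67]

/-- Right action of the free group on states. -/
def rX : FreeGroup (Fin 2) →* (Equiv.Perm (XS q))ᵐᵒᵖ :=
  FreeGroup.lift ![MulOpposite.op (eA q), MulOpposite.op (eT q)]

/-- Right action of the free group on flows and states. -/
def rY : FreeGroup (Fin 2) →* (Equiv.Perm ((XS q → ℤ) × XS q))ᵐᵒᵖ :=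
  FreeGroup.lift ![MulOpposite.op (fA q), MulOpposite.op (fT q)]

lemma rX_lt (s : Fin 8) (x : XS q) : (rX q (lt s)).unop x = act q s x := by
  fin_cases s
  · simp [lt, act, da, dp]
  · simp [lt, act, da, dp]
  · simp [lt, act, da, dp]
  · simp [lt, act, da, dp]
  · simp [lt, rX, eA]
  · simp [lt, rX, eA, Equiv.Perm.inv_def]
  · simp [lt, rX, eT]
  · simp [lt, rX, eT, Equiv.Perm.inv_def]

lemma rX_wp (w : List (Fin 8)) (x : XS q) : (rX q (wp w)).unop x = rn q x w := by
  induction w generalizing x with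
  | nil => simp [rn]
  | cons s w ih =>
    rw [wp_cons, map_mul, MulOpposite.unop_mul, Equiv.Perm.mul_apply, rX_lt, ih, rn]

lemma rY_lt (s : Fin 8) (g : XS q → ℤ) (x : XS q) :
    (rY q (lt s)).unop (g, x) = (g + dflow q x s, act q s x) := by
  fin_cases s
  · simp [lt, act, da, dp, dflow]
  · simp [lt, act, da, dp, dflow]
  · simp [lt, act, da, dp, dflow]
  · simp [lt, act, da, dp, dflow]
  · simp [lt, rY, fA, dflow]
  · simp [lt, rY, fA, dflow, Equiv.Perm.inv_def, sub_eq_add_neg]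
  · simp [lt, rY, fT, dflow]
  · simp [lt, rY, fT, dflow, Equiv.Perm.inv_def]

lemma rY_wp (w : List (Fin 8)) (g : XS q → ℤ) (x : XS q) :
    (rY q (wp w)).unop (g, x) = (g + flow q x w, rn q x w) := by
  induction w generalizing g x with
  | nil => simp [rn, flow]
  | cons s w ih =>
    rw [wp_cons, map_mul, MulOpposite.unop_mul, Equiv.Perm.mul_apply, rY_lt, ih, rn, flow,
      add_assoc]

lemma wp_surj (h : FreeGroup (Fin 2)) : ∃ w, wp w = h := by
  induction h using FreeGroup.induction_on with
  | C1 => exact ⟨[], rfl⟩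
  | of i =>
    fin_cases i
    · exact ⟨[4], by simp [wp, lt]⟩
    · exact ⟨[6], by simp [wp, lt]⟩
  | inv_of i _ =>
    fin_cases i
    · exact ⟨[5], by simp [wp, lt]⟩
    · exact ⟨[7], by simp [wp, lt]⟩
  | mul x y hx hy =>
    obtain ⟨u, rfl⟩ := hx
    obtain ⟨v, rfl⟩ := hy
    exact ⟨u ++ v, wp_append u v⟩

/-- The relators of the lamplighter group. -/
def relators : Set (FreeGroup (Fin 2)) :=
  ({(FreeGroup.of 0) ^ q} ∪
        {g | ∃ n : ℤ, g =
          (FreeGroup.of 0)⁻¹ *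
            ((FreeGroup.of 1) ^ (-n) * FreeGroup.of 0 * (FreeGroup.of 1) ^ n)⁻¹ *
            FreeGroup.of 0 *
            ((FreeGroup.of 1) ^ (-n) * FreeGroup.of 0 * (FreeGroup.of 1) ^ n)})

lemma eT_zpow (n : ℤ) (x : XS q) : (eT q ^ n) x = (x.1, x.2 + n) := by
  have hT : ∀ x, eT q x = (x.1, x.2 + 1) := fun x => by simp [eT, act, da, dp]
  have hT' : ∀ x, (eT q)⁻¹ x = (x.1, x.2 - 1) := fun x => by
    rw [Equiv.Perm.inv_eq_iff_eq, hT]; simp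
  induction n using Int.induction_on generalizing x with
  | zero => simp
  | succ n ih => rw [zpow_add_one, Equiv.Perm.mul_apply, hT, ih]; simp; ring
  | pred n ih => rw [zpow_sub_one, Equiv.Perm.mul_apply, hT', ih]; simp; ring

lemma relators_ker : Subgroup.normalClosure (relators q) ≤ (rX q).ker := by
  apply Subgroup.normalClosure_le_normal
  have hA : ∀ x, eA q x = (x.1 + Pi.single x.2 1, x.2) := fun x => by simp [eA, act_four]
  have r0 : rX q (FreeGroup.of 0) = MulOpposite.op (eA q) := by simp [rX]
  have r1 : rX q (FreeGroup.of 1) = MulOpposite.op (eT q) := by simp [rX]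
  rintro g (hg | ⟨n, hg⟩)
  · rw [Set.mem_singleton_iff] at hg
    subst hg
    rw [SetLike.mem_coe, MonoidHom.mem_ker, map_pow, r0, ← MulOpposite.op_pow,
      MulOpposite.op_eq_one_iff]
    have : ∀ (m : ℕ) (x : XS q), (eA q ^ m) x = (x.1 + Pi.single x.2 (m : ZMod q), x.2) := by
      intro m
      induction m with
      | zero => intro x; simp
      | succ m ih =>
        intro x
        rw [pow_succ, Equiv.Perm.mul_apply, hA, ih]
        simp [add_assoc, ← Pi.single_add, add_comm (1 : ZMod q)]
    ext1 x
    rw [this]; simp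
  · subst hg
    rw [SetLike.mem_coe, MonoidHom.mem_ker]
    set e := (FreeGroup.of 1 : FreeGroup (Fin 2)) ^ (-n) * FreeGroup.of 0 * (FreeGroup.of 1) ^ n
    have he : rX q e = MulOpposite.op (eT q ^ n * (eA q * eT q ^ (-n))) := by
      simp only [e, map_mul, map_zpow, r0, r1]
      rw [← MulOpposite.op_zpow, ← MulOpposite.op_zpow, ← MulOpposite.op_mul,
        ← MulOpposite.op_mul]
    have hc : Commute (rX q (FreeGroup.of 0)) (rX q e) := by
      rw [he, r0]
      apply Commute.op
      ext1 x
      simp only [Equiv.Perm.mul_apply, eT_zpow, hA]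
      ext1
      · simp [add_right_comm]
      · simp
    simp only [map_mul, map_inv]
    rw [mul_assoc, hc.eq, ← mul_inv_rev, ← mul_assoc, mul_assoc]
    rw [inv_mul_eq_one]

lemma commutator_ker (N : Subgroup (FreeGroup (Fin 2)))
    (hN : N = Subgroup.normalClosure (relators q)) : ⁅N, N⁆ ≤ (rY q).ker := by
  rw [Subgroup.commutator_le]
  intro h₁ m₁ h₂ m₂
  obtain ⟨u, rfl⟩ := wp_surj h₁
  obtain ⟨v, rfl⟩ := wp_surj h₂
  have hk : ∀ w, wp w ∈ N → ∀ x, rn q x w = x := by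
    intro w hw x
    have := relators_ker q (hN ▸ hw)
    rw [MonoidHom.mem_ker] at this
    rw [← rX_wp, this]; rfl
  rw [MonoidHom.mem_ker, map_commutatorElement, commutatorElement_eq_one_iff_mul_comm]
  apply MulOpposite.unop_injective
  ext1 ⟨g, x⟩
  simp only [MulOpposite.unop_mul, Equiv.Perm.mul_apply, rY_wp, hk u m₁, hk v m₂]
  rw [add_right_comm]

/-- If a word represents the identity in the cover, its flow vanishes. -/
lemma flow_eq_zero (N : Subgroup (FreeGroup (Fin 2)))
    (hN : N = Subgroup.normalClosure (relators q)) (w : List (Fin 8))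
    (hw : wp w ∈ ⁅N, N⁆) (x : XS q) : flow q x w = 0 ∧ rn q x w = x := by
  have := commutator_ker q N hN hw
  rw [MonoidHom.mem_ker] at this
  have h := rY_wp q w 0 x
  rw [this] at h
  simp only [MulOpposite.unop_one, Equiv.Perm.coe_one, id_eq, zero_add, Prod.mk.injEq] at h
  exact ⟨h.1.symm, h.2.symm⟩

lemma pr_le_flow (N : Subgroup (FreeGroup (Fin 2))) [N.Normal]
    (hN : N = Subgroup.normalClosure (relators q)) (hq : 2 ≤ q) (L T m n : ℕ)
    (hL : ∀ (A : Finset (XS q)) (x : XS q), A.card ≤ T →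
      Ex L (fun u => ind (rn q x u ∈ A)) ≤ 3 / 4) (hm : m * (L + q) ≤ n) (hT : q * m ≤ T) :
    pr ⁅N, N⁆ n 1 ≤ (1 - (1 / 8) ^ q / 4) ^ m := by
  obtain ⟨r, rfl⟩ := Nat.exists_eq_add_of_le hm
  refine le_trans (Ex_mono _ fun w => ind_mono ?_)
    (flow_prob q hq L T hL m r ∅ (0, 0) 0 (by simpa using hT))
  intro h y _
  rw [QuotientGroup.eq_one_iff] at h
  rw [(flow_eq_zero q N hN w h (0, 0)).1]

lemma pr_le_const (N : Subgroup (FreeGroup (Fin 2))) [N.Normal]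
    (hN : N = Subgroup.normalClosure (relators q)) (n : ℕ) :
    pr ⁅N, N⁆ (n + 1) 1 ≤ 7 / 8 := by
  set M := ⁅N, N⁆
  have hle : ∀ g, pr M n g ≤ 1 := fun g => Ex_ind_le_one n _
  have hd : pr M n 1 + pr M n ((FreeGroup.of 1 : FreeGroup (Fin 2)) : FreeGroup (Fin 2) ⧸ M)⁻¹
      ≤ 1 := by
    unfold pr
    rw [← Ex_add]
    have := Ex_mono n (f := fun w => ind ((wp w : FreeGroup (Fin 2) ⧸ M) = 1) +
      ind ((wp w : FreeGroup (Fin 2) ⧸ M) = (FreeGroup.of 1 : FreeGroup (Fin 2))⁻¹))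
      (g := fun _ => ind True) (fun w => by
        apply ind_add_le (fun _ => trivial) (fun _ => trivial)
        intro h h'
        rw [h, eq_comm, QuotientGroup.mk_inv, inv_eq_one, QuotientGroup.eq_one_iff] at h'
        have := (flow_eq_zero q N hN [6] (by simpa [wp, lt] using h') (0, 0)).2
        simp [rn, act, dp, da] at this)
    rw [Ex_const, ind_T] at this
    exact this
  rw [pr_succ]
  have e0 : pr M n ((lt 0 : FreeGroup (Fin 2) ⧸ M)⁻¹ * 1) = pr M n 1 := by simp [lt]
  have e6 : pr M n ((lt 6 : FreeGroup (Fin 2) ⧸ M)⁻¹ * 1) =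
    pr M n ((FreeGroup.of 1 : FreeGroup (Fin 2)) : FreeGroup (Fin 2) ⧸ M)⁻¹ := by simp [lt]
  rw [Fin.sum_univ_eight, e0, e6]
  linarith [hle ((lt 1 : FreeGroup (Fin 2) ⧸ M)⁻¹ * 1), hle ((lt 2 : FreeGroup (Fin 2) ⧸ M)⁻¹ * 1),
    hle ((lt 3 : FreeGroup (Fin 2) ⧸ M)⁻¹ * 1), hle ((lt 4 : FreeGroup (Fin 2) ⧸ M)⁻¹ * 1),
    hle ((lt 5 : FreeGroup (Fin 2) ⧸ M)⁻¹ * 1), hle ((lt 7 : FreeGroup (Fin 2) ⧸ M)⁻¹ * 1)]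

end rep

/-! ### Counting elements reached by confined words -/

/-- All prefixes of the word, started at `x`, stay in `B`. -/
def stays {Γ : Type*} [Group Γ] (ψ : Fin 8 → Γ) (B : Finset Γ) : Γ → List (Fin 8) → Prop
  | x, [] => x ∈ B
  | x, s :: w => x ∈ B ∧ stays ψ B (x * ψ s) w

lemma stays_mem {Γ : Type*} [Group Γ] (ψ : Fin 8 → Γ) (B : Finset Γ) (x : Γ) (w : List (Fin 8))
    (h : stays ψ B x w) : x ∈ B := by
  cases w with
  | nil => exact h
  | cons s w => exact h.1

lemma count_aux {Γ G K : Type*} [Group Γ] [Group G] [CommGroup K] (j : K →* G) (σ : Γ → G)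
    (φ : Fin 8 → G) (ψ : Fin 8 → Γ) (c : Γ → Fin 8 → K)
    (hc : ∀ x s, σ x * φ s = j (c x s) * σ (x * ψ s)) (B : Finset Γ) (w : List (Fin 8)) :
    ∀ x, stays ψ B x w → ∃ m : B × Fin 8 → ℕ, (∀ i, m i ≤ w.length) ∧ ∃ y : B,
      σ x * (w.map φ).prod = j (∏ i : B × Fin 8, c i.1 i.2 ^ m i) * σ y := by
  classical
  induction w with
  | nil => intro x hx; exact ⟨0, by simp, ⟨x, hx⟩, by simp⟩
  | cons s w ih =>
    intro x hx
    obtain ⟨m, hm, y, hy⟩ := ih _ hx.2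
    refine ⟨m + Pi.single (⟨x, hx.1⟩, s) 1, ?_, y, ?_⟩
    · intro i
      have := hm i
      simp only [Pi.add_apply, Pi.single_apply, List.length_cons]
      split_ifs <;> omega
    · rw [List.map_cons, List.prod_cons, ← mul_assoc, hc, mul_assoc, hy, ← mul_assoc, ← map_mul]
      congr 2
      simp only [Pi.add_apply, pow_add, Finset.prod_mul_distrib]
      rw [mul_comm]
      congr 1
      rw [Finset.prod_eq_single (⟨x, hx.1⟩, s)]
      · simp
      · intro b _ hb; simp [Pi.single_eq_of_ne hb]
      · simp

lemma count (N : Subgroup (FreeGroup (Fin 2))) [N.Normal] (B : Finset (FreeGroup (Fin 2) ⧸ N))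
    (n : ℕ) : ∃ A : Finset (FreeGroup (Fin 2) ⧸ ⁅N, N⁆),
      A.card ≤ (n + 1) ^ (B.card * 8) * B.card ∧
      ∀ w : List (Fin 8), w.length = n →
        stays (fun s => (lt s : FreeGroup (Fin 2) ⧸ N)) B 1 w →
        (wp w : FreeGroup (Fin 2) ⧸ ⁅N, N⁆) ∈ A := by
  classical
  let K : Subgroup (FreeGroup (Fin 2) ⧸ ⁅N, N⁆) := N.map (QuotientGroup.mk' ⁅N, N⁆)
  let _ : CommGroup K := { (inferInstance : Group K) with
    mul_comm := by
      rintro ⟨_, a, ha, rfl⟩ ⟨_, b, hb, rfl⟩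
      apply Subtype.ext
      change QuotientGroup.mk' ⁅N, N⁆ a * QuotientGroup.mk' ⁅N, N⁆ b =
        QuotientGroup.mk' ⁅N, N⁆ b * QuotientGroup.mk' ⁅N, N⁆ a
      rw [← commutatorElement_eq_one_iff_mul_comm, ← map_commutatorElement,
        QuotientGroup.mk'_apply, QuotientGroup.eq_one_iff]
      exact Subgroup.commutator_mem_commutator ha hb }
  let σ : FreeGroup (Fin 2) ⧸ N → FreeGroup (Fin 2) ⧸ ⁅N, N⁆ := fun x =>
    QuotientGroup.mk' ⁅N, N⁆ (Quotient.out x)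
  let φ : Fin 8 → FreeGroup (Fin 2) ⧸ ⁅N, N⁆ := fun s => QuotientGroup.mk' ⁅N, N⁆ (lt s)
  let ψ : Fin 8 → FreeGroup (Fin 2) ⧸ N := fun s => (lt s : FreeGroup (Fin 2) ⧸ N)
  have ho : ∀ x : FreeGroup (Fin 2) ⧸ N,
      ((Quotient.out x : FreeGroup (Fin 2)) : FreeGroup (Fin 2) ⧸ N) = x :=
    fun x => QuotientGroup.out_eq' x
  let c : FreeGroup (Fin 2) ⧸ N → Fin 8 → K := fun x s =>
    ⟨QuotientGroup.mk' ⁅N, N⁆ (Quotient.out x * lt s * (Quotient.out (x * ψ s))⁻¹),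
      _, (by
        rw [SetLike.mem_coe, ← QuotientGroup.eq_one_iff, QuotientGroup.mk_mul, QuotientGroup.mk_mul,
          QuotientGroup.mk_inv, ho, ho]
        exact mul_inv_cancel _), rfl⟩
  have hc : ∀ x s, σ x * φ s = K.subtype (c x s) * σ (x * ψ s) := by
    intro x s
    change QuotientGroup.mk' ⁅N, N⁆ _ * QuotientGroup.mk' ⁅N, N⁆ _ =
      QuotientGroup.mk' ⁅N, N⁆ _ * QuotientGroup.mk' ⁅N, N⁆ _
    rw [← map_mul, ← map_mul]
    congr 1
    group
  let e : (B × Fin 8 → Fin (n + 1)) × B → FreeGroup (Fin 2) ⧸ ⁅N, N⁆ := fun z =>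
    (σ 1)⁻¹ * (K.subtype (∏ i : B × Fin 8, c i.1 i.2 ^ (z.1 i : ℕ)) * σ z.2)
  refine ⟨Finset.univ.image e, ?_, ?_⟩
  · refine Finset.card_image_le.trans ?_
    simp
  · intro w hw hs
    obtain ⟨m, hm, y, hy⟩ := count_aux K.subtype σ φ ψ c hc B w 1 hs
    rw [Finset.mem_image]
    refine ⟨(fun i => ⟨m i, by have := hm i; omega⟩, y), Finset.mem_univ _, ?_⟩
    simp only [e]
    rw [← hy, inv_mul_cancel_left]
    change (w.map ((QuotientGroup.mk' ⁅N, N⁆) ∘ lt)).prod = QuotientGroup.mk' ⁅N, N⁆ (wp w)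
    rw [← List.map_map, ← map_list_prod]; rfl

lemma confined (q : ℕ) (hq : 2 ≤ q) (N : Subgroup (FreeGroup (Fin 2))) [N.Normal]
    (hN : N = Subgroup.normalClosure (relators q)) (r : ℕ) :
    ∃ B : Finset (FreeGroup (Fin 2) ⧸ N), B.card ≤ q ^ (2 * r + 1) * (2 * r + 1) ∧
      ∀ w : List (Fin 8), ¬ reach 0 (r + 1) 0 w →
        stays (fun s => (lt s : FreeGroup (Fin 2) ⧸ N)) B 1 w := by
  classical
  set a : FreeGroup (Fin 2) ⧸ N := QuotientGroup.mk (FreeGroup.of 0) with ha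
  set t : FreeGroup (Fin 2) ⧸ N := QuotientGroup.mk (FreeGroup.of 1) with ht
  have haq : a ^ q = 1 := by
    rw [ha, ← QuotientGroup.mk_pow, QuotientGroup.eq_one_iff, hN]
    exact Subgroup.subset_normalClosure (Or.inl rfl)
  have hcm : ∀ n : ℤ, Commute a (t ^ (-n) * a * t ^ n) := by
    intro n
    have h : (((FreeGroup.of 0)⁻¹ *
            ((FreeGroup.of 1) ^ (-n) * FreeGroup.of 0 * (FreeGroup.of 1) ^ n)⁻¹ *
            FreeGroup.of 0 *
            ((FreeGroup.of 1) ^ (-n) * FreeGroup.of 0 * (FreeGroup.of 1) ^ n) :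
            FreeGroup (Fin 2)) : FreeGroup (Fin 2) ⧸ N) = 1 := by
      rw [QuotientGroup.eq_one_iff, hN]
      exact Subgroup.subset_normalClosure (Or.inr ⟨n, rfl⟩)
    simp only [QuotientGroup.mk_mul, QuotientGroup.mk_inv, QuotientGroup.mk_zpow] at h
    rw [← ha, ← ht, ← mul_inv_rev, mul_assoc, inv_mul_eq_one] at h
    exact h.symm
  let b : ℤ → FreeGroup (Fin 2) ⧸ N := fun p => MulAut.conj (t ^ p) a
  have hb : ∀ i j, Commute (b i) (b j) := by
    intro i j
    have : b j = MulAut.conj (t ^ i) (t ^ (-(i - j)) * a * t ^ (i - j)) := by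
      simp only [b, MulAut.conj_apply]
      group
    rw [this]
    exact (hcm (i - j)).map (MulAut.conj (t ^ i))
  have hbq : ∀ i, b i ^ q = 1 := by
    intro i
    simp only [b]
    rw [← map_pow, haq, map_one]
  let ι := ↥(Finset.Icc (-(r : ℤ)) r)
  let H : ι → Subgroup (FreeGroup (Fin 2) ⧸ N) := fun i => Subgroup.zpowers (b i.1)
  have hH : Pairwise fun i j : ι => ∀ x y, x ∈ H i → y ∈ H j → Commute x y := by
    intro i j _ x y hx hy
    obtain ⟨m, rfl⟩ := Subgroup.mem_zpowers_iff.1 hx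
    obtain ⟨k, rfl⟩ := Subgroup.mem_zpowers_iff.1 hy
    exact (hb i.1 j.1).zpow_zpow m k
  have hfin : ∀ i : ι, Finite (H i) := fun i =>
    (finite_zpowers.2 (isOfFinOrder_iff_pow_eq_one.2 ⟨q, by omega, hbq i.1⟩)).to_subtype
  have hcι : Fintype.card ι = 2 * r + 1 := by
    simp only [ι, Fintype.card_coe, Int.card_Icc]; omega
  let _ : Fintype (∀ i, H i) := Fintype.ofFinite _
  have hcard : Fintype.card (∀ i, H i) ≤ q ^ (2 * r + 1) := by
    rw [← Nat.card_eq_fintype_card, Nat.card_pi, ← hcι]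
    calc _ ≤ ∏ _i : ι, q := Finset.prod_le_prod' fun i _ => by
            rw [Nat.card_zpowers]; exact orderOf_le_of_pow_eq_one (by omega) (hbq i.1)
      _ = _ := by simp
  let Φ := Subgroup.noncommPiCoprod hH
  refine ⟨(Finset.univ ×ˢ Finset.Icc (-(r : ℤ)) r).image
    (fun z : (∀ i, H i) × ℤ => Φ z.1 * t ^ z.2), ?_, ?_⟩
  · refine Finset.card_image_le.trans ?_
    rw [Finset.card_product, Finset.card_univ, Int.card_Icc]
    exact Nat.mul_le_mul hcard (by omega)
  · set B := (Finset.univ ×ˢ Finset.Icc (-(r : ℤ)) r).image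
      (fun z : (∀ i, H i) × ℤ => Φ z.1 * t ^ z.2) with hB
    have key : ∀ w : List (Fin 8), ∀ (h : ∀ i, H i) (p : ℤ), ¬ reach 0 (r + 1) p w →
        stays (fun s => (lt s : FreeGroup (Fin 2) ⧸ N)) B (Φ h * t ^ p) w := by
      intro w
      have hmem : ∀ (h : ∀ i, H i) (p : ℤ), ¬ ((r + 1 : ℕ) : ℤ) ≤ |p - 0| → Φ h * t ^ p ∈ B := by
        intro h p hp
        rw [hB, Finset.mem_image]
        refine ⟨(h, p), ?_, rfl⟩
        simp only [Finset.mem_product, Finset.mem_univ, true_and, Finset.mem_Icc]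
        rw [sub_zero] at hp
        push_cast at hp
        rw [← abs_le]; omega
      induction w with
      | nil => intro h p hr; exact hmem h p hr
      | cons s w ih =>
        intro h p hr
        have hr1 : ¬ ((r + 1 : ℕ) : ℤ) ≤ |p - 0| := fun h' => hr (Or.inl h')
        have hr2 : ¬ reach 0 (r + 1) (p + dp s) w := fun h' => hr (Or.inr h')
        have hpI : p ∈ Finset.Icc (-(r : ℤ)) r := by
          rw [Finset.mem_Icc]
          rw [sub_zero] at hr1
          push_cast at hr1
          rw [← abs_le]; omega
        refine ⟨hmem h p hr1, ?_⟩
        have hstep : ∃ h' : ∀ i, H i, Φ h * t ^ p * (lt s : FreeGroup (Fin 2) ⧸ N) =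
            Φ h' * t ^ (p + dp s) := by
          have hz : ∀ m : ℤ, ∃ h' : ∀ i, H i, Φ h * t ^ p * a ^ m = Φ h' * t ^ p := by
            intro m
            refine ⟨h * Pi.mulSingle (⟨p, hpI⟩ : ι)
              ⟨b p ^ m, Subgroup.zpow_mem_zpowers _ _⟩, ?_⟩
            rw [map_mul]
            have : Φ (Pi.mulSingle (⟨p, hpI⟩ : ι)
              ⟨b p ^ m, Subgroup.zpow_mem_zpowers _ _⟩) = b p ^ m :=
              Subgroup.noncommPiCoprod_mulSingle (hcomm := hH) _ _
            rw [this]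
            simp only [b]
            rw [← map_zpow, MulAut.conj_apply]
            group
          fin_cases s
          · exact ⟨h, by simp [lt, dp]⟩
          · exact ⟨h, by simp [lt, dp]⟩
          · exact ⟨h, by simp [lt, dp]⟩
          · exact ⟨h, by simp [lt, dp]⟩
          · simpa [lt, dp] using hz 1
          · simpa [lt, dp] using hz (-1)
          · exact ⟨h, by simp [lt, dp, zpow_add, mul_assoc, ht]⟩
          · exact ⟨h, by simp [lt, dp, zpow_add, mul_assoc, ht]⟩
        obtain ⟨h', e⟩ := hstep
        change stays _ B (Φ h * t ^ p * (lt s : FreeGroup (Fin 2) ⧸ N)) w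
        rw [e]
        exact ih h' (p + dp s) hr2
    intro w hw
    have := key w 1 0 hw
    simpa using this

/-- Lower bound for the probability of confinement. -/
lemma confine_prob (r n : ℕ) : ∀ p : ℤ, |p| ≤ r + 1 →
    (3 / 4 + 1 / 4 * Real.cos (Real.pi / (2 * (r + 1)))) ^ n *
      Real.cos (Real.pi / (2 * (r + 1)) * p) ≤
    Ex n (fun w => ind (¬ reach 0 (r + 1) p w)) := by
  set θ : ℝ := Real.pi / (2 * (r + 1)) with hθ
  have hr : (0 : ℝ) < r + 1 := by positivity
  have hθ1 : θ * (r + 1) = Real.pi / 2 := by rw [hθ]; field_simp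
  have hθ0 : 0 < θ := by have := Real.pi_pos; positivity
  have hcos : 0 ≤ Real.cos θ := by
    apply Real.cos_nonneg_of_mem_Icc
    constructor <;> nlinarith [Real.pi_pos, Nat.cast_nonneg (α := ℝ) r]
  have hedge : ∀ p : ℤ, |p| ≤ r + 1 → ((r + 1 : ℕ) : ℤ) ≤ |p - 0| → Real.cos (θ * p) = 0 := by
    intro p h1 h2
    rw [sub_zero] at h2
    push_cast at h2
    have h3 : |p| = r + 1 := le_antisymm h1 h2
    rw [← Real.cos_abs, abs_mul, abs_of_pos hθ0]
    have : |(p : ℝ)| = r + 1 := by exact_mod_cast h3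
    rw [this, hθ1, Real.cos_pi_div_two]
  induction n with
  | zero =>
    intro p hp
    by_cases h : ((r + 1 : ℕ) : ℤ) ≤ |p - 0|
    · rw [hedge p hp h, mul_zero]; exact Ex_nonneg _ fun _ => ind_nonneg _
    · simp only [Ex, reach, h, not_false_eq_true, ind_T, pow_zero, one_mul]
      exact Real.cos_le_one _
  | succ n ih =>
    intro p hp
    by_cases h : ((r + 1 : ℕ) : ℤ) ≤ |p - 0|
    · rw [hedge p hp h, mul_zero]; exact Ex_nonneg _ fun _ => ind_nonneg _
    · have hstep : ∀ s : Fin 8, (3 / 4 + 1 / 4 * Real.cos θ) ^ n * Real.cos (θ * (p + dp s : ℤ)) ≤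
          Ex n (fun w => ind (¬ reach 0 (r + 1) p (s :: w))) := by
        intro s
        refine (ih (p + dp s) ?_).trans (le_of_eq ?_)
        · have := abs_add_le p (dp s)
          have := abs_dp s
          rw [sub_zero] at h
          push_cast at h
          omega
        · congr 1
          funext w
          apply ind_congr
          simp only [reach, h, false_or]
      have hs := Finset.sum_le_sum (fun s (_ : s ∈ (Finset.univ : Finset (Fin 8))) => hstep s)
      simp only [Ex]
      refine le_trans (le_of_eq ?_) (mul_le_mul_of_nonneg_left hs (by norm_num : (0:ℝ) ≤ 1 / 8))
      rw [← Finset.mul_sum]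
      have : ∑ s : Fin 8, Real.cos (θ * (p + dp s : ℤ)) =
          (6 + 2 * Real.cos θ) * Real.cos (θ * p) := by
        simp only [Fin.sum_univ_eight, dp]
        simp [mul_add, Real.cos_add]
        ring
      rw [this, pow_succ]
      ring

/-- Combined lower bound before choosing the radius. -/
lemma lower_pre (q : ℕ) (hq : 2 ≤ q) (N : Subgroup (FreeGroup (Fin 2))) [N.Normal]
    (hN : N = Subgroup.normalClosure (relators q)) (r n : ℕ) :
    ((3 / 4 + 1 / 4 * Real.cos (Real.pi / (2 * (r + 1)))) ^ n) ^ 2 ≤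
      (((n : ℝ) + 1) ^ (q ^ (2 * r + 1) * (2 * r + 1) * 8) * (q ^ (2 * r + 1) * (2 * r + 1) : ℕ)) *
        pr ⁅N, N⁆ (2 * n) 1 := by
  obtain ⟨B, hB, hstay⟩ := confined q hq N hN r
  obtain ⟨A, hA, hmem⟩ := count N B n
  have h1 := pr_return_lower ⁅N, N⁆ n A
  have h2 := confine_prob r n 0 (by simp; positivity)
  rw [Int.cast_zero, mul_zero, Real.cos_zero, mul_one] at h2
  have h3 : Ex n (fun w => ind (¬ reach 0 (r + 1) 0 w)) ≤
      Ex n (fun w => ind ((wp w : FreeGroup (Fin 2) ⧸ ⁅N, N⁆) ∈ A)) :=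
    Ex_mono_len n fun w hw => ind_mono fun h => hmem w hw (hstay w h)
  have h0 : 0 ≤ (3 / 4 + 1 / 4 * Real.cos (Real.pi / (2 * (r + 1)))) ^ n := by
    have := Real.neg_one_le_cos (Real.pi / (2 * (r + 1)))
    apply pow_nonneg
    linarith
  refine (pow_le_pow_left₀ h0 (h2.trans h3) 2).trans (h1.trans ?_)
  apply mul_le_mul_of_nonneg_right _ (pr_nonneg _ _ _)
  have hA' : A.card ≤ (n + 1) ^ (q ^ (2 * r + 1) * (2 * r + 1) * 8) *
      (q ^ (2 * r + 1) * (2 * r + 1)) := by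
    refine hA.trans (Nat.mul_le_mul (Nat.pow_le_pow_right (by omega) ?_) hB)
    exact Nat.mul_le_mul_right _ hB
  calc (A.card : ℝ) ≤ (((n + 1) ^ (q ^ (2 * r + 1) * (2 * r + 1) * 8) *
      (q ^ (2 * r + 1) * (2 * r + 1)) : ℕ) : ℝ) := by exact_mod_cast hA'
    _ = _ := by push_cast; ring

/-! ### Choosing the parameters -/

lemma log_half {n : ℕ} (hn : 2 ≤ n) : 1 / 2 ≤ Real.log n := by
  have h1 : Real.log 2 ≤ Real.log n :=
    Real.log_le_log (by norm_num) (by exact_mod_cast hn)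
  linarith [Real.log_two_gt_d9]

lemma upper_final (q : ℕ) (hq : 2 ≤ q) (N : Subgroup (FreeGroup (Fin 2))) [N.Normal]
    (hN : N = Subgroup.normalClosure (relators q)) :
    ∃ C₀ : ℝ, 0 < C₀ ∧ ∀ n : ℕ, 2 ≤ n →
      pr ⁅N, N⁆ (2 * n) 1 ≤ Real.exp (-((1 / C₀) * (n / Real.log n ^ 2))) := by
  have hq1 : (2 : ℝ) ≤ q := by exact_mod_cast hq
  set g : ℝ := Real.log (4 * q) with hg
  have hg0 : 0 ≤ g := Real.log_nonneg (by linarith)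
  set b : ℝ := 16 * g + 12 with hb
  set K : ℝ := 8 * b ^ 2 + 4 * q with hK
  set δ : ℝ := (1 / 8) ^ q / 4 with hδ
  have hδ0 : 0 < δ := by positivity
  have hδ1 : δ ≤ 1 / 4 := by
    have : (1 / 8 : ℝ) ^ q ≤ 1 := pow_le_one₀ (by norm_num) (by norm_num)
    rw [hδ]; linarith
  have hK0 : 0 < K := by positivity
  refine ⟨K / δ, by positivity, fun n hn => ?_⟩
  set l : ℝ := Real.log n with hl
  have hl0 : 1 / 2 ≤ l := log_half hn
  have hn0 : (0 : ℝ) < n := by positivity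
  obtain ⟨k, hk1, hk2⟩ : ∃ k : ℕ, 8 * (g + l) ≤ k ∧ (k : ℝ) ≤ 8 * (g + l) + 1 :=
    ⟨⌈8 * (g + l)⌉₊, Nat.le_ceil _, (Nat.ceil_lt_add_one (by positivity)).le⟩
  set L : ℕ := 8 * (k + 1) ^ 2 with hLd
  have hkb : (k : ℝ) + 1 ≤ b * l := by rw [hb]; nlinarith
  have hLK : ((L + q : ℕ) : ℝ) ≤ K * l ^ 2 := by
    rw [hLd, hK]
    push_cast
    have h1 : ((k : ℝ) + 1) ^ 2 ≤ (b * l) ^ 2 := pow_le_pow_left₀ (by positivity) hkb 2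
    have h2 : (1 / 2) ^ 2 ≤ l ^ 2 := pow_le_pow_left₀ (by norm_num) hl0 2
    nlinarith
  have hL0 : (0 : ℝ) < L := by rw [hLd]; positivity
  have hpow : (q * n : ℝ) * (7 / 8) ^ k ≤ 1 / 4 := by
    have h1 : (7 / 8 : ℝ) ^ k ≤ Real.exp (-(g + l)) := by
      calc (7 / 8 : ℝ) ^ k ≤ (Real.exp (-(1 / 8))) ^ k := by
            apply pow_le_pow_left₀ (by norm_num)
            have := Real.add_one_le_exp (-(1 / 8) : ℝ)
            linarith
        _ = Real.exp (k * (-(1 / 8))) := by rw [← Real.exp_nat_mul]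
        _ ≤ _ := Real.exp_le_exp.2 (by linarith)
    have h2 : Real.exp (-(g + l)) = (4 * (q : ℝ) * n)⁻¹ := by
      rw [Real.exp_neg, Real.exp_add, hg, hl, Real.exp_log (by positivity), Real.exp_log hn0]
    rw [h2] at h1
    calc (q * n : ℝ) * (7 / 8) ^ k ≤ (q * n : ℝ) * (4 * (q : ℝ) * n)⁻¹ := by gcongr
      _ = 1 / 4 := by field_simp
  have hexit : ∀ (A : Finset (XS q)) (x : XS q), A.card ≤ q * n →
      Ex L (fun u => ind (rn q x u ∈ A)) ≤ 3 / 4 := by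
    intro A x hA
    have h := exit_prob q hq A x L k
    have h1 : (A.card : ℝ) * (7 / 8) ^ k ≤ 1 / 4 := by
      refine le_trans ?_ hpow
      gcongr
      exact_mod_cast hA
    have h2 : 4 * ((k : ℝ) + 1) ^ 2 = L * (1 / 2) := by rw [hLd]; push_cast; ring
    rw [h2, ← mul_add] at h
    have := le_of_mul_le_mul_left h hL0
    linarith
  have hCeq : 1 / (K / δ) = δ / K := by rw [one_div_div]
  rw [hCeq]
  by_cases hbig : L + q ≤ 2 * n
  · set m := 2 * n / (L + q) with hm
    have hLq : 0 < L + q := by omega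
    have hm1 : 1 ≤ m := (Nat.one_le_div_iff hLq).2 hbig
    have hm2 : m * (L + q) ≤ 2 * n := Nat.div_mul_le_self _ _
    have hmn : m ≤ n := by nlinarith
    have hm3 : 2 * n < (m + 1) * (L + q) := by
      have := Nat.lt_mul_div_succ (2 * n) hLq
      calc 2 * n < (L + q) * (2 * n / (L + q) + 1) := this
        _ = (m + 1) * (L + q) := by rw [hm]; ring
    have hm4 : n ≤ m * (L + q) := by nlinarith
    have h := pr_le_flow q N hN hq L (q * n) m (2 * n) hexit hm2 (Nat.mul_le_mul_left _ hmn)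
    refine h.trans ?_
    have h5 : (1 - (1 / 8 : ℝ) ^ q / 4) ^ m ≤ Real.exp (-(δ * m)) := by
      calc (1 - (1 / 8 : ℝ) ^ q / 4) ^ m ≤ (Real.exp (-δ)) ^ m := by
            apply pow_le_pow_left₀
            · linarith
            · have := Real.add_one_le_exp (-δ)
              linarith
        _ = _ := by rw [← Real.exp_nat_mul]; congr 1; ring
    refine h5.trans (Real.exp_le_exp.2 (neg_le_neg ?_))
    have h6 : (n : ℝ) ≤ m * (K * l ^ 2) := by
      have : (n : ℝ) ≤ m * ((L + q : ℕ) : ℝ) := by exact_mod_cast hm4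
      refine this.trans ?_
      gcongr
    have hKl : 0 < K * l ^ 2 := by positivity
    calc δ / K * (n / l ^ 2) = δ * (n / (K * l ^ 2)) := by field_simp
      _ ≤ δ * m := by
        gcongr
        rw [div_le_iff₀ hKl]; exact h6
  · have h := pr_le_const q N hN (2 * n - 1)
    rw [show 2 * n - 1 + 1 = 2 * n by omega] at h
    refine h.trans ?_
    have h1 : (7 / 8 : ℝ) ≤ Real.exp (-(1 / 8)) := by
      have := Real.add_one_le_exp (-(1 / 8) : ℝ)
      linarith
    refine h1.trans (Real.exp_le_exp.2 (neg_le_neg ?_))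
    have h2 : 2 * (n : ℝ) ≤ K * l ^ 2 := by
      have : 2 * (n : ℝ) ≤ ((L + q : ℕ) : ℝ) := by exact_mod_cast (not_le.1 hbig).le
      linarith
    have hKl : 0 < K * l ^ 2 := by positivity
    calc δ / K * (n / l ^ 2) = δ * (n / (K * l ^ 2)) := by field_simp
      _ ≤ (1 / 4) * (1 / 2) := by
        have h3 : (n : ℝ) / (K * l ^ 2) ≤ 1 / 2 := by rw [div_le_iff₀ hKl]; linarith
        have h4 : δ ≤ 1 / 4 := by linarith
        exact mul_le_mul h4 h3 (by positivity) (by norm_num)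
      _ = 1 / 8 := by norm_num

lemma lower_final (q : ℕ) (hq : 2 ≤ q) (N : Subgroup (FreeGroup (Fin 2))) [N.Normal]
    (hN : N = Subgroup.normalClosure (relators q)) :
    ∃ C₁ : ℝ, 0 < C₁ ∧ ∀ n : ℕ, 2 ≤ n →
      Real.exp (-(C₁ * (n / Real.log n ^ 2))) ≤ pr ⁅N, N⁆ (2 * n) 1 := by
  have hq1 : (2 : ℝ) ≤ q := by exact_mod_cast hq
  set g : ℝ := Real.log q with hg
  have hg0 : 0 < g := Real.log_pos (by linarith)
  refine ⟨128 * g ^ 2 + 3888 * q ^ 2, by positivity, fun n hn => ?_⟩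
  set l : ℝ := Real.log n with hl
  have hl0 : 1 / 2 ≤ l := log_half hn
  have hn0 : (0 : ℝ) < n := by positivity
  have hn2 : (2 : ℝ) ≤ n := by exact_mod_cast hn
  set r : ℕ := ⌊l / (8 * g)⌋₊ with hr
  have hr1 : (r : ℝ) * (8 * g) ≤ l := by
    rw [← le_div_iff₀ (by positivity)]
    exact Nat.floor_le (by positivity)
  have hr2 : l ≤ (r + 1) * (8 * g) := by
    rw [← div_le_iff₀ (by positivity)]
    exact (Nat.lt_floor_add_one _).le
  have hpre := lower_pre q hq N hN r n
  set D : ℕ := q ^ (2 * r + 1) * (2 * r + 1) with hD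
  -- size of `D`
  have hDle : (D : ℝ) ≤ q ^ 2 * √n := by
    have h1 : 2 * r + 1 ≤ q ^ (2 * r + 1) :=
      (Nat.lt_two_pow_self).le.trans (Nat.pow_le_pow_left hq _)
    have h2 : D ≤ q ^ 2 * q ^ (4 * r) := by
      rw [hD]
      calc _ ≤ q ^ (2 * r + 1) * q ^ (2 * r + 1) := Nat.mul_le_mul_left _ h1
        _ = _ := by ring
    have h3 : ((q : ℝ) ^ (4 * r)) ^ 2 ≤ n := by
      rw [← pow_mul]
      have : (q : ℝ) ^ (4 * r * 2) = Real.exp (r * (8 * g)) := by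
        rw [← Real.exp_log (show (0 : ℝ) < q by linarith), ← hg, ← Real.exp_nat_mul]
        congr 1
        push_cast; ring
      rw [this, ← Real.exp_log hn0]
      exact Real.exp_le_exp.2 hr1
    have h4 : (q : ℝ) ^ (4 * r) ≤ √n := Real.le_sqrt_of_sq_le h3
    calc (D : ℝ) ≤ ((q ^ 2 * q ^ (4 * r) : ℕ) : ℝ) := by exact_mod_cast h2
      _ = (q : ℝ) ^ 2 * q ^ (4 * r) := by push_cast; ring
      _ ≤ _ := by gcongr
  have hlog : l ^ 3 ≤ 216 * √n := by
    have h1 : l ≤ (n : ℝ) ^ (1 / 6 : ℝ) / (1 / 6) := Real.log_le_rpow_div hn0.le (by norm_num)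
    have h2 : l ^ 3 ≤ ((n : ℝ) ^ (1 / 6 : ℝ) / (1 / 6)) ^ 3 := pow_le_pow_left₀ (by linarith) h1 3
    have h3 : ((n : ℝ) ^ (1 / 6 : ℝ)) ^ 3 = √n := by
      rw [← Real.rpow_natCast, ← Real.rpow_mul hn0.le, Real.sqrt_eq_rpow]
      norm_num
    rw [div_pow, h3] at h2
    have h4 : √(n : ℝ) / (1 / 6) ^ 3 = 216 * √(n : ℝ) := by ring
    linarith
  have hsl : √n * l ≤ 216 * (n / l ^ 2) := by
    rw [← mul_div_assoc, le_div_iff₀ (by positivity)]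
    calc √n * l * l ^ 2 = √n * l ^ 3 := by ring
      _ ≤ √n * (216 * √n) := by gcongr
      _ = 216 * (√n * √n) := by ring
      _ = 216 * n := by rw [Real.mul_self_sqrt hn0.le]
  have hfac : ((n : ℝ) + 1) ^ (D * 8) * (D : ℝ) ≤ Real.exp (3888 * q ^ 2 * (n / l ^ 2)) := by
    have h1 : (n : ℝ) + 1 ≤ Real.exp (2 * l) := by
      rw [two_mul, Real.exp_add, hl, Real.exp_log hn0]; nlinarith
    have h2 : (D : ℝ) ≤ Real.exp D := by
      have := Real.add_one_le_exp (D : ℝ); linarith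
    calc ((n : ℝ) + 1) ^ (D * 8) * (D : ℝ) ≤ (Real.exp (2 * l)) ^ (D * 8) * Real.exp D := by
          gcongr
      _ = Real.exp (D * (16 * l + 1)) := by
          rw [← Real.exp_nat_mul, ← Real.exp_add]; congr 1; push_cast; ring
      _ ≤ _ := by
          apply Real.exp_le_exp.2
          calc (D : ℝ) * (16 * l + 1) ≤ (q ^ 2 * √n) * (18 * l) := by
                gcongr
                linarith
            _ = 18 * q ^ 2 * (√n * l) := by ring
            _ ≤ 18 * q ^ 2 * (216 * (n / l ^ 2)) := by gcongr
            _ = _ := by ring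
  have hconf : Real.exp (-(128 * g ^ 2 * (n / l ^ 2))) ≤
      ((3 / 4 + 1 / 4 * Real.cos (Real.pi / (2 * (r + 1)))) ^ n) ^ 2 := by
    set θ : ℝ := Real.pi / (2 * (r + 1)) with hθ
    have hr0 : (0 : ℝ) < r + 1 := by positivity
    have hx : θ ^ 2 / 8 ≤ 1 / (2 * ((r : ℝ) + 1) ^ 2) := by
      rw [hθ, div_pow, div_div, div_le_div_iff₀ (by positivity) (by positivity)]
      have : Real.pi ^ 2 ≤ 16 := by nlinarith [Real.pi_le_four, Real.pi_pos]
      nlinarith [sq_nonneg ((r : ℝ) + 1)]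
    have hx1 : θ ^ 2 / 8 ≤ 1 / 2 := by
      refine hx.trans ?_
      apply one_div_le_one_div_of_le (by norm_num)
      have : (1 : ℝ) ≤ (r : ℝ) + 1 := by linarith [Nat.cast_nonneg (α := ℝ) r]
      nlinarith
    have hc : 1 - θ ^ 2 / 8 ≤ 3 / 4 + 1 / 4 * Real.cos θ := by
      have := Real.one_sub_sq_div_two_le_cos (x := θ)
      linarith
    have he : Real.exp (-(2 * (θ ^ 2 / 8))) ≤ 1 - θ ^ 2 / 8 := by
      have hx0 : 0 ≤ θ ^ 2 / 8 := by positivity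
      rw [Real.exp_neg]
      apply inv_le_of_inv_le₀ (by linarith)
      have := Real.add_one_le_exp (2 * (θ ^ 2 / 8))
      refine le_trans ?_ this
      rw [inv_le_iff_one_le_mul₀ (by linarith)]
      nlinarith
    have h4 : Real.exp (-(128 * g ^ 2 * (n / l ^ 2))) ≤
        ((Real.exp (-(2 * (θ ^ 2 / 8)))) ^ n) ^ 2 := by
      rw [← pow_mul, ← Real.exp_nat_mul]
      apply Real.exp_le_exp.2
      push_cast
      have h5 : 1 / ((r : ℝ) + 1) ^ 2 ≤ 64 * g ^ 2 / l ^ 2 := by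
        rw [div_le_div_iff₀ (by positivity) (by positivity)]
        have := pow_le_pow_left₀ (by linarith) hr2 2
        nlinarith
      have h6 : θ ^ 2 / 8 ≤ (1 / 2) * (64 * g ^ 2 / l ^ 2) := by
        refine hx.trans ?_
        rw [one_div, mul_inv, ← one_div, ← one_div]
        gcongr
      have h7 : 128 * g ^ 2 * (n / l ^ 2) = 2 * n * (64 * g ^ 2 / l ^ 2) := by ring
      rw [h7]
      nlinarith
    refine h4.trans ?_
    gcongr
    exact he.trans hc
  have hp0 := pr_nonneg ⁅N, N⁆ (2 * n) 1
  have h1 : Real.exp (-(128 * g ^ 2 * (n / l ^ 2))) ≤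
      Real.exp (3888 * q ^ 2 * (n / l ^ 2)) * pr ⁅N, N⁆ (2 * n) 1 :=
    hconf.trans (hpre.trans (mul_le_mul_of_nonneg_right hfac hp0))
  have h2 : Real.exp (-((128 * g ^ 2 + 3888 * q ^ 2) * (n / l ^ 2))) =
      Real.exp (-(3888 * q ^ 2 * (n / l ^ 2))) * Real.exp (-(128 * g ^ 2 * (n / l ^ 2))) := by
    rw [← Real.exp_add]; congr 1; ring
  rw [h2]
  calc _ ≤ Real.exp (-(3888 * q ^ 2 * (n / l ^ 2))) *
        (Real.exp (3888 * q ^ 2 * (n / l ^ 2)) * pr ⁅N, N⁆ (2 * n) 1) := by gcongr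
    _ = _ := by rw [← mul_assoc, ← Real.exp_add]; simp

/-- Theorem: for the standard lamplighter presentation
`ℤ_q ≀ ℤ = ⟨a,t | a^q, [a, t^{-n} a t^n] (n ∈ ℤ)⟩ = F_2/N`, the lazy simple random walk
on `Γ₂(N) = F_2/[N,N]` satisfies `μ^{(2n)}(e) ≍ exp(− n/(log n)²)`. -/
theorem return_probability_lamplighter_cover (q : ℕ) (hq : 2 ≤ q)
    (N : Subgroup (FreeGroup (Fin 2)))
    (hN : N = Subgroup.normalClosure
      ({(FreeGroup.of 0) ^ q} ∪
        {g | ∃ n : ℤ, g =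
          (FreeGroup.of 0)⁻¹ *
            ((FreeGroup.of 1) ^ (-n) * FreeGroup.of 0 * (FreeGroup.of 1) ^ n)⁻¹ *
            FreeGroup.of 0 *
            ((FreeGroup.of 1) ^ (-n) * FreeGroup.of 0 * (FreeGroup.of 1) ^ n)}))
    [N.Normal] :
    ∃ C : ℝ, 1 ≤ C ∧ ∀ n : ℕ, 2 ≤ n →
      Real.exp (-C * (n : ℝ) / (Real.log n) ^ 2)
        ≤ convPow (lazySRWQuot 2 ⁅N, N⁆) (2 * n) 1 ∧
      convPow (lazySRWQuot 2 ⁅N, N⁆) (2 * n) 1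
        ≤ Real.exp (-(1 / C) * (n : ℝ) / (Real.log n) ^ 2) := by
  obtain ⟨C₀, h0, hU⟩ := upper_final q hq N hN
  obtain ⟨C₁, h1, hL⟩ := lower_final q hq N hN
  refine ⟨1 + C₀ + C₁, by linarith, fun n hn => ?_⟩
  have hx : 0 ≤ (n : ℝ) / Real.log n ^ 2 := by positivity
  rw [convPow_eq]
  constructor
  · refine le_trans (Real.exp_le_exp.2 ?_) (hL n hn)
    rw [mul_div_assoc, neg_mul]
    apply neg_le_neg
    apply mul_le_mul_of_nonneg_right _ hx
    linarith
  · refine (hU n hn).trans (Real.exp_le_exp.2 ?_)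
    rw [mul_div_assoc, neg_mul]
    apply neg_le_neg
    apply mul_le_mul_of_nonneg_right _ hx
    apply one_div_le_one_div_of_le h0
    linarith

end
end

section
/- Let q ≥ 2 and let N be the normal closure in the free group F_2 = ⟨a,b⟩ of the single element a⁻¹bab^{−q}, so that F_2/N is the Baumslag–Solitar group BS(1,q) = ⟨a,b | a⁻¹ba = b^q⟩. Let μ be the lazy simple random walk measure on Γ_2(N) = F_2/[N,N]. Then there exists a constant C ≥ 1 such that for all n ≥ 2: exp(−C·n/(log n)^2) ≤ μ^{(2n)}(e) ≤ exp(−(1/C)·n/(log n)^2). -/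
open scoped Pointwise

noncomputable section

namespace BSCover
set_option linter.unusedSectionVars false

section Ops
variable {G : Type*} [Group G]

/-- Left translation of finitely supported functions. -/
noncomputable def Lt (g : G) : (G →₀ ℝ) →ₗ[ℝ] (G →₀ ℝ) := Finsupp.lmapDomain ℝ ℝ (fun x => g * x)

/-- Integration of a function against a finitely supported function. -/
noncomputable def EE (φ : G → ℝ) : (G →₀ ℝ) →ₗ[ℝ] ℝ := Finsupp.linearCombination ℝ φ

lemma Lt_apply (g : G) (f : G →₀ ℝ) (x : G) : Lt g f x = f (g⁻¹ * x) := by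
  have h := Finsupp.mapDomain_apply (mul_right_injective g) f (g⁻¹ * x)
  simpa [Lt, Finsupp.lmapDomain_apply] using h

lemma Lt_one (f : G →₀ ℝ) : Lt 1 f = f := by
  ext x; simp [Lt_apply]

lemma Lt_mul (g h : G) (f : G →₀ ℝ) : Lt (g * h) f = Lt g (Lt h f) := by
  ext x; simp [Lt_apply, mul_assoc]

lemma EE_Lt (φ : G → ℝ) (g : G) (f : G →₀ ℝ) : EE φ (Lt g f) = EE (fun x => φ (g * x)) f := by
  simp only [EE, Lt, Finsupp.lmapDomain_apply]
  rw [Finsupp.linearCombination_mapDomain]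
  rfl

lemma EE_def (φ : G → ℝ) (f : G →₀ ℝ) : EE φ f = ∑ x ∈ f.support, f x * φ x := by
  simp [EE, Finsupp.linearCombination_apply, Finsupp.sum]

lemma EE_eq_sum (φ : G → ℝ) (f : G →₀ ℝ) (s : Finset G) (hs : f.support ⊆ s) :
    EE φ f = ∑ x ∈ s, f x * φ x := by
  rw [EE_def]
  apply Finset.sum_subset hs
  intro x _ hx
  simp [Finsupp.notMem_support_iff.1 hx]

lemma EE_mono {φ ψ : G → ℝ} {f : G →₀ ℝ} (hf : ∀ x, 0 ≤ f x) (h : ∀ x, φ x ≤ ψ x) :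
    EE φ f ≤ EE ψ f := by
  rw [EE_def, EE_def]
  exact Finset.sum_le_sum fun x _ => mul_le_mul_of_nonneg_left (h x) (hf x)

lemma EE_nonneg {φ : G → ℝ} {f : G →₀ ℝ} (hf : ∀ x, 0 ≤ f x) (h : ∀ x, 0 ≤ φ x) :
    0 ≤ EE φ f := by
  rw [EE_def]
  exact Finset.sum_nonneg fun x _ => mul_nonneg (hf x) (h x)

lemma EE_add (φ ψ : G → ℝ) (f : G →₀ ℝ) : EE (fun x => φ x + ψ x) f = EE φ f + EE ψ f := by
  simp only [EE_def, ← Finset.sum_add_distrib, mul_add]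

lemma EE_smul (c : ℝ) (φ : G → ℝ) (f : G →₀ ℝ) : EE (fun x => c * φ x) f = c * EE φ f := by
  simp only [EE_def, Finset.mul_sum]
  exact Finset.sum_congr rfl fun x _ => by ring

/-- inner product -/
noncomputable def ip (f g : G →₀ ℝ) : ℝ := EE (fun x => g x) f

lemma ip_eq_sum (f g : G →₀ ℝ) (s : Finset G) (hs : f.support ⊆ s) :
    ip f g = ∑ x ∈ s, f x * g x := EE_eq_sum _ _ s hs

lemma ip_comm (f g : G →₀ ℝ) : ip f g = ip g f := by
  classical
  rw [ip_eq_sum f g (f.support ∪ g.support) Finset.subset_union_left,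
    ip_eq_sum g f (f.support ∪ g.support) Finset.subset_union_right]
  exact Finset.sum_congr rfl fun x _ => by ring

lemma ip_add_left (f g h : G →₀ ℝ) : ip (f + g) h = ip f h + ip g h := by simp [ip]
lemma ip_sub_left (f g h : G →₀ ℝ) : ip (f - g) h = ip f h - ip g h := by simp [ip]
lemma ip_smul_left (c : ℝ) (f h : G →₀ ℝ) : ip (c • f) h = c * ip f h := by simp [ip]
lemma ip_add_right (f g h : G →₀ ℝ) : ip h (f + g) = ip h f + ip h g := by
  rw [ip_comm, ip_add_left, ip_comm f, ip_comm g]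
lemma ip_sub_right (f g h : G →₀ ℝ) : ip h (f - g) = ip h f - ip h g := by
  rw [ip_comm, ip_sub_left, ip_comm f, ip_comm g]
lemma ip_smul_right (c : ℝ) (f h : G →₀ ℝ) : ip h (c • f) = c * ip h f := by
  rw [ip_comm, ip_smul_left, ip_comm f]
lemma ip_sum_left {ι : Type*} (s : Finset ι) (F : ι → G →₀ ℝ) (h : G →₀ ℝ) :
    ip (∑ i ∈ s, F i) h = ∑ i ∈ s, ip (F i) h := by simp [ip]

lemma ip_self_nonneg (f : G →₀ ℝ) : 0 ≤ ip f f := by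
  rw [ip_eq_sum f f f.support subset_rfl]
  exact Finset.sum_nonneg fun x _ => mul_self_nonneg _

lemma ip_Lt (g : G) (f h : G →₀ ℝ) : ip (Lt g f) h = ip f (Lt g⁻¹ h) := by
  simp [ip, EE_Lt, Lt_apply]

lemma ip_Lt_Lt (g : G) (f h : G →₀ ℝ) : ip (Lt g f) (Lt g h) = ip f h := by
  rw [ip_Lt, ← Lt_mul, inv_mul_cancel, Lt_one]

lemma ip_cs (f g : G →₀ ℝ) : ip f g ^ 2 ≤ ip f f * ip g g := by
  classical
  rw [ip_eq_sum f g (f.support ∪ g.support) Finset.subset_union_left,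
    ip_eq_sum f f (f.support ∪ g.support) Finset.subset_union_left,
    ip_eq_sum g g (f.support ∪ g.support) Finset.subset_union_right]
  have := Finset.sum_mul_sq_le_sq_mul_sq (f.support ∪ g.support) (fun x => f x) (fun x => g x)
  simpa [pow_two] using this

/-- norm -/
noncomputable def nrm (f : G →₀ ℝ) : ℝ := Real.sqrt (ip f f)

lemma nrm_nonneg (f : G →₀ ℝ) : 0 ≤ nrm f := Real.sqrt_nonneg _
lemma nrm_sq (f : G →₀ ℝ) : nrm f ^ 2 = ip f f := Real.sq_sqrt (ip_self_nonneg f)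

lemma ip_le_nrm (f g : G →₀ ℝ) : ip f g ≤ nrm f * nrm g := by
  apply le_of_sq_le_sq _ (mul_nonneg (nrm_nonneg f) (nrm_nonneg g))
  rw [mul_pow, nrm_sq, nrm_sq]; exact ip_cs f g

lemma nrm_add_le (f g : G →₀ ℝ) : nrm (f + g) ≤ nrm f + nrm g := by
  apply le_of_sq_le_sq _ (add_nonneg (nrm_nonneg f) (nrm_nonneg g))
  rw [nrm_sq, ip_add_left, ip_add_right, ip_add_right, ip_comm g f]
  nlinarith [ip_le_nrm f g, nrm_sq f, nrm_sq g]

lemma nrm_Lt (g : G) (f : G →₀ ℝ) : nrm (Lt g f) = nrm f := by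
  simp [nrm, ip_Lt_Lt]

/-- displacement -/
noncomputable def nd (f : G →₀ ℝ) (g : G) : ℝ := nrm (Lt g f - f)

lemma nd_nonneg (f : G →₀ ℝ) (g : G) : 0 ≤ nd f g := nrm_nonneg _

lemma nd_one (f : G →₀ ℝ) : nd f 1 = 0 := by simp [nd, Lt_one, nrm, ip]

lemma nd_mul (f : G →₀ ℝ) (g h : G) : nd f (g * h) ≤ nd f g + nd f h := by
  have : Lt (g * h) f - f = Lt g (Lt h f - f) + (Lt g f - f) := by
    rw [map_sub, Lt_mul]; abel
  rw [nd, this]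
  refine (nrm_add_le _ _).trans ?_
  rw [nrm_Lt, add_comm]; rfl

lemma nd_sq (f : G →₀ ℝ) (g : G) : nd f g ^ 2 = 2 * ip f f - 2 * ip (Lt g f) f := by
  rw [nd, nrm_sq, ip_sub_left, ip_sub_right, ip_sub_right, ip_Lt_Lt, ip_comm f (Lt g f)]; ring

lemma nd_inv (f : G →₀ ℝ) (g : G) : nd f g⁻¹ = nd f g := by
  have h : nd f g⁻¹ ^ 2 = nd f g ^ 2 := by
    rw [nd_sq, nd_sq, ip_Lt g⁻¹, inv_inv, ip_comm f (Lt g f)]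
  exact (sq_eq_sq₀ (nd_nonneg _ _) (nd_nonneg _ _)).1 h

lemma nd_pow (f : G →₀ ℝ) (g : G) (n : ℕ) : nd f (g ^ n) ≤ n * nd f g := by
  induction n with
  | zero => simp [nd_one]
  | succ n ih =>
    rw [pow_succ]; push_cast
    linarith [nd_mul f (g ^ n) g]

/-- lazy random walk operator on a two generator group -/
noncomputable def PP (a b : G) (f : G →₀ ℝ) : G →₀ ℝ :=
  (1 / 2 : ℝ) • f + (1 / 8 : ℝ) • (Lt a f + Lt a⁻¹ f + Lt b f + Lt b⁻¹ f)

lemma ip_PP (a b : G) (f h : G →₀ ℝ) : ip (PP a b f) h = ip f (PP a b h) := by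
  simp only [PP, ip_add_left, ip_add_right, ip_smul_left, ip_smul_right, ip_Lt, inv_inv]
  ring

lemma PP_nonneg (a b : G) (f : G →₀ ℝ) (hf : ∀ x, 0 ≤ f x) (x : G) : 0 ≤ PP a b f x := by
  simp only [PP, Finsupp.add_apply, Finsupp.smul_apply, Lt_apply, smul_eq_mul]
  have := hf x; have := hf (a⁻¹ * x); have := hf (a⁻¹⁻¹ * x); have := hf (b⁻¹ * x)
  have := hf (b⁻¹⁻¹ * x)
  positivity

lemma EE_PP (a b : G) (φ : G → ℝ) (f : G →₀ ℝ) : EE φ (PP a b f) =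
    1 / 2 * EE φ f + 1 / 8 * (EE (fun x => φ (a * x)) f + EE (fun x => φ (a⁻¹ * x)) f
      + EE (fun x => φ (b * x)) f + EE (fun x => φ (b⁻¹ * x)) f) := by
  simp only [PP, map_add, map_smul, EE_Lt, smul_eq_mul]

/-- distribution of the walk at time n -/
noncomputable def wk (a b : G) : ℕ → (G →₀ ℝ)
  | 0 => Finsupp.single 1 1
  | n + 1 => PP a b (wk a b n)

lemma wk_nonneg (a b : G) (n : ℕ) (x : G) : 0 ≤ wk a b n x := by
  classical
  induction n generalizing x with
  | zero => simp only [wk, Finsupp.single_apply]; split_ifs <;> norm_num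
  | succ n ih => exact PP_nonneg a b _ ih x

lemma wk_mass (a b : G) (n : ℕ) : EE (fun _ => 1) (wk a b n) = 1 := by
  induction n with
  | zero => simp [wk, EE]
  | succ n ih => rw [wk, EE_PP]; simp only [ih]; norm_num

lemma wk_ip (a b : G) (m n : ℕ) : ip (wk a b m) (wk a b n) = wk a b (m + n) 1 := by
  induction m generalizing n with
  | zero => simp [wk, ip, EE]
  | succ m ih =>
    rw [wk, ip_PP]
    have := ih (n + 1)
    rw [wk] at this
    rw [this]; congr 2; omega

lemma wk_even (a b : G) (n : ℕ) : wk a b (2 * n) 1 = ip (wk a b n) (wk a b n) := by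
  rw [wk_ip, two_mul]

lemma energy (a b : G) (f : G →₀ ℝ) :
    nd f a ^ 2 + nd f b ^ 2 ≤ 8 * (ip f f - ip (PP a b f) (PP a b f)) := by
  have key : ∀ x y : G →₀ ℝ, 2 * ip x y ≤ ip x x + ip y y := by
    intro x y
    have := ip_self_nonneg (x - y)
    rw [ip_sub_left, ip_sub_right, ip_sub_right, ip_comm y x] at this
    linarith
  have ha := nd_sq f a
  have hb := nd_sq f b
  have hai := nd_sq f a⁻¹
  have hbi := nd_sq f b⁻¹
  rw [nd_inv] at hai hbi
  have e : PP a b f = (1 / 4 : ℝ) • ((1 / 2 : ℝ) • (f + Lt a f) + (1 / 2 : ℝ) • (f + Lt a⁻¹ f)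
      + (1 / 2 : ℝ) • (f + Lt b f) + (1 / 2 : ℝ) • (f + Lt b⁻¹ f)) := by
    rw [PP]; module
  have h4 : ∀ x : G, ip ((1 / 2 : ℝ) • (f + Lt x f)) ((1 / 2 : ℝ) • (f + Lt x f)) =
      ip f f - 1 / 4 * nd f x ^ 2 := by
    intro x
    rw [nd_sq]
    simp only [ip_add_left, ip_add_right, ip_smul_left, ip_smul_right, ip_Lt_Lt,
      ip_comm f (Lt x f)]
    ring
  have ea := h4 a
  have eb := h4 b
  have eai := h4 a⁻¹
  have ebi := h4 b⁻¹
  rw [nd_inv] at eai ebi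
  rw [e]
  generalize (1 / 2 : ℝ) • (f + Lt a f) = A at *
  generalize (1 / 2 : ℝ) • (f + Lt a⁻¹ f) = A' at *
  generalize (1 / 2 : ℝ) • (f + Lt b f) = B at *
  generalize (1 / 2 : ℝ) • (f + Lt b⁻¹ f) = B' at *
  simp only [ip_smul_left, ip_smul_right, ip_add_left, ip_add_right]
  have := key A A'; have := key A B; have := key A B'; have := key A' B; have := key A' B'
  have := key B B'
  rw [ip_comm A' A, ip_comm B A, ip_comm B' A, ip_comm B A', ip_comm B' A', ip_comm B' B]
  linarith

end Ops
end BSCover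

namespace BSCover

section QQ
variable {G : Type*} [Group G]

/-- averaged lamp switching operator -/
noncomputable def QQ (M : ℕ) (τ : ℕ → G) (f : G →₀ ℝ) : G →₀ ℝ :=
  (1 / M : ℝ) • ∑ y ∈ Finset.range M,
    ((1 / 2 : ℝ) • f + (1 / 4 : ℝ) • Lt (τ y) f + (1 / 4 : ℝ) • Lt (τ y)⁻¹ f)

lemma EE_QQ (M : ℕ) (τ : ℕ → G) (φ : G → ℝ) (f : G →₀ ℝ) : EE φ (QQ M τ f) =
    (1 / M : ℝ) * ∑ y ∈ Finset.range M,
      EE (fun g => 1 / 2 * φ g + 1 / 4 * φ (τ y * g) + 1 / 4 * φ ((τ y)⁻¹ * g)) f := by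
  simp only [QQ, map_smul, map_sum, map_add, EE_Lt, smul_eq_mul, EE_add, EE_smul]

lemma ip_QQ (M : ℕ) (τ : ℕ → G) (f h : G →₀ ℝ) : ip (QQ M τ f) h = ip f (QQ M τ h) := by
  rw [ip_comm f]
  simp only [QQ, ip_smul_left, ip_sum_left]
  congr 1
  refine Finset.sum_congr rfl fun y _ => ?_
  simp only [ip_smul_left, ip_add_left]
  rw [ip_Lt, ip_Lt, inv_inv, ip_comm h, ip_comm (Lt (τ y) h), ip_comm (Lt (τ y)⁻¹ h)]
  ring

lemma QQ_nonneg (M : ℕ) (τ : ℕ → G) (f : G →₀ ℝ) (hf : ∀ x, 0 ≤ f x) (x : G) :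
    0 ≤ QQ M τ f x := by
  simp only [QQ, Finsupp.smul_apply, Finsupp.finsetSum_apply, Finsupp.add_apply, Lt_apply,
    smul_eq_mul]
  refine mul_nonneg (by positivity) (Finset.sum_nonneg fun y _ => ?_)
  have := hf x; have := hf ((τ y)⁻¹ * x); have := hf ((τ y)⁻¹⁻¹ * x)
  positivity

lemma QQ_gap (M : ℕ) (hM : 0 < M) (τ : ℕ → G) (f : G →₀ ℝ) (B : ℝ)
    (hB : ∀ y < M, nd f (τ y) ^ 2 ≤ B) : ip f f - ip (QQ M τ f) f ≤ B / 4 := by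
  have hM' : (0 : ℝ) < M := by exact_mod_cast hM
  have h1 : ip (QQ M τ f) f = (1 / M : ℝ) * ∑ y ∈ Finset.range M,
      (ip f f - 1 / 4 * nd f (τ y) ^ 2) := by
    simp only [QQ, ip_smul_left, ip_sum_left]
    congr 1
    refine Finset.sum_congr rfl fun y _ => ?_
    have h := nd_sq f (τ y)
    simp only [ip_smul_left, ip_add_left]
    rw [ip_Lt (τ y)⁻¹, inv_inv, ip_comm f (Lt (τ y) f)]
    linarith
  have h2 : ∑ y ∈ Finset.range M, (ip f f - B / 4) ≤
      ∑ y ∈ Finset.range M, (ip f f - 1 / 4 * nd f (τ y) ^ 2) := by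
    refine Finset.sum_le_sum fun y hy => ?_
    have := hB y (Finset.mem_range.1 hy)
    linarith
  rw [Finset.sum_const, Finset.card_range, nsmul_eq_mul] at h2
  have h3 : ip f f - B / 4 ≤ ip (QQ M τ f) f := by
    rw [h1, one_div, ← div_eq_inv_mul, le_div_iff₀ hM']
    linarith
  linarith

open Classical in
lemma QQ_atom (M : ℕ) (hM : 0 < M) (τ : ℕ → G) (χ : ℕ → G → ℤ)
    (hχ : ∀ x < M, ∀ y < M, ∀ g, χ x (τ y * g) = χ x g + if x = y then 1 else 0)
    (f : G →₀ ℝ) (hf : ∀ x, 0 ≤ f x) (hm : EE (fun _ => 1) f ≤ 1) (k : ℕ) :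
    ∀ (A : Finset ℕ) (v : ℕ → ℤ), 10 * (A.card + k) ≤ M →
      EE (fun g => if ∀ x < M, x ∉ A → χ x g = v x then 1 else 0) ((QQ M τ)^[k] f)
        ≤ (11 / 20 : ℝ) ^ k := by
  have hM' : (0 : ℝ) < M := by exact_mod_cast hM
  have hχi : ∀ x < M, ∀ y < M, ∀ g, χ x ((τ y)⁻¹ * g) = χ x g - if x = y then 1 else 0 := by
    intro x hx y hy g
    have := hχ x hx y hy ((τ y)⁻¹ * g)
    rw [mul_inv_cancel_left] at this
    omega
  have hnn : ∀ k, ∀ x, 0 ≤ (QQ M τ)^[k] f x := by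
    intro k
    induction k with
    | zero => simpa using hf
    | succ k ih => rw [Function.iterate_succ_apply']; exact QQ_nonneg M τ _ ih
  induction k with
  | zero =>
    intro A v _
    simp only [Function.iterate_zero, id, pow_zero]
    refine (EE_mono hf fun x => ?_).trans hm
    split_ifs <;> norm_num
  | succ k ih =>
    intro A v hA
    rw [Function.iterate_succ_apply', EE_QQ]
    set h := (QQ M τ)^[k] f
    have hh : ∀ x, 0 ≤ h x := hnn k
    have hterm : ∀ y ∈ Finset.range M,
        EE (fun g => 1 / 2 * (if ∀ x < M, x ∉ A → χ x g = v x then (1 : ℝ) else 0)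
          + 1 / 4 * (if ∀ x < M, x ∉ A → χ x (τ y * g) = v x then (1 : ℝ) else 0)
          + 1 / 4 * (if ∀ x < M, x ∉ A → χ x ((τ y)⁻¹ * g) = v x then (1 : ℝ) else 0)) h
        ≤ (if y ∈ A then 1 else 1 / 2) * (11 / 20 : ℝ) ^ k := by
      intro y hy
      have hyM := Finset.mem_range.1 hy
      by_cases hyA : y ∈ A
      · rw [if_pos hyA, one_mul]
        refine le_trans (EE_mono hh fun g => ?_) (ih A v (by omega))
        have e1 : (∀ x < M, x ∉ A → χ x (τ y * g) = v x) ↔ (∀ x < M, x ∉ A → χ x g = v x) := by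
          refine forall_congr' fun x => forall_congr' fun hx => forall_congr' fun hxA => ?_
          rw [hχ x hx y hyM, if_neg (by rintro rfl; exact hxA hyA), add_zero]
        have e2 : (∀ x < M, x ∉ A → χ x ((τ y)⁻¹ * g) = v x) ↔
            (∀ x < M, x ∉ A → χ x g = v x) := by
          refine forall_congr' fun x => forall_congr' fun hx => forall_congr' fun hxA => ?_
          rw [hχi x hx y hyM, if_neg (by rintro rfl; exact hxA hyA), sub_zero]
        simp only [e1, e2]
        split_ifs <;> norm_num
      · rw [if_neg hyA]
        have hc : (insert y A).card = A.card + 1 := Finset.card_insert_of_notMem hyA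
        have := ih (insert y A) v (by omega)
        refine le_trans (EE_mono (ψ := fun g => 1 / 2 *
          (if ∀ x < M, x ∉ insert y A → χ x g = v x then (1 : ℝ) else 0)) hh fun g => ?_) ?_
        · by_cases hI : ∀ x < M, x ∉ insert y A → χ x g = v x
          · rw [if_pos hI]
            have n1 : (∀ x < M, x ∉ A → χ x g = v x) → χ y g = v y := fun H => H y hyM hyA
            have n2 : (∀ x < M, x ∉ A → χ x (τ y * g) = v x) → χ y g + 1 = v y := fun H => by
              have := H y hyM hyA
              rwa [hχ y hyM y hyM, if_pos rfl] at this
            have n3 : (∀ x < M, x ∉ A → χ x ((τ y)⁻¹ * g) = v x) → χ y g - 1 = v y := fun H => by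
              have := H y hyM hyA
              rwa [hχi y hyM y hyM, if_pos rfl] at this
            split_ifs with h1 h2 h3 h3 h2 h3 h3 <;> first
              | (exfalso; have := n1 h1; have := n2 h2; omega)
              | (exfalso; have := n1 h1; have := n3 h3; omega)
              | (exfalso; have := n2 h2; have := n3 h3; omega)
              | (norm_num; done)
          · rw [if_neg hI]
            have n1 : ¬ (∀ x < M, x ∉ A → χ x g = v x) := fun H => hI fun x hx hxA =>
              H x hx fun h => hxA (Finset.mem_insert_of_mem h)
            have n2 : ¬ (∀ x < M, x ∉ A → χ x (τ y * g) = v x) := fun H => hI fun x hx hxA => by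
              have := H x hx fun h => hxA (Finset.mem_insert_of_mem h)
              rwa [hχ x hx y hyM, if_neg (by rintro rfl; exact hxA (Finset.mem_insert_self _ _)),
                add_zero] at this
            have n3 : ¬ (∀ x < M, x ∉ A → χ x ((τ y)⁻¹ * g) = v x) := fun H => hI fun x hx hxA => by
              have := H x hx fun h => hxA (Finset.mem_insert_of_mem h)
              rwa [hχi x hx y hyM, if_neg (by rintro rfl; exact hxA (Finset.mem_insert_self _ _)),
                sub_zero] at this
            rw [if_neg n1, if_neg n2, if_neg n3]; norm_num
        · rw [EE_smul]; linarith
    refine le_trans (mul_le_mul_of_nonneg_left (Finset.sum_le_sum hterm) (by positivity)) ?_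
    have hs : ∑ y ∈ Finset.range M, (if y ∈ A then (1 : ℝ) else 1 / 2) ≤ 11 / 20 * M := by
      have e : ∀ y ∈ Finset.range M, (if y ∈ A then (1 : ℝ) else 1 / 2) =
          1 / 2 + if y ∈ A then (1 / 2 : ℝ) else 0 := by
        intro y _; split_ifs <;> norm_num
      rw [Finset.sum_congr rfl e, Finset.sum_add_distrib, ← Finset.sum_filter]
      simp only [Finset.sum_const, Finset.card_range, nsmul_eq_mul]
      have c : ((Finset.range M).filter (· ∈ A)).card ≤ A.card :=
        Finset.card_le_card fun x hx => (Finset.mem_filter.1 hx).2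
      have c' : (((Finset.range M).filter (· ∈ A)).card : ℝ) ≤ A.card := by exact_mod_cast c
      have c2 : (10 : ℝ) * A.card ≤ M := by
        have : 10 * A.card ≤ M := by omega
        exact_mod_cast this
      linarith
    rw [← Finset.sum_mul, pow_succ]
    have hp : (0 : ℝ) ≤ (11 / 20) ^ k := by positivity
    calc (1 / M : ℝ) * ((∑ y ∈ Finset.range M, (if y ∈ A then (1 : ℝ) else 1 / 2)) * (11 / 20) ^ k)
        ≤ (1 / M : ℝ) * ((11 / 20 * M) * (11 / 20) ^ k) := by gcongr
      _ = _ := by field_simp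

lemma QQ_pow_lower (M : ℕ) (τ : ℕ → G) (f : G →₀ ℝ) (hpos : 0 < ip f f) (θ : ℝ) (hθ : 0 ≤ θ)
    (h : θ * ip f f ≤ ip (QQ M τ f) f) (j : ℕ) :
    θ ^ (2 ^ j) * ip f f ≤ ip ((QQ M τ)^[2 ^ j] f) f := by
  have hsa : ∀ k (x y : G →₀ ℝ), ip ((QQ M τ)^[k] x) y = ip x ((QQ M τ)^[k] y) := by
    intro k
    induction k with
    | zero => simp
    | succ k ih => 
      intro x y
      rw [Function.iterate_succ_apply', ip_QQ, ih, ← Function.iterate_succ_apply]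
  induction j with
  | zero => simpa using h
  | succ j ih =>
    have e : ip ((QQ M τ)^[2 ^ (j + 1)] f) f =
        ip ((QQ M τ)^[2 ^ j] f) ((QQ M τ)^[2 ^ j] f) := by
      rw [pow_succ, mul_two, Function.iterate_add_apply, hsa]
    rw [e]
    have cs := ip_cs ((QQ M τ)^[2 ^ j] f) f
    set a := ip ((QQ M τ)^[2 ^ j] f) ((QQ M τ)^[2 ^ j] f)
    set b := ip ((QQ M τ)^[2 ^ j] f) f
    have h1 : (θ ^ (2 ^ j) * ip f f) ^ 2 ≤ b ^ 2 := by
      apply pow_le_pow_left₀ (by positivity) ih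
    have h2 : θ ^ (2 ^ (j + 1)) * ip f f * ip f f ≤ a * ip f f := by
      have : θ ^ (2 ^ (j + 1)) * ip f f * ip f f = (θ ^ (2 ^ j) * ip f f) ^ 2 := by
        rw [pow_succ 2 j, pow_mul]; ring
      linarith
    exact le_of_mul_le_mul_right h2 hpos

/-- Spectral-gap type estimate for nonnegative functions of mass one and large norm. -/
lemma QQ_main (M : ℕ) (τ : ℕ → G) (χ : ℕ → G → ℤ)
    (hχ : ∀ x < M, ∀ y < M, ∀ g, χ x (τ y * g) = χ x g + if x = y then 1 else 0)
    (f : G →₀ ℝ) (hf : ∀ x, 0 ≤ f x) (hm : EE (fun _ => 1) f ≤ 1) (j : ℕ)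
    (hj : 10 * 2 ^ j ≤ M) (hbig : (3 / 5 : ℝ) ^ (2 ^ j) ≤ ip f f) :
    ip (QQ M τ f) f ≤ 11 / 12 * ip f f := by
  classical
  have hpos : 0 < ip f f := lt_of_lt_of_le (by positivity) hbig
  have hM : 0 < M := by have : 0 < 2 ^ j := by positivity
                        omega
  by_contra hcon
  push Not at hcon
  set θ := ip (QQ M τ f) f / ip f f with hθ
  have hθ1 : 11 / 12 < θ := by rw [hθ, lt_div_iff₀ hpos]; exact hcon
  have h1 := QQ_pow_lower M τ f hpos θ (by linarith) (by rw [hθ, div_mul_cancel₀ _ hpos.ne']) j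
  have h2 : ip ((QQ M τ)^[2 ^ j] f) f ≤ (11 / 20 : ℝ) ^ (2 ^ j) := by
    have hat : ∀ g, (QQ M τ)^[2 ^ j] f g ≤ (11 / 20 : ℝ) ^ (2 ^ j) := by
      intro g
      have hnn : ∀ k, ∀ x, 0 ≤ (QQ M τ)^[k] f x := by
        intro k
        induction k with
        | zero => simpa using hf
        | succ k ih => rw [Function.iterate_succ_apply']; exact QQ_nonneg M τ _ ih
      have := QQ_atom M hM τ χ hχ f hf hm (2 ^ j) ∅ (fun x => χ x g) (by simpa using hj)
      refine le_trans ?_ this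
      by_cases hg : g ∈ ((QQ M τ)^[2 ^ j] f).support
      · rw [EE_def]
        have hl := Finset.single_le_sum (f := fun x => (QQ M τ)^[2 ^ j] f x *
          (if ∀ y < M, y ∉ (∅ : Finset ℕ) → χ y x = χ y g then (1 : ℝ) else 0))
          (fun i _ => mul_nonneg (hnn _ i) (by split_ifs <;> norm_num)) hg
        simpa using hl
      · rw [Finsupp.notMem_support_iff.1 hg]
        exact EE_nonneg (hnn _) fun x => by split_ifs <;> norm_num
    rw [ip_comm, ip]
    have hp : (0 : ℝ) ≤ (11 / 20) ^ (2 ^ j) := by positivity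
    calc EE (fun x => (QQ M τ)^[2 ^ j] f x) f ≤ EE (fun x => (11 / 20 : ℝ) ^ (2 ^ j) * 1) f :=
          EE_mono hf fun x => by simpa using hat x
      _ = (11 / 20 : ℝ) ^ (2 ^ j) * EE (fun _ => 1) f := EE_smul _ _ _
      _ ≤ _ := by nlinarith
  have h3 : (11 / 12 : ℝ) ^ (2 ^ j) < θ ^ (2 ^ j) :=
    pow_lt_pow_left₀ hθ1 (by norm_num) (by positivity)
  have h4 : (11 / 20 : ℝ) ^ (2 ^ j) = (11 / 12) ^ (2 ^ j) * (3 / 5) ^ (2 ^ j) := by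
    rw [← mul_pow]; norm_num
  have h5 : (11 / 12 : ℝ) ^ (2 ^ j) * (3 / 5) ^ (2 ^ j) < θ ^ (2 ^ j) * ip f f :=
    mul_lt_mul h3 hbig (by positivity) (by positivity)
  linarith

/-- One-step decay of the return probability. -/
lemma step_decay (a b : G) (M : ℕ) (τ : ℕ → G) (χ : ℕ → G → ℤ)
    (hχ : ∀ x < M, ∀ y < M, ∀ g, χ x (τ y * g) = χ x g + if x = y then 1 else 0)
    (l : ℝ) (hl : 0 < l) (hτ : ∀ y < M, ∀ f δ, nd f a ≤ δ → nd f b ≤ δ → nd f (τ y) ≤ l * δ)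
    (n j : ℕ) (hj : 10 * 2 ^ j ≤ M) (hbig : (3 / 5 : ℝ) ^ (2 ^ j) ≤ wk a b (2 * n) 1) :
    wk a b (2 * (n + 1)) 1 ≤ (1 - 1 / (24 * l ^ 2)) * wk a b (2 * n) 1 := by
  rw [wk_even] at hbig
  rw [wk_even, wk_even, wk]
  set f := wk a b n with hf
  have hM : 0 < M := by have : 0 < 2 ^ j := by positivity
                        omega
  have h1 := QQ_main M τ χ hχ f (wk_nonneg a b n) (wk_mass a b n).le j hj hbig
  have h2 := energy a b f
  set e := ip f f - ip (PP a b f) (PP a b f) with he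
  have he0 : 0 ≤ 8 * e := le_trans (by positivity) h2
  have ha : nd f a ≤ Real.sqrt (8 * e) := Real.le_sqrt_of_sq_le (by nlinarith [sq_nonneg (nd f b)])
  have hb : nd f b ≤ Real.sqrt (8 * e) := Real.le_sqrt_of_sq_le (by nlinarith [sq_nonneg (nd f a)])
  have h3 := QQ_gap M hM τ f (l ^ 2 * (8 * e)) (fun y hy => by
    have := pow_le_pow_left₀ (nd_nonneg _ _) (hτ y hy f _ ha hb) 2
    rwa [mul_pow, Real.sq_sqrt he0] at this)
  have h4 : ip f f / (24 * l ^ 2) ≤ e := by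
    rw [div_le_iff₀ (by positivity)]; nlinarith
  have : (1 - 1 / (24 * l ^ 2)) * ip f f = ip f f - ip f f / (24 * l ^ 2) := by ring
  rw [this]; linarith

lemma wk_decay (a b : G) (M : ℕ) (τ : ℕ → G) (χ : ℕ → G → ℤ)
    (hχ : ∀ x < M, ∀ y < M, ∀ g, χ x (τ y * g) = χ x g + if x = y then 1 else 0)
    (l : ℝ) (hl : 1 ≤ l) (hτ : ∀ y < M, ∀ f δ, nd f a ≤ δ → nd f b ≤ δ → nd f (τ y) ≤ l * δ)
    (n j : ℕ) (hj : 10 * 2 ^ j ≤ M) :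
    wk a b (2 * n) 1 ≤ (3 / 5 : ℝ) ^ (2 ^ j) ∨
      wk a b (2 * n) 1 ≤ Real.exp (- (n / (24 * l ^ 2))) := by
  by_cases hb : wk a b (2 * n) 1 ≤ (3 / 5 : ℝ) ^ (2 ^ j)
  · exact Or.inl hb
  right
  push Not at hb
  have hanti : ∀ m, wk a b (2 * (m + 1)) 1 ≤ wk a b (2 * m) 1 := by
    intro m
    rw [wk_even, wk_even, wk]
    nlinarith [energy a b (wk a b m), sq_nonneg (nd (wk a b m) a), sq_nonneg (nd (wk a b m) b)]
  have hanti' : Antitone fun m => wk a b (2 * m) 1 := antitone_nat_of_succ_le hanti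
  have hstep : ∀ m ≤ n, wk a b (2 * m) 1 ≤ Real.exp (- (m / (24 * l ^ 2))) := by
    intro m
    induction m with
    | zero => intro _; simp [wk]
    | succ m ih =>
      intro hmn
      have h1 := ih (by omega)
      have h2 := step_decay a b M τ χ hχ l (by linarith) hτ m j hj
        (hb.le.trans (hanti' (by omega : m ≤ n)))
      have h3 := Real.add_one_le_exp (-(1 / (24 * l ^ 2)))
      have h4 : Real.exp (-(((m + 1 : ℕ) : ℝ) / (24 * l ^ 2))) =
          Real.exp (-(1 / (24 * l ^ 2))) * Real.exp (-(m / (24 * l ^ 2))) := by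
        rw [← Real.exp_add]; congr 1; push_cast; ring
      rw [h4]
      refine h2.trans (mul_le_mul (by linarith) h1 (wk_nonneg _ _ _ _) (Real.exp_pos _).le)
  exact hstep n le_rfl

end QQ
end BSCover

namespace BSCover
set_option linter.unusedSectionVars false

section Action

/-- affine action, base -/
noncomputable def pa0 (q : ℕ) (hq : 2 ≤ q) : Equiv.Perm (ℚ × ℤ) where
  toFun p := (p.1 / q, p.2 + 1)
  invFun p := (p.1 * q, p.2 - 1)
  left_inv p := by
    have : (q : ℚ) ≠ 0 := by positivity
    ext <;> simp [this]
  right_inv p := by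
    have : (q : ℚ) ≠ 0 := by positivity
    ext <;> simp [this]

noncomputable def pb0 : Equiv.Perm (ℚ × ℤ) where
  toFun p := (p.1 + 1, p.2)
  invFun p := (p.1 - 1, p.2)
  left_inv p := by ext <;> simp
  right_inv p := by ext <;> simp

/-- the lifted action on a `ℤ`-cover -/
noncomputable def pa (q : ℕ) (hq : 2 ≤ q) : Equiv.Perm (ℚ × ℤ × ℤ) where
  toFun p := (p.1 / q, p.2.1 + 1, p.2.2)
  invFun p := (p.1 * q, p.2.1 - 1, p.2.2)
  left_inv p := by
    have : (q : ℚ) ≠ 0 := by positivity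
    ext <;> simp [this]
  right_inv p := by
    have : (q : ℚ) ≠ 0 := by positivity
    ext <;> simp [this]

noncomputable def pb : Equiv.Perm (ℚ × ℤ × ℤ) where
  toFun p := (p.1 + 1, p.2.1, p.2.2 + if p.1 = 0 ∧ p.2.1 = 0 then 1 else 0)
  invFun p := (p.1 - 1, p.2.1, p.2.2 - if p.1 - 1 = 0 ∧ p.2.1 = 0 then 1 else 0)
  left_inv p := by ext <;> simp
  right_inv p := by ext <;> simp

noncomputable def rho0 (q : ℕ) (hq : 2 ≤ q) : FreeGroup (Fin 2) →* Equiv.Perm (ℚ × ℤ) :=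
  FreeGroup.lift ![pa0 q hq, pb0]

noncomputable def rho (q : ℕ) (hq : 2 ≤ q) : FreeGroup (Fin 2) →* Equiv.Perm (ℚ × ℤ × ℤ) :=
  FreeGroup.lift ![pa q hq, pb]

lemma rho_lift (q : ℕ) (hq : 2 ≤ q) (g : FreeGroup (Fin 2)) : ∀ p : ℚ × ℤ, ∃ d : ℤ, ∀ c : ℤ,
    rho q hq g (p.1, p.2, c) = ((rho0 q hq g p).1, (rho0 q hq g p).2, c + d) := by
  induction g using FreeGroup.induction_on with
  | C1 => intro p; exact ⟨0, fun c => by simp⟩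
  | of i =>
    intro p
    fin_cases i
    · exact ⟨0, fun c => by simp [rho, rho0, pa, pa0]⟩
    · exact ⟨if p.1 = 0 ∧ p.2 = 0 then 1 else 0, fun c => by simp [rho, rho0, pb, pb0]⟩
  | inv_of i _ =>
    intro p
    fin_cases i
    · exact ⟨0, fun c => by
        simp only [rho, rho0, map_inv, FreeGroup.lift_apply_of, Equiv.Perm.inv_def]
        simp [pa, pa0, Equiv.symm]⟩
    · exact ⟨-if p.1 - 1 = 0 ∧ p.2 = 0 then 1 else 0, fun c => by
        simp only [rho, rho0, map_inv, FreeGroup.lift_apply_of, Equiv.Perm.inv_def]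
        simp [pb, pb0, Equiv.symm, sub_eq_add_neg]⟩
  | mul x y hx hy =>
    intro p
    obtain ⟨d, hd⟩ := hy p
    obtain ⟨e, he⟩ := hx (rho0 q hq y p)
    refine ⟨d + e, fun c => ?_⟩
    rw [map_mul, map_mul, Equiv.Perm.mul_apply, Equiv.Perm.mul_apply, hd, he]
    simp [add_assoc]

/-- the relator -/
def rel (q : ℕ) : FreeGroup (Fin 2) :=
  (FreeGroup.of 0)⁻¹ * FreeGroup.of 1 * FreeGroup.of 0 * (FreeGroup.of 1) ^ (-(q : ℤ))

lemma pb0_pow (n : ℕ) (p : ℚ × ℤ) : (pb0 ^ n) p = (p.1 + n, p.2) := by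
  induction n with
  | zero => simp
  | succ n ih => rw [pow_succ', Equiv.Perm.mul_apply, ih]; simp [pb0, add_assoc]

lemma pb_pow (n : ℕ) (x : ℚ) (h c : ℤ) (hh : h ≠ 0) : (pb ^ n) (x, h, c) = (x + n, h, c) := by
  induction n with
  | zero => simp
  | succ n ih => rw [pow_succ', Equiv.Perm.mul_apply, ih]; simp [pb, add_assoc, hh]

lemma rho0_rel (q : ℕ) (hq : 2 ≤ q) : rho0 q hq (rel q) = 1 := by
  have hq0 : (q : ℚ) ≠ 0 := by positivity
  have h : rho0 q hq (rel q) = (pa0 q hq)⁻¹ * pb0 * pa0 q hq * (pb0 ^ q)⁻¹ := by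
    simp [rho0, rel]
  rw [h, mul_inv_eq_one, mul_assoc, inv_mul_eq_iff_eq_mul]
  ext1 p
  rw [Equiv.Perm.mul_apply, Equiv.Perm.mul_apply, pb0_pow]
  ext
  · simp only [pa0, pb0, Equiv.coe_fn_mk]; field_simp
  · simp only [pa0, pb0, Equiv.coe_fn_mk]

lemma rho_rel (q : ℕ) (hq : 2 ≤ q) (x : ℚ) (c : ℤ) :
    rho q hq (rel q) (x, -1, c) = (x, -1, c + if x = q then 1 else 0) := by
  have hq0 : (q : ℚ) ≠ 0 := by positivity
  have h : rho q hq (rel q) = (pa q hq)⁻¹ * pb * pa q hq * (pb ^ q)⁻¹ := by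
    simp [rho, rel]
  have h2 : (pb ^ q)⁻¹ (x, -1, c) = (x - q, -1, c) := by
    rw [Equiv.Perm.inv_eq_iff_eq, pb_pow _ _ _ _ (by norm_num)]; simp
  rw [h, Equiv.Perm.mul_apply, h2, Equiv.Perm.mul_apply, Equiv.Perm.mul_apply,
    Equiv.Perm.inv_eq_iff_eq]
  have : (x - q) / q = 0 ↔ x = q := by
    rw [div_eq_zero_iff, sub_eq_zero]; simp [hq0]
  simp [pa, pb, this]
  field_simp
  ring

/-- the traveller words -/
def zw (q : ℕ) : ℕ → ℕ → FreeGroup (Fin 2)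
  | 0, _ => 1
  | r + 1, x => (FreeGroup.of 1) ^ (x % q) * (FreeGroup.of 0)⁻¹ * zw q r (x / q)

lemma rho0_zw (q : ℕ) (hq : 2 ≤ q) (r : ℕ) : ∀ x < q ^ r, ∀ p : ℚ × ℤ,
    rho0 q hq (zw q r x) p = (q ^ r * p.1 + x, p.2 - r) := by
  induction r with
  | zero =>
    intro x hx p
    have : x = 0 := by simpa using hx
    simp [zw, this]
  | succ r ih =>
    intro x hx p
    have hx' : x / q < q ^ r := Nat.div_lt_of_lt_mul (by rwa [pow_succ'] at hx)
    have e : rho0 q hq (zw q (r + 1) x) = pb0 ^ (x % q) * (pa0 q hq)⁻¹ *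
        rho0 q hq (zw q r (x / q)) := by simp [zw, rho0]
    have e2 : (pa0 q hq)⁻¹ (q ^ r * p.1 + (x / q : ℕ), p.2 - r) =
        ((q ^ r * p.1 + (x / q : ℕ)) * q, p.2 - r - 1) := rfl
    rw [e, Equiv.Perm.mul_apply, Equiv.Perm.mul_apply, ih _ hx', e2, pb0_pow]
    have hdm : (q : ℚ) * (x / q : ℕ) + (x % q : ℕ) = x := by exact_mod_cast Nat.div_add_mod x q
    ext
    · dsimp only
      rw [← hdm]; ring
    · push_cast; ring

variable (N : Subgroup (FreeGroup (Fin 2))) [N.Normal]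

lemma rho0_of_mem (q : ℕ) (hq : 2 ≤ q) (hN : N = Subgroup.normalClosure {rel q})
    (g : FreeGroup (Fin 2)) (hg : g ∈ N) : rho0 q hq g = 1 := by
  have : N ≤ (rho0 q hq).ker := by
    rw [hN]
    apply Subgroup.normalClosure_le_normal
    simpa [MonoidHom.mem_ker] using rho0_rel q hq
  exact this hg

lemma comm_le_ker (q : ℕ) (hq : 2 ≤ q) (hN : N = Subgroup.normalClosure {rel q}) :
    ⁅N, N⁆ ≤ (rho q hq).ker := by
  rw [Subgroup.commutator_le]
  intro g hg h hh
  rw [MonoidHom.mem_ker, map_commutatorElement, commutatorElement_eq_one_iff_mul_comm]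
  ext1 ⟨x, y, c⟩
  obtain ⟨d, hd⟩ := rho_lift q hq g (x, y)
  obtain ⟨e, he⟩ := rho_lift q hq h (x, y)
  simp only [rho0_of_mem N q hq hN g hg, rho0_of_mem N q hq hN h hh, Equiv.Perm.one_apply] at hd he
  simp only [Equiv.Perm.mul_apply, hd, he]
  ext <;> simp
  ring

noncomputable def rhoQ (q : ℕ) (hq : 2 ≤ q) (hN : N = Subgroup.normalClosure {rel q}) :
    FreeGroup (Fin 2) ⧸ ⁅N, N⁆ →* Equiv.Perm (ℚ × ℤ × ℤ) :=
  QuotientGroup.lift ⁅N, N⁆ (rho q hq) (fun x hx => comm_le_ker N q hq hN hx)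

lemma chi_exists (q : ℕ) (hq : 2 ≤ q) (hN : N = Subgroup.normalClosure {rel q}) (r : ℕ) :
    ∃ χ : ℕ → FreeGroup (Fin 2) ⧸ ⁅N, N⁆ → ℤ, ∀ x < q ^ r, ∀ y < q ^ r, ∀ g,
      χ x (QuotientGroup.mk (zw q r y * rel q * (zw q r y)⁻¹) * g) =
        χ x g + if x = y then 1 else 0 := by
  refine ⟨fun x g => - (rhoQ N q hq hN g⁻¹ ((x : ℚ) + q ^ (r + 1), -1 - (r : ℤ), 0)).2.2, ?_⟩
  intro x hx y hy g
  have hq0 : (q : ℚ) ≠ 0 := by positivity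
  -- action of the lamp element
  have key : ∀ c : ℤ, rho q hq (zw q r y * rel q * (zw q r y)⁻¹)
      ((x : ℚ) + q ^ (r + 1), -1 - (r : ℤ), c) =
      ((x : ℚ) + q ^ (r + 1), -1 - (r : ℤ), c + if x = y then 1 else 0) := by
    intro c
    set p : ℚ × ℤ := (q + ((x : ℚ) - y) / q ^ r, -1) with hp
    have hpz : rho0 q hq (zw q r y) p = ((x : ℚ) + q ^ (r + 1), -1 - (r : ℤ)) := by
      rw [rho0_zw q hq r y hy, hp]
      ext
      · dsimp only; field_simp; ring
      · simp
    obtain ⟨d, hd⟩ := rho_lift q hq (zw q r y) p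
    rw [hpz] at hd
    dsimp only at hd
    have hinv : (rho q hq (zw q r y))⁻¹ ((x : ℚ) + q ^ (r + 1), -1 - (r : ℤ), c) =
        (p.1, -1, c - d) := by
      rw [Equiv.Perm.inv_eq_iff_eq]
      have := hd (c - d)
      rw [sub_add_cancel] at this
      exact this.symm
    rw [map_mul, map_mul, map_inv, Equiv.Perm.mul_apply, hinv, Equiv.Perm.mul_apply, rho_rel]
    have hiff : p.1 = q ↔ x = y := by
      rw [hp]
      simp only [add_eq_left, div_eq_zero_iff, sub_eq_zero]
      constructor
      · rintro (h | h)
        · exact_mod_cast h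
        · exact absurd h (by positivity)
      · intro h; left; rw [h]
    simp only [hiff]
    have := hd (c - d + if x = y then 1 else 0)
    rw [show p.2 = -1 from rfl] at this
    rw [this]
    ext <;> simp
    ring
  set w := zw q r y * rel q * (zw q r y)⁻¹ with hw
  have hinv : rhoQ N q hq hN (QuotientGroup.mk w)⁻¹ ((x : ℚ) + q ^ (r + 1), -1 - (r : ℤ), 0) =
      ((x : ℚ) + q ^ (r + 1), -1 - (r : ℤ), 0 - if x = y then 1 else 0) := by
    rw [map_inv, Equiv.Perm.inv_eq_iff_eq]
    have h1 : rhoQ N q hq hN (QuotientGroup.mk w) = rho q hq w := rfl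
    rw [h1, key, sub_add_cancel]
  dsimp only
  rw [mul_inv_rev, map_mul, Equiv.Perm.mul_apply, hinv]
  induction g using QuotientGroup.induction_on with
  | H g =>
    obtain ⟨d, hd⟩ := rho_lift q hq g⁻¹ ((x : ℚ) + q ^ (r + 1), -1 - (r : ℤ))
    have h1 : rhoQ N q hq hN (QuotientGroup.mk g)⁻¹ = rho q hq g⁻¹ := rfl
    rw [h1, hd, hd]
    dsimp only
    ring

end Action
end BSCover

namespace BSCover
set_option linter.unusedSectionVars false

section Upper
variable (N : Subgroup (FreeGroup (Fin 2))) [N.Normal]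

/-- the generators of the quotient -/
def gen (i : Fin 2) : FreeGroup (Fin 2) ⧸ ⁅N, N⁆ := QuotientGroup.mk (FreeGroup.of i)

lemma nd_zw (q : ℕ) (hq : 2 ≤ q) (f : FreeGroup (Fin 2) ⧸ ⁅N, N⁆ →₀ ℝ) (δ : ℝ)
    (ha : nd f (gen N 0) ≤ δ) (hb : nd f (gen N 1) ≤ δ) (r : ℕ) :
    ∀ x, nd f (QuotientGroup.mk (zw q r x)) ≤ (q * r) * δ := by
  have hδ : 0 ≤ δ := (nd_nonneg _ _).trans ha
  induction r with
  | zero => intro x; simp [zw, nd_one]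
  | succ r ih =>
    intro x
    have e : (QuotientGroup.mk (zw q (r + 1) x) : FreeGroup (Fin 2) ⧸ ⁅N, N⁆) =
      gen N 1 ^ (x % q) * (gen N 0)⁻¹ * QuotientGroup.mk (zw q r (x / q)) := rfl
    rw [e]
    have h1 := nd_mul f (gen N 1 ^ (x % q) * (gen N 0)⁻¹) (QuotientGroup.mk (zw q r (x / q)))
    have h2 := nd_mul f (gen N 1 ^ (x % q)) (gen N 0)⁻¹
    have h3 := nd_pow f (gen N 1) (x % q)
    have h4 := ih (x / q)
    rw [nd_inv] at h2
    have h5 : ((x % q : ℕ) : ℝ) ≤ q - 1 := by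
      have : x % q + 1 ≤ q := Nat.mod_lt _ (by omega)
      have : ((x % q + 1 : ℕ) : ℝ) ≤ q := by exact_mod_cast this
      push_cast at this; linarith
    have h6 : ((x % q : ℕ) : ℝ) * nd f (gen N 1) ≤ (q - 1) * δ :=
      mul_le_mul h5 hb (nd_nonneg _ _) (le_trans (by positivity) h5)
    push_cast
    nlinarith

lemma nd_rel (q : ℕ) (f : FreeGroup (Fin 2) ⧸ ⁅N, N⁆ →₀ ℝ) (δ : ℝ)
    (ha : nd f (gen N 0) ≤ δ) (hb : nd f (gen N 1) ≤ δ) :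
    nd f (QuotientGroup.mk (rel q)) ≤ (q + 3) * δ := by
  have e : (QuotientGroup.mk (rel q) : FreeGroup (Fin 2) ⧸ ⁅N, N⁆) =
      (gen N 0)⁻¹ * gen N 1 * gen N 0 * (gen N 1 ^ q)⁻¹ := by
    rw [rel, zpow_neg, zpow_natCast]; rfl
  rw [e]
  have h1 := nd_mul f ((gen N 0)⁻¹ * gen N 1 * gen N 0) (gen N 1 ^ q)⁻¹
  have h2 := nd_mul f ((gen N 0)⁻¹ * gen N 1) (gen N 0)
  have h3 := nd_mul f (gen N 0)⁻¹ (gen N 1)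
  have h4 := nd_pow f (gen N 1) q
  rw [nd_inv] at h1 h3
  have h5 : (q : ℝ) * nd f (gen N 1) ≤ q * δ := by gcongr
  linarith

lemma nd_tau (q : ℕ) (hq : 2 ≤ q) (r y : ℕ) (f : FreeGroup (Fin 2) ⧸ ⁅N, N⁆ →₀ ℝ) (δ : ℝ)
    (ha : nd f (gen N 0) ≤ δ) (hb : nd f (gen N 1) ≤ δ) :
    nd f (QuotientGroup.mk (zw q r y * rel q * (zw q r y)⁻¹)) ≤ (2 * q * r + q + 3) * δ := by
  have e : (QuotientGroup.mk (zw q r y * rel q * (zw q r y)⁻¹) : FreeGroup (Fin 2) ⧸ ⁅N, N⁆) =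
    QuotientGroup.mk (zw q r y) * QuotientGroup.mk (rel q) * (QuotientGroup.mk (zw q r y))⁻¹ := rfl
  rw [e]
  have h1 := nd_mul f (QuotientGroup.mk (zw q r y) * QuotientGroup.mk (rel q))
    (QuotientGroup.mk (zw q r y))⁻¹
  have h2 := nd_mul f (QuotientGroup.mk (zw q r y)) (QuotientGroup.mk (rel q))
  have h3 := nd_zw N q hq f δ ha hb r y
  have h4 := nd_rel N q f δ ha hb
  rw [nd_inv] at h1
  linarith

lemma upper (q : ℕ) (hq : 2 ≤ q) (hN : N = Subgroup.normalClosure {rel q}) (C : ℝ)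
    (hC : 15000 * (q : ℝ) ^ 2 ≤ C) (n : ℕ) (hn : 2 ≤ n) :
    wk (gen N 0) (gen N 1) (2 * n) 1 ≤ Real.exp (-(1 / C) * (n : ℝ) / (Real.log n) ^ 2) := by
  set j := Nat.log 2 n with hj
  obtain ⟨χ, hχ⟩ := chi_exists N q hq hN (j + 4)
  have hq2 : (2 : ℝ) ≤ q := by exact_mod_cast hq
  have hn2 : (2 : ℝ) ≤ n := by exact_mod_cast hn
  have hlog2 : (0.69 : ℝ) < Real.log 2 := by linarith [Real.log_two_gt_d9]
  have hlogn : Real.log 2 ≤ Real.log n := Real.log_le_log (by norm_num) hn2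
  have hjn : 2 ^ j ≤ n := Nat.pow_log_le_self 2 (by omega)
  have hnj : n < 2 ^ (j + 1) := Nat.lt_pow_succ_log_self (by norm_num) n
  have hjl : (j : ℝ) * Real.log 2 ≤ Real.log n := by
    rw [← Real.log_pow]
    apply Real.log_le_log (by positivity)
    exact_mod_cast hjn
  have hj0 : (0 : ℝ) ≤ j := by positivity
  have hM : 10 * 2 ^ j ≤ q ^ (j + 4) := by
    calc 10 * 2 ^ j ≤ 2 ^ (j + 4) := by rw [pow_add]; omega
      _ ≤ q ^ (j + 4) := Nat.pow_le_pow_left hq _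
  have hCpos : 0 < C := lt_of_lt_of_le (by positivity) hC
  have hLpos : 0 < Real.log n := by linarith
  have hl1 : (1 : ℝ) ≤ 2 * q * ((j + 4 : ℕ) : ℝ) + q + 3 := by
    have : (0 : ℝ) ≤ 2 * q * ((j + 4 : ℕ) : ℝ) := by positivity
    linarith
  have hdec := wk_decay (gen N 0) (gen N 1) (q ^ (j + 4))
    (fun y => QuotientGroup.mk (zw q (j + 4) y * rel q * (zw q (j + 4) y)⁻¹)) χ hχ
    (2 * q * ((j + 4 : ℕ) : ℝ) + q + 3) hl1
    (fun y _ f δ ha hb => nd_tau N q hq (j + 4) y f δ ha hb) n j hM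
  rcases hdec with h | h
  · refine h.trans ?_
    have h1 : (3 / 5 : ℝ) ≤ Real.exp (-(2 / 5)) := by
      have := Real.add_one_le_exp (-(2 / 5 : ℝ)); linarith
    have h2 : (3 / 5 : ℝ) ^ (2 ^ j) ≤ Real.exp (-(2 / 5)) ^ (2 ^ j) :=
      pow_le_pow_left₀ (by norm_num) h1 _
    refine h2.trans ?_
    rw [← Real.exp_nat_mul]
    apply Real.exp_le_exp.2
    have h3 : (n : ℝ) ≤ 2 * 2 ^ j := by
      have : n ≤ 2 * 2 ^ j := by rw [pow_succ] at hnj; omega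
      exact_mod_cast this
    have h4 : (1 / C) * n / Real.log n ^ 2 ≤ n / 5 := by
      rw [div_le_iff₀ (by positivity), one_div, inv_mul_le_iff₀ hCpos]
      have h5 : (0.4 : ℝ) ≤ Real.log n ^ 2 := by nlinarith
      have h6 : (60000 : ℝ) ≤ C := by nlinarith
      have h7 : (5 : ℝ) ≤ C * Real.log n ^ 2 := by nlinarith
      nlinarith
    have e : -(1 / C) * (n : ℝ) / Real.log n ^ 2 = -((1 / C) * n / Real.log n ^ 2) := by ring
    rw [e]; push_cast; linarith
  · refine h.trans (Real.exp_le_exp.2 ?_)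
    have e : -(1 / C) * (n : ℝ) / Real.log n ^ 2 = -(n / (C * Real.log n ^ 2)) := by
      field_simp
    rw [e]
    apply neg_le_neg
    apply div_le_div_of_nonneg_left (by positivity) (by positivity)
    have hl : 2 * q * ((j + 4 : ℕ) : ℝ) + q + 3 ≤ 25 * q * Real.log n := by
      push_cast
      have a1 : (j : ℝ) ≤ 2 * Real.log n := by nlinarith
      have a2 : (1 : ℝ) ≤ 2 * Real.log n := by linarith
      have a3 : (q : ℝ) * j ≤ q * (2 * Real.log n) := by gcongr
      have a4 : (q : ℝ) * 1 ≤ q * (2 * Real.log n) := by gcongr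
      nlinarith
    calc 24 * (2 * q * ((j + 4 : ℕ) : ℝ) + q + 3) ^ 2 ≤ 24 * (25 * q * Real.log n) ^ 2 := by gcongr
      _ = 15000 * (q : ℝ) ^ 2 * Real.log n ^ 2 := by ring
      _ ≤ _ := by gcongr

end Upper
end BSCover

namespace BSCover
set_option linter.unusedSectionVars false

section LowerAbs
variable {G : Type*} [Group G]

open Classical in
lemma ind_step {P : Type*} (Box : Finset P) (γ : P → G) (Fr : P → ℝ) (S : ℕ → Finset G)
    (l : ℝ) (hl : 0 ≤ l) (f : G →₀ ℝ) (hf : ∀ x, 0 ≤ f x) (n : ℕ) (s : G) (p p' : P)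
    (h : ∀ p ∈ Box, l ^ n * Fr p ≤ EE (fun x => if γ p * x ∈ S n then 1 else 0) f)
    (h1 : p' ∈ Box → ∀ x, γ p' * x ∈ S n → γ p * (s * x) ∈ S (n + 1))
    (h2 : p' ∉ Box → Fr p' ≤ 0) :
    l ^ n * Fr p' ≤ EE (fun x => if γ p * (s * x) ∈ S (n + 1) then 1 else 0) f := by
  by_cases hp : p' ∈ Box
  · refine (h p' hp).trans (EE_mono hf fun x => ?_)
    by_cases hx : γ p' * x ∈ S n
    · simp [hx, h1 hp x hx]
    · simp only [hx, if_false]; split_ifs <;> norm_num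
  · refine (mul_nonpos_of_nonneg_of_nonpos (pow_nonneg hl n) (h2 hp)).trans
      (EE_nonneg hf fun x => ?_)
    split_ifs <;> norm_num

open Classical in
lemma low_ind {P : Type*} (a b : G) (Box : Finset P) (γ : P → G) (Fr : P → ℝ) (S : ℕ → Finset G)
    (l : ℝ) (hl : 0 ≤ l) (sa sa' sb sb' : P → P)
    (h0 : ∀ p ∈ Box, γ p ∈ S 0) (hF : ∀ p, Fr p ≤ 1) (hm : ∀ n, S n ⊆ S (n + 1))
    (ha1 : ∀ p ∈ Box, sa p ∈ Box → ∀ n x, γ (sa p) * x ∈ S n → γ p * (a * x) ∈ S (n + 1))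
    (ha2 : ∀ p ∈ Box, sa p ∉ Box → Fr (sa p) ≤ 0)
    (ha1' : ∀ p ∈ Box, sa' p ∈ Box → ∀ n x, γ (sa' p) * x ∈ S n → γ p * (a⁻¹ * x) ∈ S (n + 1))
    (ha2' : ∀ p ∈ Box, sa' p ∉ Box → Fr (sa' p) ≤ 0)
    (hb1 : ∀ p ∈ Box, sb p ∈ Box → ∀ n x, γ (sb p) * x ∈ S n → γ p * (b * x) ∈ S (n + 1))
    (hb2 : ∀ p ∈ Box, sb p ∉ Box → Fr (sb p) ≤ 0)
    (hb1' : ∀ p ∈ Box, sb' p ∈ Box → ∀ n x, γ (sb' p) * x ∈ S n → γ p * (b⁻¹ * x) ∈ S (n + 1))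
    (hb2' : ∀ p ∈ Box, sb' p ∉ Box → Fr (sb' p) ≤ 0)
    (hh : ∀ p ∈ Box, l * Fr p ≤ 1 / 2 * Fr p
      + 1 / 8 * (Fr (sa p) + Fr (sa' p) + Fr (sb p) + Fr (sb' p))) (n : ℕ) :
    ∀ p ∈ Box, l ^ n * Fr p ≤ EE (fun x => if γ p * x ∈ S n then 1 else 0) (wk a b n) := by
  induction n with
  | zero =>
    intro p hp
    simp [wk, EE, h0 p hp, hF p]
  | succ n ih =>
    intro p hp
    have hf := wk_nonneg a b n
    rw [wk, EE_PP]
    have e0 : l ^ n * Fr p ≤ EE (fun x => if γ p * x ∈ S (n + 1) then 1 else 0) (wk a b n) := by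
      have := ind_step Box γ Fr S l hl (wk a b n) hf n 1 p p ih
        (fun _ x hx => by rw [one_mul]; exact hm n hx) (fun h => absurd hp h)
      simpa using this
    have e1 := ind_step Box γ Fr S l hl (wk a b n) hf n a p (sa p) ih
      (fun h x hx => ha1 p hp h n x hx) (ha2 p hp)
    have e2 := ind_step Box γ Fr S l hl (wk a b n) hf n a⁻¹ p (sa' p) ih
      (fun h x hx => ha1' p hp h n x hx) (ha2' p hp)
    have e3 := ind_step Box γ Fr S l hl (wk a b n) hf n b p (sb p) ih
      (fun h x hx => hb1 p hp h n x hx) (hb2 p hp)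
    have e4 := ind_step Box γ Fr S l hl (wk a b n) hf n b⁻¹ p (sb' p) ih
      (fun h x hx => hb1' p hp h n x hx) (hb2' p hp)
    have e5 := mul_le_mul_of_nonneg_left (hh p hp) (pow_nonneg hl n)
    rw [pow_succ]
    nlinarith

open Classical in
lemma low_cs (a b : G) (S : Finset G) (n : ℕ) :
    EE (fun x => if x ∈ S then 1 else 0) (wk a b n) ^ 2 ≤ wk a b (2 * n) 1 * S.card := by
  rw [wk_even, EE_eq_sum _ _ ((wk a b n).support ∪ S) Finset.subset_union_left,
    ip_eq_sum _ _ ((wk a b n).support ∪ S) Finset.subset_union_left]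
  have := Finset.sum_mul_sq_le_sq_mul_sq ((wk a b n).support ∪ S) (fun x => wk a b n x)
    (fun x => if x ∈ S then (1 : ℝ) else 0)
  refine this.trans (le_of_eq ?_)
  congr 1
  · exact Finset.sum_congr rfl fun x _ => by ring
  · simp [Finset.union_inter_cancel_right, Finset.sum_ite]
    

end LowerAbs

section Usets
variable {A : Type*} [CommGroup A] {ι : Type*} [Fintype ι]

open Classical in
/-- products with bounded exponents -/
noncomputable def UU (f : ι → A) (n : ℕ) : Finset A :=
  (Fintype.piFinset (fun _ : ι => Finset.Icc (-(n : ℤ)) n)).image (fun m => ∏ i, f i ^ m i)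

lemma UU_card (f : ι → A) (n : ℕ) : (UU f n).card ≤ (2 * n + 1) ^ Fintype.card ι := by
  classical
  refine Finset.card_image_le.trans (le_of_eq ?_)
  rw [Fintype.card_piFinset]
  simp only [Int.card_Icc, Finset.prod_const, Finset.card_univ]
  congr 1; omega

lemma mem_UU (f : ι → A) (n : ℕ) (u : A) :
    u ∈ UU f n ↔ ∃ m : ι → ℤ, (∀ i, |m i| ≤ n) ∧ ∏ i, f i ^ m i = u := by
  classical
  simp [UU, Fintype.mem_piFinset, abs_le]

lemma one_mem_UU (f : ι → A) (n : ℕ) : 1 ∈ UU f n :=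
  (mem_UU f n 1).2 ⟨0, by simp, by simp⟩

lemma UU_mono (f : ι → A) (n : ℕ) : UU f n ⊆ UU f (n + 1) := by
  intro u hu
  obtain ⟨m, h1, h2⟩ := (mem_UU f n u).1 hu
  exact (mem_UU f _ u).2 ⟨m, fun i => by push_cast; linarith [h1 i], h2⟩

lemma UU_mul (f : ι → A) (n : ℕ) (i : ι) (e : ℤ) (he : |e| ≤ 1) (u : A) (hu : u ∈ UU f n) :
    f i ^ e * u ∈ UU f (n + 1) := by
  classical
  obtain ⟨m, h1, h2⟩ := (mem_UU f n u).1 hu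
  refine (mem_UU f _ _).2 ⟨fun j => (if j = i then e else 0) + m j, fun j => ?_, ?_⟩
  · refine (abs_add_le _ _).trans ?_
    have := h1 j
    push_cast
    split_ifs
    · linarith
    · simp; linarith
  · simp only [zpow_add, Finset.prod_mul_distrib, h2]
    congr 1
    rw [Finset.prod_eq_single i]
    · simp
    · intro j _ hj; simp [hj]
    · simp

end Usets
end BSCover

namespace BSCover
set_option linter.unusedSectionVars false

section Box
variable {G : Type*} [Group G] {A : Type*} [CommGroup A]

/-- lifts of the box points -/
def gam (a b : G) (p : ℤ × ℤ) : G := b ^ p.1 * a ^ (-p.2)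

/-- shifts -/
def shb (q : ℕ) (p : ℤ × ℤ) : ℤ × ℤ := (p.1 + (q : ℤ) ^ p.2.toNat, p.2)
def shb' (q : ℕ) (p : ℤ × ℤ) : ℤ × ℤ := (p.1 - (q : ℤ) ^ p.2.toNat, p.2)
def sha (p : ℤ × ℤ) : ℤ × ℤ := (p.1, p.2 - 1)
def sha' (p : ℤ × ℤ) : ℤ × ℤ := (p.1, p.2 + 1)

lemma gam_a (a b : G) (p : ℤ × ℤ) : gam a b p * a = gam a b (sha p) := by
  simp only [gam, sha]
  rw [mul_assoc, ← zpow_add_one]; congr 2; ring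

lemma gam_a' (a b : G) (p : ℤ × ℤ) : gam a b p * a⁻¹ = gam a b (sha' p) := by
  simp only [gam, sha']
  rw [mul_assoc, ← zpow_sub_one]; congr 2; ring

/-- the box -/
noncomputable def Bx (L R : ℕ) : Finset (ℤ × ℤ) := Finset.Icc 0 (L : ℤ) ×ˢ Finset.Icc 0 (R : ℤ)

lemma mem_Bx (L R : ℕ) (p : ℤ × ℤ) : p ∈ Bx L R ↔ (0 ≤ p.1 ∧ p.1 ≤ L) ∧ (0 ≤ p.2 ∧ p.2 ≤ R) := by
  simp [Bx]

lemma card_Bx (L R : ℕ) : (Bx L R).card = (L + 1) * (R + 1) := by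
  simp [Bx, Finset.card_product]

open Classical in
/-- the reachable sets -/
noncomputable def SS (a b : G) (j : A →* G) (c : ℤ × ℤ → A) (L R n : ℕ) : Finset G :=
  Finset.image₂ (fun u p => j u * gam a b p) (UU (fun i : Bx L R => c i.1) n) (Bx L R)

lemma SS_card (a b : G) (j : A →* G) (c : ℤ × ℤ → A) (L R n : ℕ) :
    (SS a b j c L R n).card ≤ (2 * n + 1) ^ ((L + 1) * (R + 1)) * ((L + 1) * (R + 1)) := by
  classical
  refine (Finset.card_image₂_le _ _ _).trans ?_
  rw [card_Bx]
  refine Nat.mul_le_mul_right _ ((UU_card _ n).trans (le_of_eq ?_))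
  rw [Fintype.card_coe, card_Bx]

lemma SS_mono (a b : G) (j : A →* G) (c : ℤ × ℤ → A) (L R n : ℕ) :
    SS a b j c L R n ⊆ SS a b j c L R (n + 1) := by
  classical
  exact Finset.image₂_subset_right (UU_mono _ n)

lemma SS_zero (a b : G) (j : A →* G) (c : ℤ × ℤ → A) (L R : ℕ) (p : ℤ × ℤ) (hp : p ∈ Bx L R) :
    gam a b p ∈ SS a b j c L R 0 := by
  classical
  exact Finset.mem_image₂.2 ⟨1, one_mem_UU _ 0, p, hp, by simp⟩

lemma SS_step (a b : G) (j : A →* G) (c : ℤ × ℤ → A) (L R n : ℕ) (p : ℤ × ℤ) (hp : p ∈ Bx L R)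
    (e : ℤ) (he : |e| ≤ 1) (g : G) (hg : g ∈ SS a b j c L R n) :
    j (c p) ^ e * g ∈ SS a b j c L R (n + 1) := by
  classical
  obtain ⟨u, hu, p', hp', rfl⟩ := Finset.mem_image₂.1 hg
  refine Finset.mem_image₂.2 ⟨c p ^ e * u,
    UU_mul (fun i : Bx L R => c i.1) n ⟨p, hp⟩ e he u hu, p', hp', ?_⟩
  simp [mul_assoc]

/-- weight -/
noncomputable def Fw (L R : ℕ) (p : ℤ × ℤ) : ℝ :=
  Real.sin (Real.pi / (R + 2) * (p.2 + 1)) * Real.sin (Real.pi / (L + 2) * (p.1 + 1))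

/-- eigenvalue -/
noncomputable def lam (q L R : ℕ) : ℝ :=
  1 / 2 + 1 / 4 * Real.cos (Real.pi / (R + 2)) + 1 / 4 * Real.cos (Real.pi / (L + 2) * q ^ R)

lemma sin_box (L : ℕ) (x : ℝ) (h0 : 0 ≤ x) (h1 : x ≤ L) :
    0 ≤ Real.sin (Real.pi / (L + 2) * (x + 1)) := by
  have hpi := Real.pi_pos
  apply Real.sin_nonneg_of_nonneg_of_le_pi
  · positivity
  · rw [div_mul_eq_mul_div, div_le_iff₀ (by positivity)]
    nlinarith

lemma sin_box_hi (L : ℕ) (x : ℝ) (h0 : (L : ℝ) + 1 ≤ x) (h1 : x ≤ 2 * L + 3) :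
    Real.sin (Real.pi / (L + 2) * (x + 1)) ≤ 0 := by
  have hpi := Real.pi_pos
  have e1 : Real.pi ≤ Real.pi / (L + 2) * (x + 1) := by
    rw [div_mul_eq_mul_div, le_div_iff₀ (by positivity)]
    nlinarith
  have e2 : Real.pi / (L + 2) * (x + 1) ≤ 2 * Real.pi := by
    rw [div_mul_eq_mul_div, div_le_iff₀ (by positivity)]
    nlinarith
  have := Real.sin_nonneg_of_nonneg_of_le_pi (x := Real.pi / (L + 2) * (x + 1) - Real.pi)
    (by linarith) (by linarith)
  rw [Real.sin_sub_pi] at this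
  linarith

lemma sin_box_lo (L : ℕ) (x : ℝ) (h0 : x ≤ -1) (h1 : -(L + 3 : ℝ) ≤ x) :
    Real.sin (Real.pi / (L + 2) * (x + 1)) ≤ 0 := by
  have hpi := Real.pi_pos
  apply Real.sin_nonpos_of_nonpos_of_neg_pi_le
  · exact mul_nonpos_of_nonneg_of_nonpos (by positivity) (by linarith)
  · rw [div_mul_eq_mul_div, le_div_iff₀ (by positivity)]
    nlinarith

lemma box_lower (a b : G) (j : A →* G) (c : ℤ × ℤ → A) (q L R : ℕ) (hq : 2 ≤ q)
    (hL : q ^ R ≤ L) (hl : 0 ≤ lam q L R)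
    (hc : ∀ p : ℤ × ℤ, 0 ≤ p.2 → j (c p) * gam a b (shb q p) = gam a b p * b) (n : ℕ) :
    (lam q L R ^ n * Fw L R (0, 0)) ^ 2 ≤ wk a b (2 * n) 1 * (SS a b j c L R n).card := by
  classical
  have hpi := Real.pi_pos
  have hqk : ∀ p ∈ Bx L R, (1 : ℝ) ≤ (q : ℝ) ^ p.2.toNat ∧ (q : ℝ) ^ p.2.toNat ≤ q ^ R ∧
      (q : ℝ) ^ p.2.toNat ≤ L := by
    intro p hp
    rw [mem_Bx] at hp
    have h1 : (1 : ℝ) ≤ q := by exact_mod_cast (by omega : 1 ≤ q)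
    have h2 : (q : ℝ) ^ p.2.toNat ≤ q ^ R := pow_le_pow_right₀ h1 (by omega)
    refine ⟨one_le_pow₀ h1, h2, h2.trans (by exact_mod_cast hL)⟩
  have key := low_ind a b (Bx L R) (gam a b) (Fw L R) (SS a b j c L R) (lam q L R) hl
    sha sha' (shb q) (shb' q) (SS_zero a b j c L R) ?_ (SS_mono a b j c L R)
    ?_ ?_ ?_ ?_ ?_ ?_ ?_ ?_ ?_ n (0, 0) (by rw [mem_Bx]; simp)
  · have e : gam a b (0, 0) = 1 := by simp [gam]
    simp only [e, one_mul] at key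
    refine (pow_le_pow_left₀ ?_ key 2).trans (low_cs a b _ n)
    refine mul_nonneg (pow_nonneg hl n) (mul_nonneg ?_ ?_)
    · exact sin_box R _ (by simp) (by simp)
    · exact sin_box L _ (by simp) (by simp)
  · intro p
    have h1 := Real.abs_sin_le_one (Real.pi / (R + 2) * (p.2 + 1))
    have h2 := Real.abs_sin_le_one (Real.pi / (L + 2) * (p.1 + 1))
    refine (le_abs_self _).trans ?_
    rw [Fw, abs_mul]
    exact mul_le_one₀ h1 (abs_nonneg _) h2
  · intro p hp hp' n x hx
    rw [← mul_assoc, gam_a]; exact SS_mono _ _ _ _ _ _ _ hx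
  · intro p hp hp'
    rw [mem_Bx] at hp hp'
    have : p.2 = 0 := by simp only [sha] at hp'; omega
    simp [Fw, sha, this]
  · intro p hp hp' n x hx
    rw [← mul_assoc, gam_a']; exact SS_mono _ _ _ _ _ _ _ hx
  · intro p hp hp'
    rw [mem_Bx] at hp hp'
    have : p.2 = R := by simp only [sha'] at hp'; omega
    have e : Real.pi / (R + 2) * (((R : ℤ) + 1 : ℤ) + 1) = Real.pi := by
      push_cast; field_simp; ring
    simp only [Fw, sha', this, e, Real.sin_pi, zero_mul, le_refl]
  · intro p hp hp' n x hx
    have := SS_step a b j c L R n p hp 1 (by simp) _ hx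
    rw [zpow_one, ← mul_assoc, hc p ((mem_Bx _ _ _).1 hp).2.1, mul_assoc] at this
    exact this
  · intro p hp hp'
    obtain ⟨h1, h2, h3⟩ := hqk p hp
    rw [mem_Bx] at hp hp'
    apply mul_nonpos_of_nonneg_of_nonpos
    · apply sin_box
      · exact_mod_cast hp.2.1
      · exact_mod_cast hp.2.2
    · have e1 : (L : ℤ) + 1 ≤ (shb q p).1 := by
        have : 0 ≤ (q : ℤ) ^ p.2.toNat := by positivity
        simp only [shb] at hp' ⊢; omega
      apply sin_box_hi
      · exact_mod_cast e1
      · have : (p.1 : ℝ) ≤ L := by exact_mod_cast hp.1.2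
        simp only [shb]; push_cast; linarith
  · intro p hp hp' n x hx
    have := SS_step a b j c L R n (shb' q p) hp' (-1) (by simp) _ hx
    have e := hc (shb' q p) ((mem_Bx _ _ _).1 hp').2.1
    have e2 : shb q (shb' q p) = p := by simp [shb, shb']
    rw [e2] at e
    have e3 : gam a b p * b⁻¹ = (j (c (shb' q p))) ^ (-1 : ℤ) * gam a b (shb' q p) := by
      rw [zpow_neg_one, eq_inv_mul_iff_mul_eq, ← mul_assoc, e, mul_inv_cancel_right]
    rw [← mul_assoc, ← e3, mul_assoc] at this
    exact this
  · intro p hp hp'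
    obtain ⟨h1, h2, h3⟩ := hqk p hp
    rw [mem_Bx] at hp hp'
    apply mul_nonpos_of_nonneg_of_nonpos
    · apply sin_box
      · exact_mod_cast hp.2.1
      · exact_mod_cast hp.2.2
    · have e1 : (shb' q p).1 ≤ -1 := by
        have : 0 ≤ (q : ℤ) ^ p.2.toNat := by positivity
        simp only [shb'] at hp' ⊢; omega
      apply sin_box_lo
      · exact_mod_cast e1
      · have : (0 : ℝ) ≤ p.1 := by exact_mod_cast hp.1.1
        simp only [shb']; push_cast; linarith
  · intro p hp
    obtain ⟨h1, h2, h3⟩ := hqk p hp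
    rw [mem_Bx] at hp
    have s1 : 0 ≤ Real.sin (Real.pi / (R + 2) * (p.2 + 1)) :=
      sin_box R _ (by exact_mod_cast hp.2.1) (by exact_mod_cast hp.2.2)
    have s2 : 0 ≤ Real.sin (Real.pi / (L + 2) * (p.1 + 1)) :=
      sin_box L _ (by exact_mod_cast hp.1.1) (by exact_mod_cast hp.1.2)
    have hcos : Real.cos (Real.pi / (L + 2) * q ^ R) ≤ Real.cos (Real.pi / (L + 2) * q ^ p.2.toNat) := by
      apply Real.cos_le_cos_of_nonneg_of_le_pi (by positivity)
      · rw [div_mul_eq_mul_div, div_le_iff₀ (by positivity)]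
        have : (q : ℝ) ^ R ≤ L := by exact_mod_cast hL
        nlinarith
      · gcongr
    simp only [Fw, sha, sha', shb, shb', lam]
    push_cast
    have t1 : Real.sin (Real.pi / (R + 2) * ((p.2 : ℝ) - 1 + 1)) +
        Real.sin (Real.pi / (R + 2) * ((p.2 : ℝ) + 1 + 1)) =
        2 * Real.cos (Real.pi / (R + 2)) * Real.sin (Real.pi / (R + 2) * (p.2 + 1)) := by
      rw [show Real.pi / (R + 2) * ((p.2 : ℝ) - 1 + 1) = Real.pi / (R + 2) * (p.2 + 1) - Real.pi / (R + 2) by ring,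
        show Real.pi / (R + 2) * ((p.2 : ℝ) + 1 + 1) = Real.pi / (R + 2) * (p.2 + 1) + Real.pi / (R + 2) by ring,
        Real.sin_add, Real.sin_sub]
      ring
    have t2 : Real.sin (Real.pi / (L + 2) * ((p.1 : ℝ) + q ^ p.2.toNat + 1)) +
        Real.sin (Real.pi / (L + 2) * ((p.1 : ℝ) - q ^ p.2.toNat + 1)) =
        2 * Real.cos (Real.pi / (L + 2) * q ^ p.2.toNat) * Real.sin (Real.pi / (L + 2) * (p.1 + 1)) := by
      rw [show Real.pi / (L + 2) * ((p.1 : ℝ) + q ^ p.2.toNat + 1) = Real.pi / (L + 2) * (p.1 + 1) + Real.pi / (L + 2) * q ^ p.2.toNat by ring,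
        show Real.pi / (L + 2) * ((p.1 : ℝ) - q ^ p.2.toNat + 1) = Real.pi / (L + 2) * (p.1 + 1) - Real.pi / (L + 2) * q ^ p.2.toNat by ring,
        Real.sin_add, Real.sin_sub]
      ring
    generalize Real.sin (Real.pi / (R + 2) * ((p.2 : ℝ) - 1 + 1)) = A1 at *
    generalize Real.sin (Real.pi / (R + 2) * ((p.2 : ℝ) + 1 + 1)) = A2 at *
    generalize Real.sin (Real.pi / (L + 2) * ((p.1 : ℝ) + q ^ p.2.toNat + 1)) = B1 at *
    generalize Real.sin (Real.pi / (L + 2) * ((p.1 : ℝ) - q ^ p.2.toNat + 1)) = B2 at *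
    generalize Real.sin (Real.pi / (R + 2) * ((p.2 : ℝ) + 1)) = X at *
    generalize Real.sin (Real.pi / (L + 2) * ((p.1 : ℝ) + 1)) = Y at *
    have r1 : A1 * Y + A2 * Y + X * B1 + X * B2 = 2 * Real.cos (Real.pi / (R + 2)) * X * Y
      + 2 * Real.cos (Real.pi / (L + 2) * q ^ p.2.toNat) * (X * Y) := by
      linear_combination Y * t1 + X * t2
    rw [r1]
    nlinarith [mul_le_mul_of_nonneg_right hcos (mul_nonneg s1 s2)]

end Box
end BSCover

namespace BSCover
set_option linter.unusedSectionVars false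

lemma bs_pow {H : Type*} [Group H] (a b : H) (q : ℕ) (h : a⁻¹ * b * a = b ^ q) (k : ℕ) :
    (a ^ k)⁻¹ * b * a ^ k = b ^ (q ^ k) := by
  induction k with
  | zero => simp
  | succ k ih =>
    have : (a ^ (k + 1))⁻¹ * b * a ^ (k + 1) = a⁻¹ * ((a ^ k)⁻¹ * b * a ^ k) * a := by
      rw [pow_succ]; group
    rw [this, ih]
    have h2 := conj_pow (i := q ^ k) (a := a⁻¹) (b := b)
    rw [inv_inv] at h2
    rw [← h2, h, ← pow_mul, pow_succ, mul_comm]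

section Lower
variable (N : Subgroup (FreeGroup (Fin 2))) [N.Normal]

lemma word_mem (q : ℕ) (hN : N = Subgroup.normalClosure {rel q}) (p : ℤ × ℤ) (hp : 0 ≤ p.2) :
    gam (FreeGroup.of 0) (FreeGroup.of 1) p * FreeGroup.of 1 *
      (gam (FreeGroup.of 0) (FreeGroup.of 1) (shb q p))⁻¹ ∈ N := by
  have hr : rel q ∈ N := by rw [hN]; exact Subgroup.subset_normalClosure (by simp)
  rw [← QuotientGroup.eq_one_iff] at hr ⊢
  set a : FreeGroup (Fin 2) ⧸ N := QuotientGroup.mk (FreeGroup.of 0) with ha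
  set b : FreeGroup (Fin 2) ⧸ N := QuotientGroup.mk (FreeGroup.of 1) with hb
  have hr' : a⁻¹ * b * a * b ^ (-(q : ℤ)) = 1 := hr
  rw [zpow_neg, mul_inv_eq_one, zpow_natCast] at hr'
  obtain ⟨x, k⟩ := p
  lift k to ℕ using hp
  have h2 := bs_pow a b q hr' k
  change b ^ x * a ^ (-(k : ℤ)) * b * (b ^ (x + (q : ℤ) ^ k) * a ^ (-(k : ℤ)))⁻¹ = 1
  have e : b ^ ((q : ℤ) ^ k) = b ^ (q ^ k) := by
    rw [← zpow_natCast b]; push_cast; rfl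
  rw [zpow_add, e, ← h2]
  simp only [zpow_neg, zpow_natCast]
  group

lemma lower_group (q : ℕ) (hq : 2 ≤ q) (hN : N = Subgroup.normalClosure {rel q}) (L R : ℕ)
    (hL : q ^ R ≤ L) (hl : 0 ≤ lam q L R) (n : ℕ) :
    (lam q L R ^ n * Fw L R (0, 0)) ^ 2 ≤ wk (gen N 0) (gen N 1) (2 * n) 1 *
      (((2 * n + 1) ^ ((L + 1) * (R + 1)) * ((L + 1) * (R + 1)) : ℕ) : ℝ) := by
  classical
  let M : Subgroup (FreeGroup (Fin 2) ⧸ ⁅N, N⁆) := N.map (QuotientGroup.mk' ⁅N, N⁆)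
  have hcomm : ∀ x ∈ M, ∀ y ∈ M, x * y = y * x := by
    rintro _ ⟨x, hx, rfl⟩ _ ⟨y, hy, rfl⟩
    rw [← map_mul, ← map_mul]
    apply (QuotientGroup.eq).2
    have := Subgroup.commutator_mem_commutator (N.inv_mem hy) (N.inv_mem hx)
    convert this using 1
    rw [commutatorElement_def]; group
  let _ : CommGroup M := { (inferInstance : Group M) with
    mul_comm := fun x y => Subtype.ext (hcomm x.1 x.2 y.1 y.2) }
  let c : ℤ × ℤ → M := fun p => if hp : 0 ≤ p.2 then
    ⟨QuotientGroup.mk' ⁅N, N⁆ _, Subgroup.mem_map_of_mem _ (word_mem N q hN p hp)⟩ else 1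
  have h := box_lower (gen N 0) (gen N 1) M.subtype c q L R hq hL hl (fun p hp => by
    simp only [c, hp, dif_pos, Subgroup.coe_subtype]
    have e : ∀ p, gam (gen N 0) (gen N 1) p = QuotientGroup.mk' ⁅N, N⁆
      (gam (FreeGroup.of 0) (FreeGroup.of 1) p) := fun p => rfl
    have e1 : gen N 1 = QuotientGroup.mk' ⁅N, N⁆ (FreeGroup.of 1) := rfl
    rw [e, e, e1, ← map_mul, ← map_mul, inv_mul_cancel_right]) n
  refine h.trans (mul_le_mul_of_nonneg_left ?_ (wk_nonneg _ _ _ _))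
  exact_mod_cast SS_card _ _ _ _ _ _ _

end Lower

lemma num_lam (q R : ℕ) (hq : 2 ≤ q) : 1 / 2 ≤ lam q (q ^ (2 * R)) R ∧
    1 - 7 / ((R : ℝ) + 2) ^ 2 ≤ lam q (q ^ (2 * R)) R := by
  have hpi := Real.pi_pos
  have hpi4 := Real.pi_lt_d2
  set Q : ℝ := (q : ℝ) ^ R with hQ
  have hq2 : (2 : ℝ) ≤ q := by exact_mod_cast hq
  have hQ2 : ((q ^ (2 * R) : ℕ) : ℝ) = Q ^ 2 := by push_cast; rw [hQ, ← pow_mul, mul_comm]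
  have hQ1 : (R : ℝ) + 1 ≤ Q := by
    have h1 : (2 : ℝ) ^ R ≤ Q := pow_le_pow_left₀ (by norm_num) hq2 R
    have h2 : R + 1 ≤ 2 ^ R := Nat.lt_two_pow_self
    have h3 : (R : ℝ) + 1 ≤ 2 ^ R := by exact_mod_cast h2
    linarith
  have hR : (0 : ℝ) ≤ R := Nat.cast_nonneg R
  simp only [lam, hQ2, ← hQ]
  have b0 : 0 ≤ Real.pi / (Q ^ 2 + 2) * Q := by positivity
  have b1 : Real.pi / (Q ^ 2 + 2) * Q ≤ Real.pi / 2 := by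
    rw [div_mul_eq_mul_div, div_le_div_iff₀ (by positivity) (by positivity)]
    nlinarith [sq_nonneg (Q - 1)]
  have b2 : Real.pi / (Q ^ 2 + 2) * Q ≤ 2 * Real.pi / (R + 2) := by
    rw [div_mul_eq_mul_div, div_le_div_iff₀ (by positivity) (by positivity)]
    have : Q * (R + 2) ≤ 2 * (Q ^ 2 + 2) := by nlinarith
    nlinarith
  have a1 : Real.pi / ((R : ℝ) + 2) ≤ Real.pi / 2 := by
    apply div_le_div_of_nonneg_left hpi.le (by norm_num) (by linarith)
  have a0 : 0 ≤ Real.pi / ((R : ℝ) + 2) := by positivity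
  constructor
  · have := Real.cos_nonneg_of_neg_pi_div_two_le_of_le (by linarith) a1
    have := Real.cos_nonneg_of_neg_pi_div_two_le_of_le (by linarith) b1
    linarith
  · have h1 := Real.one_sub_sq_div_two_le_cos (x := Real.pi / ((R : ℝ) + 2))
    have h2 := Real.one_sub_sq_div_two_le_cos (x := Real.pi / (Q ^ 2 + 2) * Q)
    have h3 := pow_le_pow_left₀ b0 b2 2
    have h4 : (2 * Real.pi / ((R : ℝ) + 2)) ^ 2 = 4 * (Real.pi / ((R : ℝ) + 2)) ^ 2 := by ring
    have h5 : (Real.pi / ((R : ℝ) + 2)) ^ 2 ≤ 10 / ((R : ℝ) + 2) ^ 2 := by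
      rw [div_pow]; gcongr; nlinarith
    have h6 : 7 / ((R : ℝ) + 2) ^ 2 = 7 / 10 * (10 / ((R : ℝ) + 2) ^ 2) := by ring
    have h7 : 0 ≤ 10 / ((R : ℝ) + 2) ^ 2 := by positivity
    linarith

lemma num_Fw (L R : ℕ) : 1 / (((R : ℝ) + 2) * (L + 2)) ≤ Fw L R (0, 0) := by
  have hpi := Real.pi_pos
  have key : ∀ m : ℕ, 1 / ((m : ℝ) + 2) ≤ Real.sin (Real.pi / (m + 2)) := by
    intro m
    have h1 : Real.pi / ((m : ℝ) + 2) ≤ Real.pi / 2 :=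
      div_le_div_of_nonneg_left hpi.le (by norm_num) (by linarith [(Nat.cast_nonneg m : (0 : ℝ) ≤ m)])
    have h := Real.mul_le_sin (x := Real.pi / ((m : ℝ) + 2)) (by positivity) h1
    refine le_trans ?_ h
    rw [div_mul_div_comm, mul_comm 2, mul_div_mul_left _ _ hpi.ne']
    gcongr; norm_num
  simp only [Fw, Int.cast_zero, zero_add, mul_one]
  rw [← one_div_mul_one_div]
  exact mul_le_mul (key R) (key L) (by positivity) ((by positivity : (0 : ℝ) ≤ _).trans (key R))

end BSCover

namespace BSCover
set_option linter.unusedSectionVars false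

set_option maxHeartbeats 1600000 in
lemma num_final (q n R : ℕ) (hq : 2 ≤ q) (hn : 2 ≤ n) (hR : R = Nat.log q n / 6) (W lm F : ℝ)
    (h1 : 1 / 2 ≤ lm) (h2 : 1 - 7 / ((R : ℝ) + 2) ^ 2 ≤ lm)
    (hF : 1 / (((R : ℝ) + 2) * ((q ^ (2 * R) : ℕ) + 2)) ≤ F)
    (hW : (lm ^ n * F) ^ 2 ≤ W * (((2 * n + 1) ^ ((q ^ (2 * R) + 1) * (R + 1)) *
      ((q ^ (2 * R) + 1) * (R + 1)) : ℕ) : ℝ)) (C : ℝ) (hC : 6000 * (q : ℝ) ^ 2 ≤ C) :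
    Real.exp (-C * n / (Real.log n) ^ 2) ≤ W := by
  have hq2 : (2 : ℝ) ≤ q := by exact_mod_cast hq
  have hn2 : (2 : ℝ) ≤ n := by exact_mod_cast hn
  have hRR : (0 : ℝ) ≤ R := Nat.cast_nonneg R
  set ℓ := Real.log n with hℓ
  have hℓ0 : 0 < ℓ := Real.log_pos (by linarith)
  set Q : ℝ := (q : ℝ) ^ R with hQ
  have hQ2 : ((q ^ (2 * R) : ℕ) : ℝ) = Q ^ 2 := by push_cast; rw [hQ, ← pow_mul, mul_comm]
  have hQ1 : (R : ℝ) + 1 ≤ Q := by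
    have h1 : (2 : ℝ) ^ R ≤ Q := pow_le_pow_left₀ (by norm_num) hq2 R
    have h2 : R + 1 ≤ 2 ^ R := Nat.lt_two_pow_self
    have h3 : (R : ℝ) + 1 ≤ 2 ^ R := by exact_mod_cast h2
    linarith
  have hQ11 : 1 ≤ Q := by linarith
  have hQ6 : Q ^ 6 ≤ n := by
    have e1 : q ^ (6 * R) ≤ q ^ Nat.log q n := Nat.pow_le_pow_right (by omega) (by omega)
    have e2 : q ^ Nat.log q n ≤ n := Nat.pow_log_le_self q (by omega)
    have e3 : ((q ^ (6 * R) : ℕ) : ℝ) ≤ n := by exact_mod_cast e1.trans e2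
    push_cast at e3
    rwa [mul_comm, pow_mul] at e3
  have hnlt : ℓ ≤ 6 * (R + 2) * q := by
    have e1 : n < q ^ (6 * (R + 2)) :=
      (Nat.lt_pow_succ_log_self (by omega) n).trans_le (Nat.pow_le_pow_right (by omega) (by omega))
    have e2 : (n : ℝ) ≤ (q : ℝ) ^ (6 * (R + 2)) := by exact_mod_cast e1.le
    have e3 := Real.log_le_log (by linarith) e2
    rw [Real.log_pow] at e3
    push_cast at e3
    have e4 : Real.log q ≤ q := by linarith [Real.log_le_sub_one_of_pos (by linarith : (0 : ℝ) < q)]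
    refine e3.trans (mul_le_mul_of_nonneg_left e4 (by positivity))
  set B : ℝ := Q ^ 3 with hB
  have hB1 : 1 ≤ B := one_le_pow₀ hQ11
  have hBn : B ≤ Real.sqrt n := Real.le_sqrt_of_sq_le (by rw [hB, ← pow_mul]; exact hQ6)
  have hsn : Real.sqrt n * Real.sqrt n = n := Real.mul_self_sqrt (by linarith)
  have hs0 : 0 ≤ Real.sqrt n := Real.sqrt_nonneg n
  have hl6 : ℓ ^ 3 ≤ 216 * Real.sqrt n := by
    have := Real.log_le_rpow_div (x := n) (by linarith) (ε := 1 / 6) (by norm_num)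
    have := pow_le_pow_left₀ hℓ0.le this 3
    refine this.trans (le_of_eq ?_)
    rw [div_pow, ← Real.rpow_natCast, ← Real.rpow_mul (by linarith), Real.sqrt_eq_rpow]
    norm_num; ring
  have hl4 : ℓ ^ 2 ≤ 16 * Real.sqrt n := by
    have := Real.log_le_rpow_div (x := n) (by linarith) (ε := 1 / 4) (by norm_num)
    have := pow_le_pow_left₀ hℓ0.le this 2
    refine this.trans (le_of_eq ?_)
    rw [div_pow, ← Real.rpow_natCast, ← Real.rpow_mul (by linarith), Real.sqrt_eq_rpow]
    norm_num; ring
  -- box sizes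
  have hK1 : ((R : ℝ) + 2) * (Q ^ 2 + 2) ≤ 6 * B := by
    have : (R : ℝ) + 2 ≤ 2 * Q := by linarith
    have h' : Q ^ 2 + 2 ≤ 3 * Q ^ 2 := by nlinarith
    calc ((R : ℝ) + 2) * (Q ^ 2 + 2) ≤ (2 * Q) * (3 * Q ^ 2) := by gcongr
      _ = 6 * B := by rw [hB]; ring
  have hK2 : (((q ^ (2 * R) + 1) * (R + 1) : ℕ) : ℝ) ≤ 6 * B := by
    rw [Nat.cast_mul, Nat.cast_add, hQ2]; push_cast
    nlinarith
  have hexp6 : 6 * B ≤ Real.exp (6 * B) := by linarith [Real.add_one_le_exp (6 * B)]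
  -- eigenvalue
  have hlm : Real.exp (-(14 * n / ((R : ℝ) + 2) ^ 2)) ≤ lm ^ n := by
    have e1 := Real.one_sub_inv_le_log_of_pos (by linarith : 0 < lm)
    have e2 : lm⁻¹ - 1 ≤ 14 / ((R : ℝ) + 2) ^ 2 := by
      have e3 : lm⁻¹ ≤ 2 := by
        rw [inv_le_comm₀ (by linarith) (by norm_num)]; linarith
      have e4 : lm⁻¹ - 1 = (1 - lm) * lm⁻¹ := by field_simp
      have e6 : 14 / ((R : ℝ) + 2) ^ 2 = 7 / ((R : ℝ) + 2) ^ 2 * 2 := by ring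
      rw [e4, e6]
      have : 0 < lm⁻¹ := by positivity
      exact mul_le_mul (by linarith) e3 this.le (by positivity)
    rw [← Real.exp_log (by linarith : 0 < lm), ← Real.exp_nat_mul]
    apply Real.exp_le_exp.2
    have : (n : ℝ) * (14 / ((R : ℝ) + 2) ^ 2) = 14 * n / ((R : ℝ) + 2) ^ 2 := by ring
    nlinarith
  have hFF : Real.exp (-(6 * B)) ≤ F := by
    refine le_trans ?_ hF
    rw [hQ2, Real.exp_neg, ← one_div]
    apply one_div_le_one_div_of_le (by positivity)
    linarith
  -- cardinality
  have hcard : (((2 * n + 1) ^ ((q ^ (2 * R) + 1) * (R + 1)) *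
      ((q ^ (2 * R) + 1) * (R + 1)) : ℕ) : ℝ) ≤ Real.exp (18 * B * ℓ) * Real.exp (6 * B) := by
    rw [Nat.cast_mul]
    refine mul_le_mul ?_ (hK2.trans hexp6) (by positivity) (by positivity)
    have e1 : (2 * n + 1 : ℝ) ≤ Real.exp (3 * ℓ) := by
      have : Real.exp (3 * ℓ) = (n : ℝ) ^ 3 := by
        rw [hℓ, mul_comm, Real.exp_mul, Real.exp_log (by linarith)]; norm_cast
      rw [this]; nlinarith [mul_nonneg (sub_nonneg.2 hn2) (sub_nonneg.2 hn2)]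
    rw [Nat.cast_pow]
    push_cast
    refine (pow_le_pow_left₀ (by positivity) e1 _).trans ?_
    rw [← Real.exp_nat_mul]
    apply Real.exp_le_exp.2
    generalize (((q ^ (2 * R) + 1) * (R + 1) : ℕ) : ℝ) = K at hK2 ⊢
    have := mul_le_mul_of_nonneg_right hK2 hℓ0.le
    linarith
  have hW0 : 0 ≤ W := by
    by_contra hneg
    push Not at hneg
    have p1 : 0 < (lm ^ n * F) ^ 2 := by
      have : 0 < F := (Real.exp_pos _).trans_le hFF
      have : 0 < lm := by linarith
      positivity
    have p2 := mul_nonpos_of_nonpos_of_nonneg hneg.le (Nat.cast_nonneg (α := ℝ)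
      ((2 * n + 1) ^ ((q ^ (2 * R) + 1) * (R + 1)) * ((q ^ (2 * R) + 1) * (R + 1))))
    linarith
  have hfin : (Real.exp (-(14 * n / ((R : ℝ) + 2) ^ 2)) * Real.exp (-(6 * B))) ^ 2 ≤
      W * (Real.exp (18 * B * ℓ) * Real.exp (6 * B)) := by
    refine le_trans ?_ (hW.trans (mul_le_mul_of_nonneg_left hcard hW0))
    have := Real.exp_pos (-(6 * B))
    gcongr
  have hfin2 : Real.exp (-(28 * n / ((R : ℝ) + 2) ^ 2 + 18 * B + 18 * B * ℓ)) ≤ W := by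
    rw [← Real.exp_add, ← Real.exp_add, ← Real.exp_nat_mul] at hfin
    rw [← div_le_iff₀ (Real.exp_pos _), ← Real.exp_sub] at hfin
    refine le_trans (le_of_eq ?_) hfin
    congr 1; push_cast; ring
  refine le_trans (Real.exp_le_exp.2 ?_) hfin2
  rw [neg_mul, neg_div, neg_le_neg_iff, le_div_iff₀ (by positivity)]
  have t1 : 28 * n / ((R : ℝ) + 2) ^ 2 * ℓ ^ 2 ≤ 1008 * (q : ℝ) ^ 2 * n := by
    rw [div_mul_eq_mul_div, div_le_iff₀ (by positivity)]
    have := pow_le_pow_left₀ hℓ0.le hnlt 2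
    nlinarith [mul_le_mul_of_nonneg_left this (by linarith : (0 : ℝ) ≤ 28 * n)]
  have t2 : B * ℓ ^ 2 ≤ 16 * n := by
    calc B * ℓ ^ 2 ≤ Real.sqrt n * (16 * Real.sqrt n) := by gcongr
      _ = 16 * n := by linear_combination 16 * hsn
  have t3 : B * ℓ ^ 3 ≤ 216 * n := by
    calc B * ℓ ^ 3 ≤ Real.sqrt n * (216 * Real.sqrt n) := by gcongr
      _ = 216 * n := by linear_combination 216 * hsn
  have t4 : 6000 * (q : ℝ) ^ 2 * n ≤ C * n := by gcongr
  have t5 : 4 * (n : ℝ) ≤ (q : ℝ) ^ 2 * n := by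
    have : (4 : ℝ) ≤ (q : ℝ) ^ 2 := by nlinarith
    gcongr
  nlinarith

lemma lower (N : Subgroup (FreeGroup (Fin 2))) [N.Normal] (q : ℕ) (hq : 2 ≤ q)
    (hN : N = Subgroup.normalClosure {rel q}) (C : ℝ) (hC : 6000 * (q : ℝ) ^ 2 ≤ C)
    (n : ℕ) (hn : 2 ≤ n) :
    Real.exp (-C * n / (Real.log n) ^ 2) ≤ wk (gen N 0) (gen N 1) (2 * n) 1 := by
  have h1 := num_lam q (Nat.log q n / 6) hq
  refine num_final q n _ hq hn rfl _ _ _ h1.1 h1.2 (num_Fw _ _)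
    (lower_group N q hq hN _ _ ?_ (by linarith [h1.1]) n) C hC
  exact Nat.pow_le_pow_right (by omega) (by omega)

end BSCover

namespace BSCover
set_option linter.unusedSectionVars false

open Classical in
lemma lazySRW_eq (g : FreeGroup (Fin 2)) : lazySRW 2 g =
    (Finsupp.single (1 : FreeGroup (Fin 2)) (1 / 2 : ℝ) + (Finsupp.single (FreeGroup.of 0) (1 / 8 : ℝ)
      + Finsupp.single (FreeGroup.of 0)⁻¹ (1 / 8 : ℝ) + Finsupp.single (FreeGroup.of 1) (1 / 8 : ℝ)
      + Finsupp.single (FreeGroup.of 1)⁻¹ (1 / 8 : ℝ)) : FreeGroup (Fin 2) →₀ ℝ) g := by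
  have n0 : ∀ i : Fin 2, FreeGroup.of i ≠ 1 := fun i => FreeGroup.of_ne_one i
  have n1 : ∀ i j : Fin 2, FreeGroup.of i ≠ (FreeGroup.of j)⁻¹ := by
    intro i j h
    have := congrArg FreeGroup.toWord h
    simp [FreeGroup.toWord_inv, FreeGroup.invRev] at this
  have n01 : FreeGroup.of (0 : Fin 2) ≠ FreeGroup.of 1 := fun h => by
    have := FreeGroup.of_injective h; simp at this
  have n1' : ∀ i j : Fin 2, (FreeGroup.of j)⁻¹ ≠ FreeGroup.of i := fun i j => (n1 i j).symm
  have n0' : ∀ i : Fin 2, 1 ≠ FreeGroup.of i := fun i => (n0 i).symm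
  simp only [lazySRW, Fin.exists_fin_two, Finsupp.add_apply, Finsupp.single_apply]
  by_cases h1 : g = 1
  · subst h1; simp [n0]
  by_cases h2 : g = FreeGroup.of 0
  · subst h2; simp [n0, n0', n1', n01.symm]; norm_num
  by_cases h3 : g = (FreeGroup.of 0)⁻¹
  · subst h3; simp [n0, n0', n1, n01.symm]; norm_num
  by_cases h4 : g = FreeGroup.of 1
  · subst h4; simp [n0, n0', n1', n01]; norm_num
  by_cases h5 : g = (FreeGroup.of 1)⁻¹
  · subst h5; simp [n0, n0', n1, n01]; norm_num
  simp [h1, h2, h3, h4, h5, Ne.symm h1, Ne.symm h2, Ne.symm h3, Ne.symm h4, Ne.symm h5]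

lemma pushforward_finsupp {G H : Type*} (f : G → H) (μ : G →₀ ℝ) :
    pushforward f (fun g => μ g) = fun h => Finsupp.mapDomain f μ h := by
  classical
  funext h
  simp only [pushforward]
  refine (tsum_subtype {g | f g = h} (fun g => μ g)).trans ?_
  rw [tsum_eq_sum (s := μ.support)]
  · rw [Finsupp.mapDomain, Finsupp.sum, Finsupp.finsetSum_apply]
    refine Finset.sum_congr rfl fun g _ => ?_
    simp [Set.indicator_apply, Finsupp.single_apply]
  · intro g hg
    simp [Set.indicator_apply, Finsupp.notMem_support_iff.1 hg]

lemma convPow_eq (N : Subgroup (FreeGroup (Fin 2))) [N.Normal] (n : ℕ) :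
    convPow (lazySRWQuot 2 ⁅N, N⁆) n = fun g => wk (gen N 0) (gen N 1) n g := by
  classical
  induction n with
  | zero => funext g; simp [convPow, wk, Finsupp.single_apply, eq_comm]
  | succ n ih =>
    funext g
    have e1 : lazySRW 2 = fun g => _ := funext lazySRW_eq
    have e2 : lazySRWQuot 2 ⁅N, N⁆ = fun g =>
        (Finsupp.single (1 : FreeGroup (Fin 2) ⧸ ⁅N, N⁆) (1 / 2 : ℝ)
        + (Finsupp.single (gen N 0) (1 / 8 : ℝ)
      + Finsupp.single (gen N 0)⁻¹ (1 / 8 : ℝ) + Finsupp.single (gen N 1) (1 / 8 : ℝ)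
      + Finsupp.single (gen N 1)⁻¹ (1 / 8 : ℝ)) : FreeGroup (Fin 2) ⧸ ⁅N, N⁆ →₀ ℝ) g := by
      rw [lazySRWQuot, e1, pushforward_finsupp]
      simp only [Finsupp.mapDomain_add, Finsupp.mapDomain_single]
      rfl
    simp only [convPow, conv]
    rw [ih]
    rw [e2]
    set ν : FreeGroup (Fin 2) ⧸ ⁅N, N⁆ →₀ ℝ := _ + _ with hν
    rw [tsum_eq_sum (s := ν.support) (fun x hx => by
      simp [Finsupp.notMem_support_iff.1 hx])]
    have := EE_def (fun h => wk (gen N 0) (gen N 1) n (h⁻¹ * g)) ν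
    rw [← this, hν]
    simp only [wk, PP, map_add, EE, Finsupp.linearCombination_single, Finsupp.add_apply,
      Finsupp.smul_apply, Lt_apply, smul_eq_mul, inv_one, one_mul]
    ring

end BSCover

/-- Theorem: for the presentation `BS(1,q) = ⟨a,b | a⁻¹ b a = b^q⟩ = F_2/N` (`q ≥ 2`),
the lazy simple random walk on `Γ₂(N) = F_2/[N,N]` satisfies
`μ^{(2n)}(e) ≍ exp(− n/(log n)²)`. -/
theorem return_probability_baumslag_solitar_cover (q : ℕ) (hq : 2 ≤ q)
    (N : Subgroup (FreeGroup (Fin 2)))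
    (hN : N = Subgroup.normalClosure
      {(FreeGroup.of 0)⁻¹ * FreeGroup.of 1 * FreeGroup.of 0 * (FreeGroup.of 1) ^ (-(q : ℤ))})
    [N.Normal] :
    ∃ C : ℝ, 1 ≤ C ∧ ∀ n : ℕ, 2 ≤ n →
      Real.exp (-C * (n : ℝ) / (Real.log n) ^ 2)
        ≤ convPow (lazySRWQuot 2 ⁅N, N⁆) (2 * n) 1 ∧
      convPow (lazySRWQuot 2 ⁅N, N⁆) (2 * n) 1
        ≤ Real.exp (-(1 / C) * (n : ℝ) / (Real.log n) ^ 2) := by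
  have hq2 : (2 : ℝ) ≤ q := by exact_mod_cast hq
  refine ⟨15000 * (q : ℝ) ^ 2, by nlinarith, fun n hn => ?_⟩
  rw [BSCover.convPow_eq]
  exact ⟨BSCover.lower N q hq hN _ (by nlinarith) n hn,
    BSCover.upper N q hq hN _ le_rfl n hn⟩

end
end
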